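/- arXiv:1810.05280 — 3 statements merged into one kernel-verified Lean document; each statement's English description precedes it below -/
import Mathlib

section
/- If a finite simple graph G satisfies the NC property, then its DP-chromatic number satisfies χ_DP(G) ≤ ω(G) + 1, where ω(G) is the clique number of G. Moreover, if in addition G has no K_n minor, then χ_DP(G) ≤ n − 1. -/
open SimpleGraph

variable {V : Type*}

/-- A *hole* of `G`: an induced cycle of length at least 4, given as a closed walk. -/
def IsHole (G : SimpleGraph V) {a : V} (w : G.Walk a a) : Prop :=
  w.IsCycle ∧ 4 ≤ w.length ∧
    ∀ x y : V, x ∈ w.support → y ∈ w.support → G.Adj x y → s(x, y) ∈ w.edges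

/-- A graph is *chordal* if it has no hole. -/
def IsChordal (G : SimpleGraph V) : Prop :=
  ∀ (a : V) (w : G.Walk a a), ¬ IsHole G w

/-- Two edge lists share two consecutive edges. -/
def ShareTwoConsecutiveEdges (l₁ l₂ : List (Sym2 V)) : Prop :=
  ∃ x y z : V, x ≠ z ∧ s(x, y) ∈ l₁ ∧ s(y, z) ∈ l₁ ∧ s(x, y) ∈ l₂ ∧ s(y, z) ∈ l₂

/-- A vertex `u` satisfies the *NC property* in `G`: no hole through `u` and
no hole avoiding `u` share two consecutive edges. -/
def VertexNC (G : SimpleGraph V) (u : V) : Prop :=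
  ∀ (a b : V) (w₁ : G.Walk a a) (w₂ : G.Walk b b),
    IsHole G w₁ → IsHole G w₂ → u ∈ w₁.support → u ∉ w₂.support →
      ¬ ShareTwoConsecutiveEdges w₁.edges w₂.edges

/-- A *hole cover* of `G`: a nonempty vertex set meeting every hole of `G`. -/
def IsHoleCover (G : SimpleGraph V) (C : Set V) : Prop :=
  C.Nonempty ∧ ∀ (a : V) (w : G.Walk a a), IsHole G w → ∃ u ∈ C, u ∈ w.support

/-- A vertex set `C` satisfies the *NC property* in `G`: every vertex of `C`
satisfies the NC property and every hole of `G` contains at most one vertex of `C`. -/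
def SetNC (G : SimpleGraph V) (C : Set V) : Prop :=
  (∀ u ∈ C, VertexNC G u) ∧
    ∀ (a : V) (w : G.Walk a a), IsHole G w →
      ∀ u ∈ C, ∀ v ∈ C, u ∈ w.support → v ∈ w.support → u = v

/-- A graph satisfies the *NC property* if it has a hole cover satisfying the NC property. -/
def HasNCProperty (G : SimpleGraph V) : Prop :=
  ∃ C : Set V, IsHoleCover G C ∧ SetNC G C

/-- A DP-cover of `G` with lists of size `k`, realized on the vertex set `V × Fin k`:
the fibers `{v} × Fin k` are cliques, cross edges exist only over edges of `G`,
and the edges between two fibers form a matching. -/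
def IsDPCover (G : SimpleGraph V) (k : ℕ) (H : SimpleGraph (V × Fin k)) : Prop :=
  (∀ (v : V) (i j : Fin k), i ≠ j → H.Adj (v, i) (v, j)) ∧
  (∀ (u v : V) (i j : Fin k), u ≠ v → H.Adj (u, i) (v, j) → G.Adj u v) ∧
  (∀ (u v : V) (i j j' : Fin k), u ≠ v → H.Adj (u, i) (v, j) → H.Adj (u, i) (v, j') → j = j')

/-- `G` is DP-`k`-colorable: every DP-cover with lists of size `k` admits an
independent transversal. -/
def DPColorable (G : SimpleGraph V) (k : ℕ) : Prop :=
  ∀ H : SimpleGraph (V × Fin k), IsDPCover G k H →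
    ∃ f : V → Fin k, ∀ u v : V, ¬ H.Adj (u, f u) (v, f v)

/-- The DP-chromatic number: the least `k` such that `G` is DP-`k`-colorable. -/
noncomputable def dpChromaticNumber (G : SimpleGraph V) : ℕ :=
  sInf {k | DPColorable G k}

/-- `M` is a minor of `G`, via the branch-set characterization. -/
def HasMinor {W : Type*} (G : SimpleGraph V) (M : SimpleGraph W) : Prop :=
  ∃ B : W → Set V,
    (∀ i, (B i).Nonempty) ∧
    (∀ i, (G.induce (B i)).Connected) ∧
    (Pairwise fun i j => Disjoint (B i) (B j)) ∧
    ∀ i j, M.Adj i j → ∃ a ∈ B i, ∃ b ∈ B j, G.Adj a b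

/-- Locally chordalize by `u` all holes of `G` containing `u`: add all edges
joining `u` to the vertices of such holes (new edges go to the vertices
nonadjacent to `u`). -/
def localChordalize (G : SimpleGraph V) (u : V) : SimpleGraph V :=
  G ⊔ SimpleGraph.fromRel fun x y =>
    x = u ∧ ∃ (a : V) (w : G.Walk a a), IsHole G w ∧ u ∈ w.support ∧ y ∈ w.support

/-- Recursive local chordalizations along a list of vertices. -/
def chordalizeList (G : SimpleGraph V) : List V → SimpleGraph V
  | [] => G
  | u :: l => chordalizeList (localChordalize G u) l

/-- Delete a vertex set (keeping the ambient vertex type: the removed vertices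
become isolated). -/
def removeVerts (G : SimpleGraph V) (A : Set V) : SimpleGraph V where
  Adj x y := G.Adj x y ∧ x ∉ A ∧ y ∉ A
  symm := by constructor; intro x y h; exact ⟨h.1.symm, h.2.2, h.2.1⟩
  loopless := by constructor; intro x h; exact G.loopless.irrefl x h.1

/-- The chordalization chain corresponding to an ordered partition
`parts 0, …, parts (k-1)` (playing the role of `C₁, …, C_k`) of a hole cover:
`(lcChain G parts i).1 = Gᵢ` and `(lcChain G parts i).2 = Gᵢ*`. -/
def lcChain (G : SimpleGraph V) {k : ℕ} (parts : Fin k → List V) :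
    ℕ → SimpleGraph V × SimpleGraph V
  | 0 =>
      (removeVerts G {v | ∃ i, v ∈ parts i}, removeVerts G {v | ∃ i, v ∈ parts i})
  | i + 1 =>
      let Gi := (lcChain G parts i).2 ⊔
        removeVerts G {v | ∃ j : Fin k, i + 1 ≤ (j : ℕ) ∧ v ∈ parts j}
      (Gi, if h : i < k then chordalizeList Gi (parts ⟨i, h⟩) else Gi)

/-- `(parts 0, …, parts (k-1))` is a *local chordalization partition* of the hole
cover `C` of `G`. -/
def IsLCPartition (G : SimpleGraph V) (C : Set V) {k : ℕ} (parts : Fin k → List V) : Prop :=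
  (∀ i, (parts i).Nodup) ∧
  (∀ i, parts i ≠ []) ∧
  (Pairwise fun i j : Fin k => ∀ v, v ∈ parts i → v ∉ parts j) ∧
  {v | ∃ i, v ∈ parts i} = C ∧
  ∀ i : Fin k,
    IsHoleCover (lcChain G parts ((i : ℕ) + 1)).1 {v | v ∈ parts i} ∧
    SetNC (lcChain G parts ((i : ℕ) + 1)).1 {v | v ∈ parts i} ∧
    IsChordal (lcChain G parts ((i : ℕ) + 1)).2

/-- The *non-chordality index* of `G`. -/
noncomputable def ncIndex (G : SimpleGraph V) : ℕ := by
  classical exact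
    if IsChordal G then 0
    else sInf {k | ∃ (C : Set V) (parts : Fin k → List V),
      IsHoleCover G C ∧ IsLCPartition G C parts}

/-- `G` is `k`-list-colorable. -/
def ListColorable (G : SimpleGraph V) (k : ℕ) : Prop :=
  ∀ L : V → Finset ℕ, (∀ v, k ≤ (L v).card) →
    ∃ f : V → ℕ, (∀ v, f v ∈ L v) ∧ ∀ u v : V, G.Adj u v → f u ≠ f v

/-- The list chromatic number of `G`. -/
noncomputable def listChromaticNumber (G : SimpleGraph V) : ℕ :=
  sInf {k | ListColorable G k}


/-! ### Functional holes and induced paths -/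

def HF (G : SimpleGraph V) (n : ℕ) (f : ℕ → V) : Prop :=
  4 ≤ n ∧ f n = f 0 ∧ ∀ i j, i < j → j < n →
    f i ≠ f j ∧ (G.Adj (f i) (f j) ↔ (j = i + 1 ∨ (i = 0 ∧ j + 1 = n)))

def IP (G : SimpleGraph V) (m : ℕ) (p : ℕ → V) : Prop :=
  ∀ i j, i < j → j ≤ m → p i ≠ p j ∧ (G.Adj (p i) (p j) ↔ j = i + 1)

def HS (G : SimpleGraph V) (Y : Set V) : Prop :=
  ∃ n f, HF G n f ∧ ∀ y, y ∈ Y ↔ ∃ i, i < n ∧ f i = y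

def Conn (G : SimpleGraph V) (X : Set V) : Prop :=
  ∀ x ∈ X, ∀ y ∈ X, Relation.ReflTransGen (fun a b => G.Adj a b ∧ b ∈ X) x y

theorem HF_of_hole {G : SimpleGraph V} {a : V} (w : G.Walk a a) (h : IsHole G w) :
    HF G w.length w.getVert := by
  obtain ⟨hc, h4, hi⟩ := h
  have inj := hc.getVert_injOn'
  have inj' : ∀ i j, i < w.length → j < w.length → w.getVert i = w.getVert j → i = j := by
    intro i j hi hj e
    exact inj (by simp; omega) (by simp; omega) e
  refine ⟨h4, by simp, ?_⟩
  intro i j hij hj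
  refine ⟨fun e => by have := inj' i j (by omega) hj e; omega, ?_, ?_⟩
  · intro had
    have := hi _ _ (w.getVert_mem_support i) (w.getVert_mem_support j) had
    rw [Walk.mk_mem_edges_iff_exists] at this
    obtain ⟨k, hk, hk2⟩ := this
    by_cases hkl : k + 1 < w.length
    · simp only [Sym2.eq_iff] at hk2
      grind
    · have : k + 1 = w.length := by omega
      have e0 : w.getVert (k+1) = w.getVert 0 := by rw [this]; simp
      simp only [Sym2.eq_iff] at *
      grind
  · rintro (rfl | ⟨rfl, hj2⟩)
    · exact w.adj_getVert_succ (by omega)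
    · have := w.adj_getVert_succ (i := j) (by omega)
      rw [hj2] at this
      simpa using this.symm

theorem mem_support_hole {G : SimpleGraph V} {a : V} (w : G.Walk a a) (h : IsHole G w) (x : V) :
    x ∈ w.support ↔ ∃ i, i < w.length ∧ w.getVert i = x := by
  rw [Walk.mem_support_iff_exists_getVert]
  constructor
  · rintro ⟨n, rfl, hn⟩
    by_cases h2 : n = w.length
    · exact ⟨0, by have := h.2.1; omega, by simp [h2]⟩
    · exact ⟨n, by omega, rfl⟩
  · rintro ⟨i, hi, rfl⟩; exact ⟨i, rfl, hi.le⟩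

theorem walk_of_fn {G : SimpleGraph V} (f : ℕ → V) : ∀ m, (∀ i < m, G.Adj (f i) (f (i+1))) →
    ∃ w : G.Walk (f 0) (f m), w.length = m ∧ ∀ i ≤ m, w.getVert i = f i := by
  intro m
  induction m with
  | zero => intro _; exact ⟨Walk.nil, rfl, by intro i hi; simp at hi; subst hi; rfl⟩
  | succ m ih =>
    intro h
    obtain ⟨w, hw, hg⟩ := ih (fun i hi => h i (by omega))
    refine ⟨w.concat (h m (by omega)), by simp [hw], ?_⟩
    intro i hi
    rw [Walk.concat_eq_append, Walk.getVert_append]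
    split_ifs with h1
    · exact hg i (by omega)
    · rcases (show i = m ∨ i = m + 1 by omega) with rfl | rfl
      · simp [hw]
      · simp [hw]

theorem hole_of_HF {G : SimpleGraph V} {n : ℕ} {f : ℕ → V} (h : HF G n f) :
    ∃ (a : V) (w : G.Walk a a), IsHole G w ∧ ∀ x, x ∈ w.support ↔ ∃ i, i < n ∧ f i = x := by
  obtain ⟨h4, h0, hf⟩ := h
  obtain ⟨w, hw, hg⟩ := walk_of_fn (G := G) f (n-1) (fun i hi => by
    rw [(hf i (i+1) (by omega) (by omega)).2]; left; rfl)
  have hadj : G.Adj (f (n-1)) (f 0) := by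
    rw [G.adj_comm, (hf 0 (n-1) (by omega) (by omega)).2]; right; omega
  have inj : ∀ i j, i < n → j < n → f i = f j → i = j := by
    intro i j hi hj e
    rcases lt_trichotomy i j with h1 | h1 | h1
    · exact absurd e (hf i j h1 hj).1
    · exact h1
    · exact absurd e.symm (hf j i h1 hi).1
  have hp : w.IsPath := by
    rw [← Walk.IsPath.getVert_injOn_iff]
    intro i hi j hj e
    simp only [Set.mem_ofPred_eq, hw] at hi hj
    rw [hg i hi, hg j hj] at e
    exact inj i j (by omega) (by omega) e
  have hsup : ∀ x, x ∈ w.support ↔ ∃ i, i < n ∧ f i = x := by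
    intro x
    rw [Walk.mem_support_iff_exists_getVert]
    constructor
    · rintro ⟨i, hi, hil⟩; exact ⟨i, by omega, by rw [← hi, hg i (by omega)]⟩
    · rintro ⟨i, hi, hil⟩; exact ⟨i, by rw [← hil, hg i (by omega)], by omega⟩
  have hedge : ∀ i, i + 1 < n → s(f i, f (i+1)) ∈ w.edges := by
    intro i hi
    rw [Walk.mk_mem_edges_iff_exists]
    refine ⟨i, by omega, ?_⟩
    rw [hg i (by omega), hg (i+1) (by omega)]
  refine ⟨f (n-1), Walk.cons hadj w, ⟨?_, ?_, ?_⟩, ?_⟩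
  · rw [Walk.cons_isCycle_iff]
    refine ⟨hp, ?_⟩
    intro hmem
    rw [Walk.mk_mem_edges_iff_exists] at hmem
    obtain ⟨k, hk, hk2⟩ := hmem
    rw [hg k (by omega), hg (k+1) (by omega)] at hk2
    simp only [Sym2.eq_iff] at hk2
    rcases hk2 with ⟨e1, e2⟩ | ⟨e1, e2⟩
    · have := inj _ _ (by omega) (by omega) e1
      have := inj _ _ (by omega) (by omega) e2
      omega
    · have := inj _ _ (by omega) (by omega) e1
      have := inj _ _ (by omega) (by omega) e2
      omega
  · simp [hw]; omega
  · intro x y hx hy hxy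
    have key : ∀ i j, i < j → j < n → G.Adj (f i) (f j) →
        s(f i, f j) ∈ (Walk.cons hadj w).edges := by
      intro i j hij hj had
      rw [(hf i j hij hj).2] at had
      rw [Walk.edges_cons, List.mem_cons]
      rcases had with rfl | ⟨rfl, h2⟩
      · right; exact hedge i hj
      · left; rw [Sym2.eq_swap]; congr; omega
    have memc : ∀ x, x ∈ (Walk.cons hadj w).support → ∃ i, i < n ∧ f i = x := by
      intro x hx
      rw [Walk.support_cons, List.mem_cons] at hx
      rcases hx with rfl | hx
      · exact ⟨n-1, by omega, rfl⟩
      · exact (hsup x).1 hx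
    obtain ⟨i, hi, rfl⟩ := memc x hx
    obtain ⟨j, hj, rfl⟩ := memc y hy
    rcases lt_trichotomy i j with h1 | h1 | h1
    · exact key i j h1 hj hxy
    · subst h1; exact absurd hxy (G.irrefl)
    · rw [Sym2.eq_swap]; exact key j i h1 hi hxy.symm
  · intro x
    rw [Walk.support_cons, List.mem_cons, hsup]
    constructor
    · rintro (rfl | h)
      · exact ⟨n-1, by omega, rfl⟩
      · exact h
    · intro h; right; exact h

/-- Shortest path through a connected set. -/
theorem exists_sp {G : SimpleGraph V} {X : Set V} (hX : Conn G X) {s t : V}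
    (hs : ∃ x ∈ X, G.Adj s x) (ht : ∃ x ∈ X, G.Adj t x) :
    ∃ (r : ℕ) (q : ℕ → V), IP G r q ∧ (∀ i ≤ r, q i ∈ X) ∧
      (∀ i ≤ r, (G.Adj s (q i) ↔ i = 0)) ∧ (∀ i ≤ r, (G.Adj t (q i) ↔ i = r)) := by
  classical
  let Wk : ℕ → Prop := fun r => ∃ q : ℕ → V, (∀ i ≤ r, q i ∈ X) ∧
    (∀ i < r, G.Adj (q i) (q (i+1))) ∧ G.Adj s (q 0) ∧ G.Adj t (q r)
  have hex : ∃ r, Wk r := by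
    obtain ⟨x, hx, hsx⟩ := hs
    obtain ⟨y, hy, hty⟩ := ht
    have := hX x hx y hy
    have : ∃ (r : ℕ) (q : ℕ → V), (∀ i ≤ r, q i ∈ X) ∧
      (∀ i < r, G.Adj (q i) (q (i+1))) ∧ q 0 = x ∧ q r = y := by
      clear hty hy
      induction this with
      | refl => exact ⟨0, fun _ => x, fun _ _ => hx, by simp, rfl, rfl⟩
      | tail hab hbc ih =>
        rename_i b c
        obtain ⟨r, q, h1, h2, h3, h4⟩ := ih
        refine ⟨r+1, fun i => if i ≤ r then q i else c, ?_, ?_, ?_, ?_⟩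
        · intro i hi; dsimp only; split_ifs with h
          · exact h1 i h
          · exact hbc.2
        · intro i hi
          by_cases h : i < r
          · simp only [show i ≤ r by omega, show i + 1 ≤ r by omega, if_true]; exact h2 i h
          · have : i = r := by omega
            subst this; simp [h4, hbc.1]
        · simp [h3]
        · simp
    obtain ⟨r, q, h1, h2, h3, h4⟩ := this
    exact ⟨r, q, h1, h2, h3 ▸ hsx, h4 ▸ hty⟩
  obtain ⟨q, h1, h2, h3, h4⟩ := Nat.find_spec hex
  have hmin : ∀ k, k < Nat.find hex → ¬ Wk k := fun k hk => Nat.find_min hex hk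
  generalize Nat.find hex = r at *
  have cut : ∀ i j, i + 1 < j → j ≤ r → ¬ G.Adj (q i) (q j) := by
    intro i j hij hj had
    apply hmin (r - (j - i - 1)) (by omega)
    refine ⟨fun k => if k ≤ i then q k else q (k + (j - i - 1)), ?_, ?_, ?_, ?_⟩
    · intro k hk; dsimp only; split_ifs
      · exact h1 _ (by omega)
      · exact h1 _ (by omega)
    · intro k hk
      dsimp only
      by_cases hki : k + 1 ≤ i
      · simp only [hki, show k ≤ i by omega, if_true]; exact h2 k (by omega)
      · by_cases hk2 : k ≤ i
        · have : k = i := by omega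
          subst this
          simp only [le_refl, if_true, hki, if_false]
          rwa [show k + 1 + (j - k - 1) = j by omega]
        · simp only [hki, hk2, if_false]
          rw [show k + 1 + (j - i - 1) = k + (j - i - 1) + 1 by omega]
          exact h2 _ (by omega)
    · simpa using h3
    · dsimp only
      rw [if_neg (by omega), show r - (j - i - 1) + (j - i - 1) = r by omega]; exact h4
  have hs' : ∀ i ≤ r, (G.Adj s (q i) ↔ i = 0) := by
    intro i hi
    refine ⟨fun had => ?_, fun h => h ▸ h3⟩
    by_contra h0
    apply hmin (r - i) (by omega)
    refine ⟨fun k => q (k + i), fun k hk => h1 _ (by omega), fun k hk => ?_, by simpa using had, ?_⟩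
    · have := h2 (k + i) (by omega); rwa [show k + i + 1 = k + 1 + i by omega] at this
    · dsimp only; rwa [show r - i + i = r by omega]
  have ht' : ∀ i ≤ r, (G.Adj t (q i) ↔ i = r) := by
    intro i hi
    refine ⟨fun had => ?_, fun h => h ▸ h4⟩
    by_contra h0
    exact hmin i (by omega) ⟨q, fun k hk => h1 _ (by omega), fun k hk => h2 _ (by omega), h3, had⟩
  refine ⟨r, q, ?_, h1, hs', ht'⟩
  intro i j hij hj
  constructor
  · intro e
    by_cases hjr : j = r
    · subst hjr
      have := (ht' i (by omega)).1 (e ▸ h4)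
      omega
    · have := h2 j (by omega)
      rw [← e] at this
      exact cut i (j+1) (by omega) (by omega) this
  · constructor
    · intro had
      by_contra h
      exact cut i j (by omega) hj had
    · rintro rfl; exact h2 i (by omega)

/-- Closing an induced path through a connected set. -/
theorem close_path {G : SimpleGraph V} {X : Set V} (hX : Conn G X) {m : ℕ} {p : ℕ → V}
    (hp : IP G m p) (hm : 2 ≤ m) (hpX : ∀ i ≤ m, p i ∉ X)
    (hInt : ∀ i, 0 < i → i < m → ∀ x ∈ X, ¬ G.Adj (p i) x)
    (h0 : ∃ x ∈ X, G.Adj (p 0) x) (h1 : ∃ x ∈ X, G.Adj (p m) x) :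
    ∃ Y, HS G Y ∧ (∀ i ≤ m, p i ∈ Y) ∧ (∀ y ∈ Y, y ∈ X ∨ ∃ i ≤ m, p i = y) ∧
      ∃ y ∈ Y, y ∈ X := by
  obtain ⟨r, q, hq, hqX, hs, ht⟩ := exists_sp hX h0 h1
  let f : ℕ → V := fun k => if k ≤ m then p k else if k ≤ m + r + 1 then q (m + r + 1 - k) else p 0
  have f1 : ∀ k ≤ m, f k = p k := fun k hk => by simp [f, hk]
  have f2 : ∀ k, m < k → k ≤ m + r + 1 → f k = q (m + r + 1 - k) := fun k hk hk2 => by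
    simp only [f]; rw [if_neg (by omega), if_pos hk2]
  have hf : HF G (m + r + 2) f := by
    refine ⟨by omega, ?_, ?_⟩
    · simp only [f]; rw [if_neg (by omega), if_neg (by omega), if_pos (by omega)]
    · intro i j hij hj
      by_cases hjm : j ≤ m
      · rw [f1 i (by omega), f1 j hjm, (hp i j hij hjm).2]
        refine ⟨(hp i j hij hjm).1, ?_⟩
        omega
      · rw [f2 j (by omega) (by omega)]
        by_cases him : i ≤ m
        · rw [f1 i him]
          refine ⟨fun e => hpX i him (e ▸ hqX _ (by omega)), ?_⟩
          by_cases hi0 : i = 0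
          · subst hi0; rw [hs _ (by omega)]; omega
          · by_cases him2 : i = m
            · subst him2; rw [ht _ (by omega)]; omega
            · constructor
              · intro had; exact absurd had (hInt i (by omega) (by omega) _ (hqX _ (by omega)))
              · omega
        · rw [f2 i (by omega) (by omega)]
          have := hq (m + r + 1 - j) (m + r + 1 - i) (by omega) (by omega)
          refine ⟨this.1.symm, ?_⟩
          rw [G.adj_comm, this.2]; omega
  refine ⟨{y | ∃ i, i < m + r + 2 ∧ f i = y}, ⟨_, f, hf, fun y => Iff.rfl⟩, ?_, ?_, ?_⟩
  · intro i hi; exact ⟨i, by omega, f1 i hi⟩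
  · rintro y ⟨i, hi, rfl⟩
    by_cases him : i ≤ m
    · right; exact ⟨i, him, (f1 i him).symm⟩
    · left; rw [f2 i (by omega) (by omega)]; exact hqX _ (by omega)
  · refine ⟨q 0, ⟨m + r + 1, by omega, ?_⟩, hqX 0 (by omega)⟩
    rw [f2 _ (by omega) (by omega)]; simp

/-! ### The separation claim -/

def NCu (G : SimpleGraph V) (u : V) : Prop :=
  ∀ Y Z, HS G Y → HS G Z → u ∈ Y → u ∉ Z → ∀ x y z, x ≠ z → G.Adj x y → G.Adj y z →
    x ∈ Y → y ∈ Y → z ∈ Y → x ∈ Z → y ∈ Z → z ∈ Z → False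

theorem HF.ext {G : SimpleGraph V} {n : ℕ} {f : ℕ → V} (h : HF G n f) (i j : ℕ) (hij : i < j)
    (hj : j ≤ n) (h0 : ¬ (i = 0 ∧ j = n)) : f i ≠ f j ∧
    (G.Adj (f i) (f j) ↔ (j = i + 1 ∨ (i = 0 ∧ j + 1 = n) ∨ (i = 1 ∧ j = n))) := by
  obtain ⟨h4, hn, hf⟩ := h
  by_cases hjn : j = n
  · subst hjn
    have := hf 0 i (by omega) (by omega)
    rw [hn]
    refine ⟨this.1.symm, ?_⟩
    rw [G.adj_comm, this.2]; omega
  · have := hf i j hij (by omega)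
    refine ⟨this.1, ?_⟩
    rw [this.2]; omega

theorem HF.rev {G : SimpleGraph V} {n : ℕ} {f : ℕ → V} (h : HF G n f) :
    HF G n (fun k => f (n - k)) := by
  refine ⟨h.1, by simp [h.2.1], ?_⟩
  intro i j hij hj
  have := h.ext (n - j) (n - i) (by omega) (by omega) (by omega)
  refine ⟨this.1.symm, ?_⟩
  have h4 := h.1
  rw [G.adj_comm, this.2]; omega

theorem HF.rot {G : SimpleGraph V} {n : ℕ} {f : ℕ → V} (h : HF G n f) (r : ℕ) (hr : r < n) :
    HF G n (fun k => if k + r ≤ n then f (k + r) else f (k + r - n)) := by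
  have h4 := h.1
  refine ⟨h.1, ?_, ?_⟩
  · dsimp only
    by_cases h0 : r = 0
    · subst h0; simp [h.2.1]
    · rw [if_neg (by omega), if_pos (by omega)]; congr 1; omega
  · intro i j hij hj
    dsimp only
    by_cases h1 : j + r ≤ n
    · rw [if_pos h1, if_pos (by omega)]
      have := h.ext (i + r) (j + r) (by omega) h1 (by omega)
      refine ⟨this.1, ?_⟩
      rw [this.2]; omega
    · rw [if_neg h1]
      by_cases h2 : i + r ≤ n
      · rw [if_pos h2]
        have := h.ext (j + r - n) (i + r) (by omega) h2 (by omega)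
        refine ⟨this.1.symm, ?_⟩
        rw [G.adj_comm, this.2]; omega
      · rw [if_neg h2]
        have := h.ext (i + r - n) (j + r - n) (by omega) (by omega) (by omega)
        refine ⟨this.1, ?_⟩
        rw [this.2]; omega

theorem HS.based {G : SimpleGraph V} {Y : Set V} (h : HS G Y) {u : V} (hu : u ∈ Y) :
    ∃ n f, HF G n f ∧ f 0 = u ∧ (∀ y, y ∈ Y ↔ ∃ i, i < n ∧ f i = y) := by
  obtain ⟨n, f, hf, hY⟩ := h
  obtain ⟨r, hr, rfl⟩ := (hY u).1 hu
  refine ⟨n, _, hf.rot r hr, ?_, ?_⟩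
  · simp [hr.le]
  · intro y
    rw [hY]
    constructor
    · rintro ⟨i, hi, rfl⟩
      by_cases h : r ≤ i
      · refine ⟨i - r, by omega, ?_⟩
        rw [if_pos (by omega)]; congr 1; omega
      · refine ⟨i + n - r, by omega, ?_⟩
        by_cases h0 : i = 0
        · rw [if_pos (by omega), show i + n - r + r = n by omega, hf.2.1, h0]
        · rw [if_neg (by omega)]; congr 1; omega
    · rintro ⟨i, hi, rfl⟩
      split_ifs with h1
      · by_cases h2 : i + r = n
        · exact ⟨0, by omega, by rw [h2, hf.2.1]⟩
        · exact ⟨_, by omega, rfl⟩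
      · exact ⟨_, by omega, rfl⟩

/-- The arc of a hole passing through the base point. -/
theorem HF.wrap {G : SimpleGraph V} {n : ℕ} {f : ℕ → V} (h : HF G n f) {k j : ℕ}
    (hkj : k + 2 ≤ j) (hjn : j < n) :
    IP G (n - j + k) (fun t => if t ≤ n - j then f (j + t) else f (t - (n - j))) := by
  have h4 := h.1
  intro s t hst ht
  dsimp only
  by_cases h1 : t ≤ n - j
  · rw [if_pos h1, if_pos (by omega)]
    have := h.ext (j + s) (j + t) (by omega) (by omega) (by omega)
    refine ⟨this.1, ?_⟩
    rw [this.2]; omega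
  · rw [if_neg h1]
    by_cases h2 : s ≤ n - j
    · rw [if_pos h2]
      have := h.ext (t - (n - j)) (j + s) (by omega) (by omega) (by omega)
      refine ⟨this.1.symm, ?_⟩
      rw [G.adj_comm, this.2]; omega
    · rw [if_neg h2]
      have := h.ext (s - (n - j)) (t - (n - j)) (by omega) (by omega) (by omega)
      refine ⟨this.1, ?_⟩
      rw [this.2]; omega

theorem IP.snoc {G : SimpleGraph V} {m : ℕ} {p : ℕ → V} (h : IP G m p) {a : V}
    (ha : ∀ t ≤ m, p t ≠ a ∧ (G.Adj (p t) a ↔ t = m)) :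
    IP G (m + 1) (fun t => if t ≤ m then p t else a) := by
  intro s t hst ht
  dsimp only
  by_cases h1 : t ≤ m
  · rw [if_pos h1, if_pos (by omega)]; exact h s t hst h1
  · rw [if_neg h1, if_pos (by omega)]
    have := ha s (by omega)
    refine ⟨this.1, ?_⟩
    rw [this.2]; omega

theorem conn_singleton {G : SimpleGraph V} (a : V) : Conn G {a} := by
  rintro x rfl y rfl
  exact Relation.ReflTransGen.refl

theorem conn_pair {G : SimpleGraph V} {a b : V} (h : G.Adj a b) : Conn G {a, b} := by
  intro x hx y hy
  by_cases e : x = y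
  · subst e; exact Relation.ReflTransGen.refl
  · apply Relation.ReflTransGen.single
    refine ⟨?_, hy⟩
    rcases hx with rfl | rfl <;> rcases hy with rfl | rfl
    · exact absurd rfl e
    · exact h
    · exact h.symm
    · exact absurd rfl e

theorem close3 {G : SimpleGraph V} {X : Set V} (hX : Conn G X) {x y z : V}
    (hxy : G.Adj x y) (hyz : G.Adj y z) (hxz : ¬ G.Adj x z) (hne : x ≠ z)
    (h1 : x ∉ X) (h2 : y ∉ X) (h3 : z ∉ X) (hInt : ∀ w ∈ X, ¬ G.Adj y w)
    (e1 : ∃ w ∈ X, G.Adj x w) (e2 : ∃ w ∈ X, G.Adj z w) :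
    ∃ Y, HS G Y ∧ x ∈ Y ∧ y ∈ Y ∧ z ∈ Y ∧ ∀ w ∈ Y, w ∈ X ∨ w = x ∨ w = y ∨ w = z := by
  let p : ℕ → V := fun i => if i = 0 then x else if i = 1 then y else z
  have hp : IP G 2 p := by
    intro i j hij hj
    have : (i = 0 ∧ j = 1) ∨ (i = 0 ∧ j = 2) ∨ (i = 1 ∧ j = 2) := by omega
    rcases this with ⟨rfl, rfl⟩ | ⟨rfl, rfl⟩ | ⟨rfl, rfl⟩
    · simp [p, hxy, hxy.ne]
    · simp [p, hxz, hne]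
    · simp [p, hyz, hyz.ne]
  obtain ⟨Y, hY, hpY, hYX, -⟩ := close_path hX hp le_rfl (by
      intro i hi
      have : i = 0 ∨ i = 1 ∨ i = 2 := by omega
      rcases this with rfl | rfl | rfl <;> simpa [p]) (by
      intro i hi hi2
      have : i = 1 := by omega
      subst this; simpa [p] using hInt) (by simpa [p] using e1) (by simpa [p] using e2)
  refine ⟨Y, hY, by simpa [p] using hpY 0 (by omega), by simpa [p] using hpY 1 (by omega),
    by simpa [p] using hpY 2 (by omega), ?_⟩
  intro w hw
  rcases hYX w hw with h | ⟨i, hi, rfl⟩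
  · exact Or.inl h
  · have : i = 0 ∨ i = 1 ∨ i = 2 := by omega
    rcases this with rfl | rfl | rfl <;> simp [p]

theorem close4 {G : SimpleGraph V} {X : Set V} (hX : Conn G X) {x y z t : V}
    (hxy : G.Adj x y) (hyz : G.Adj y z) (hzt : G.Adj z t) (hxz : ¬ G.Adj x z) (hne : x ≠ z)
    (hyt : ¬ G.Adj y t) (hne2 : y ≠ t) (hxt : ¬ G.Adj x t) (hne3 : x ≠ t)
    (h1 : x ∉ X) (h2 : y ∉ X) (h3 : z ∉ X) (h4 : t ∉ X) (hInt : ∀ w ∈ X, ¬ G.Adj y w)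
    (hInt2 : ∀ w ∈ X, ¬ G.Adj z w)
    (e1 : ∃ w ∈ X, G.Adj x w) (e2 : ∃ w ∈ X, G.Adj t w) :
    ∃ Y, HS G Y ∧ x ∈ Y ∧ y ∈ Y ∧ z ∈ Y ∧ ∀ w ∈ Y, w ∈ X ∨ w = x ∨ w = y ∨ w = z ∨ w = t := by
  let p : ℕ → V := fun i => if i = 0 then x else if i = 1 then y else if i = 2 then z else t
  have hp : IP G 3 p := by
    intro i j hij hj
    have : (i = 0 ∧ j = 1) ∨ (i = 0 ∧ j = 2) ∨ (i = 1 ∧ j = 2) ∨ (i = 0 ∧ j = 3) ∨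
      (i = 1 ∧ j = 3) ∨ (i = 2 ∧ j = 3) := by omega
    rcases this with ⟨rfl, rfl⟩ | ⟨rfl, rfl⟩ | ⟨rfl, rfl⟩ | ⟨rfl, rfl⟩ | ⟨rfl, rfl⟩ | ⟨rfl, rfl⟩
    · simp [p, hxy, hxy.ne]
    · simp [p, hxz, hne]
    · simp [p, hyz, hyz.ne]
    · simp [p, hxt, hne3]
    · simp [p, hyt, hne2]
    · simp [p, hzt, hzt.ne]
  obtain ⟨Y, hY, hpY, hYX, -⟩ := close_path hX hp (by omega) (by
      intro i hi
      have : i = 0 ∨ i = 1 ∨ i = 2 ∨ i = 3 := by omega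
      rcases this with rfl | rfl | rfl | rfl <;> simpa [p]) (by
      intro i hi hi2
      have : i = 1 ∨ i = 2 := by omega
      rcases this with rfl | rfl
      · simpa [p] using hInt
      · simpa [p] using hInt2) (by simpa [p] using e1) (by simpa [p] using e2)
  refine ⟨Y, hY, by simpa [p] using hpY 0 (by omega), by simpa [p] using hpY 1 (by omega),
    by simpa [p] using hpY 2 (by omega), ?_⟩
  intro w hw
  rcases hYX w hw with h | ⟨i, hi, rfl⟩
  · exact Or.inl h
  · have : i = 0 ∨ i = 1 ∨ i = 2 ∨ i = 3 := by omega
    rcases this with rfl | rfl | rfl | rfl <;> simp [p]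

/-- Outer neighbourhood. -/
def Nb (G : SimpleGraph V) (K : Set V) : Set V := {s | s ∉ K ∧ ∃ x ∈ K, G.Adj s x}

structure Ctx (G : SimpleGraph V) (u : V) (K : Set V) : Prop where
  nc : NCu G u
  conn : Conn G K
  hole : ∀ Y, HS G Y → u ∈ Y → ∀ y ∈ Y, y ∉ K
  uK : u ∉ K
  uS : u ∉ Nb G K

structure Arm (G : SimpleGraph V) (u : V) (K : Set V) (l : ℕ) (α : ℕ → V) : Prop where
  ip : IP G l α
  pos : 1 ≤ l
  start : α 0 ∈ Nb G K
  fin : α l = u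
  out : ∀ k, 1 ≤ k → k ≤ l → α k ∉ Nb G K
  notK : ∀ k ≤ l, α k ∉ K
  hole : 2 ≤ l → ∃ Y, HS G Y ∧ u ∈ Y ∧ ∀ k ≤ l, α k ∈ Y

theorem not_adj_of_not_nb {G : SimpleGraph V} {K : Set V} {x : V} (h1 : x ∉ Nb G K) (h2 : x ∉ K) :
    ∀ y ∈ K, ¬ G.Adj x y := fun y hy had => h1 ⟨h2, y, hy, had⟩

theorem contact {G : SimpleGraph V} {u : V} {K : Set V} (c : Ctx G u K) {l m : ℕ} {α β : ℕ → V}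
    (A : Arm G u K l α) (B : Arm G u K m β) (hne : α 0 ≠ β 0) (hna : ¬ G.Adj (α 0) (β 0)) :
    (G.Adj (α 0) (β 1) ∧ 2 ≤ m) ∨
    (2 ≤ l ∧ (∀ k ≤ m, ¬ G.Adj (α 0) (β k)) ∧ G.Adj (α 1) (β 0)) ∨
    (2 ≤ l ∧ 2 ≤ m ∧ (∀ k ≤ m, ¬ G.Adj (α 0) (β k)) ∧ G.Adj (α 1) (β 1) ∧
      ¬ G.Adj (α 1) (β 0)) := by
  classical
  have hex : ∃ i, i ≤ l ∧ ∃ k ≤ m, G.Adj (α i) (β k) := by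
    refine ⟨l - 1, by omega, m, le_rfl, ?_⟩
    have := (A.ip (l-1) l (by have := A.pos; omega) le_rfl).2.2 (by have := A.pos; omega)
    rwa [B.fin, ← A.fin]
  obtain ⟨hil, hex2⟩ := Nat.find_spec hex
  have hmin : ∀ k, k < Nat.find hex → ¬ (k ≤ l ∧ ∃ k' ≤ m, G.Adj (α k) (β k')) :=
    fun k hk => Nat.find_min hex hk
  generalize Nat.find hex = i at *
  obtain ⟨hjm, hadj⟩ := Nat.find_spec hex2
  have hminj : ∀ k, k < Nat.find hex2 → ¬ (k ≤ m ∧ G.Adj (α i) (β k)) :=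
    fun k hk => Nat.find_min hex2 hk
  generalize Nat.find hex2 = j at *
  have hmin' : ∀ k < i, ∀ k' ≤ m, ¬ G.Adj (α k) (β k') :=
    fun k hk k' hk' had => hmin k hk ⟨by omega, k', hk', had⟩
  have hneq : ∀ k ≤ i, ∀ k' ≤ j, α k ≠ β k' := by
    intro k hk k' hk' e
    by_cases h0 : k' = 0
    · subst h0
      by_cases hk0 : k = 0
      · subst hk0; exact hne e
      · exact A.out k (by omega) (by omega) (e ▸ B.start)
    · have had : G.Adj (α k) (β (k' - 1)) := by
        rw [e, G.adj_comm]
        exact (B.ip (k'-1) k' (by omega) (by omega)).2.2 (by omega)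
      by_cases hki : k = i
      · subst hki; exact hminj (k'-1) (by omega) ⟨by omega, had⟩
      · exact hmin' k (by omega) _ (by omega) had
  let p : ℕ → V := fun k => if k ≤ i then α k else β (i + 1 + j - k)
  have p1 : ∀ k ≤ i, p k = α k := fun k hk => by simp [p, hk]
  have p2 : ∀ k, i < k → p k = β (i + 1 + j - k) := fun k hk => by
    simp only [p]; rw [if_neg (by omega)]
  have hp : IP G (i + 1 + j) p := by
    intro s t hst ht
    by_cases h1 : t ≤ i
    · rw [p1 t h1, p1 s (by omega)]; exact A.ip s t hst (by omega)
    · rw [p2 t (by omega)]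
      by_cases h2 : s ≤ i
      · rw [p1 s h2]
        refine ⟨hneq s h2 _ (by omega), ?_⟩
        constructor
        · intro had
          by_contra hcon
          by_cases hsi : s = i
          · subst hsi; exact hminj _ (by omega) ⟨by omega, had⟩
          · exact hmin' s (by omega) _ (by omega) had
        · intro h
          have e1 : s = i := by omega
          subst e1
          rwa [show s + 1 + j - t = j by omega]
      · rw [p2 s (by omega)]
        have := B.ip (i + 1 + j - t) (i + 1 + j - s) (by omega) (by omega)
        refine ⟨this.1.symm, ?_⟩
        rw [G.adj_comm, this.2]; omega
  have hij : ¬ (i = 0 ∧ j = 0) := by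
    rintro ⟨rfl, rfl⟩; exact hna hadj
  have hpK : ∀ k ≤ i + 1 + j, p k ∉ K := by
    intro k hk
    by_cases h : k ≤ i
    · rw [p1 k h]; exact A.notK k (by omega)
    · rw [p2 k (by omega)]; exact B.notK _ (by omega)
  have hpm : p (i + 1 + j) = β 0 := by rw [p2 _ (by omega)]; simp
  obtain ⟨Y, hY, hpY, hYX, y, hyY, hyK⟩ := close_path c.conn hp (by omega) hpK (by
      intro k hk hk2
      apply not_adj_of_not_nb _ (hpK k (by omega))
      by_cases h : k ≤ i
      · rw [p1 k h]; exact A.out k (by omega) (by omega)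
      · rw [p2 k (by omega)]; exact B.out _ (by omega) (by omega))
      (by rw [p1 0 (by omega)]; exact A.start.2) (by rw [hpm]; exact B.start.2)
  have huY : u ∉ Y := fun h => c.hole Y hY h y hyY hyK
  have hαY : ∀ k ≤ i, α k ∈ Y := fun k hk => p1 k hk ▸ hpY k (by omega)
  have hβY : ∀ k ≤ j, β k ∈ Y := fun k hk => by
    have := hpY (i + 1 + j - k) (by omega)
    rw [p2 _ (by omega)] at this
    rwa [show i + 1 + j - (i + 1 + j - k) = k by omega] at this
  have hil' : i < l := by
    by_contra h
    have : i = l := by omega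
    subst this; exact huY (A.fin ▸ hαY i le_rfl)
  have hjm' : j < m := by
    by_contra h
    have : j = m := by omega
    subst this; exact huY (B.fin ▸ hβY j le_rfl)
  have arm2 : ∀ (l i : ℕ) (α : ℕ → V), Arm G u K l α → (∀ k ≤ i, α k ∈ Y) → i < l → i ≤ 1 := by
    intro l i α A hαY hil
    by_contra h
    obtain ⟨Z, hZ, huZ, hαZ⟩ := A.hole (by omega)
    exact c.nc Z Y hZ hY huZ huY (α 0) (α 1) (α 2) (A.ip 0 2 (by omega) (by omega)).1
      ((A.ip 0 1 (by omega) (by omega)).2.2 rfl) ((A.ip 1 2 (by omega) (by omega)).2.2 rfl)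
      (hαZ _ (by omega)) (hαZ _ (by omega)) (hαZ _ (by omega))
      (hαY _ (by omega)) (hαY _ (by omega)) (hαY _ (by omega))
  have hi1 := arm2 l i α A hαY hil'
  have hj1 := arm2 m j β B hβY hjm'
  by_cases hi0 : i = 0
  · left
    have : j = 1 := by omega
    subst this; subst hi0
    exact ⟨hadj, by omega⟩
  · have e1 : i = 1 := by omega
    subst e1
    right
    by_cases hj0 : j = 0
    · left; subst hj0
      exact ⟨by omega, fun k hk => hmin' 0 (by omega) k hk, hadj⟩
    · have e1 : j = 1 := by omega
      subst e1
      right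
      exact ⟨by omega, by omega, fun k hk => hmin' 0 (by omega) k hk, hadj,
        fun h => hminj 0 (by omega) ⟨by omega, h⟩⟩

theorem bad3 {G : SimpleGraph V} {u : V} (nc : NCu G u) {Y : Set V} (hY : HS G Y) (hu : u ∈ Y)
    {x y z : V} (hx : x ∈ Y) (hy : y ∈ Y) (hz : z ∈ Y) {X : Set V} (hX : Conn G X)
    (hxy : G.Adj x y) (hyz : G.Adj y z) (hxz : ¬ G.Adj x z) (hne : x ≠ z)
    (h2 : y ∉ X) (hInt : ∀ w ∈ X, ¬ G.Adj y w)
    (e1 : ∃ w ∈ X, G.Adj x w) (e2 : ∃ w ∈ X, G.Adj z w)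
    (hux : u ≠ x) (huy : u ≠ y) (huz : u ≠ z) (huX : u ∉ X) : False := by
  obtain ⟨Z, hZ, hxZ, hyZ, hzZ, hs⟩ := close3 hX hxy hyz hxz hne
    (fun h => hInt _ h hxy.symm) h2 (fun h => hInt _ h hyz) hInt e1 e2
  refine nc Y Z hY hZ hu ?_ x y z hne hxy hyz hx hy hz hxZ hyZ hzZ
  intro h
  rcases hs u h with h | h | h | h
  · exact huX h
  · exact hux h
  · exact huy h
  · exact huz h

theorem bad4 {G : SimpleGraph V} {u : V} (nc : NCu G u) {Y : Set V} (hY : HS G Y) (hu : u ∈ Y)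
    {x y z t : V} (hx : x ∈ Y) (hy : y ∈ Y) (hz : z ∈ Y) {X : Set V} (hX : Conn G X)
    (hxy : G.Adj x y) (hyz : G.Adj y z) (hzt : G.Adj z t) (hxz : ¬ G.Adj x z) (hne : x ≠ z)
    (hyt : ¬ G.Adj y t) (hne2 : y ≠ t) (hxt : ¬ G.Adj x t) (hne3 : x ≠ t)
    (hInt : ∀ w ∈ X, ¬ G.Adj y w) (hInt2 : ∀ w ∈ X, ¬ G.Adj z w)
    (e1 : ∃ w ∈ X, G.Adj x w) (e2 : ∃ w ∈ X, G.Adj t w)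
    (hux : u ≠ x) (huy : u ≠ y) (huz : u ≠ z) (hut : u ≠ t) (huX : u ∉ X) : False := by
  obtain ⟨Z, hZ, hxZ, hyZ, hzZ, hs⟩ := close4 hX hxy hyz hzt hxz hne hyt hne2 hxt hne3
    (fun h => hInt _ h hxy.symm) (fun h => hInt2 _ h hyz.symm) (fun h => hInt _ h hyz)
    (fun h => hInt2 _ h hzt) hInt hInt2 e1 e2
  refine nc Y Z hY hZ hu ?_ x y z hne hxy hyz hx hy hz hxZ hyZ hzZ
  intro h
  rcases hs u h with h | h | h | h | h
  · exact huX h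
  · exact hux h
  · exact huy h
  · exact huz h
  · exact hut h

structure Str (G : SimpleGraph V) (u : V) (K : Set V) (n : ℕ) (f : ℕ → V) (i j : ℕ) : Prop where
  hf : HF G n f
  f0 : f 0 = u
  i1 : 1 ≤ i
  ij : j = i ∨ j = i + 1
  jn : j < n
  iS : f i ∈ Nb G K
  jS : f j ∈ Nb G K
  out : ∀ k ≤ n, (k < i ∨ j < k) → f k ∉ Nb G K
  notK : ∀ k ≤ n, f k ∉ K

theorem Str.fn {G : SimpleGraph V} {u : V} {K : Set V} {n : ℕ} {f : ℕ → V} {i j : ℕ}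
    (s : Str G u K n f i j) : f n = u := by rw [s.hf.2.1, s.f0]

theorem Str.rev {G : SimpleGraph V} {u : V} {K : Set V} {n : ℕ} {f : ℕ → V} {i j : ℕ}
    (s : Str G u K n f i j) : Str G u K n (fun k => f (n - k)) (n - j) (n - i) := by
  have h1 := s.i1
  have h2 := s.jn
  have h3 := s.ij
  refine ⟨s.hf.rev, by simpa using s.fn, by omega, by omega, by omega, ?_, ?_, ?_, ?_⟩
  · simpa [show n - (n - j) = j by omega] using s.jS
  · simpa [show n - (n - i) = i by omega] using s.iS
  · intro k hk h; exact s.out _ (by omega) (by omega)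
  · intro k hk; exact s.notK _ (by omega)

theorem Str.hole {G : SimpleGraph V} {u : V} {K : Set V} {n : ℕ} {f : ℕ → V} {i j : ℕ}
    (s : Str G u K n f i j) : ∃ Y, HS G Y ∧ u ∈ Y ∧ ∀ k ≤ n, f k ∈ Y := by
  have h2 := s.jn
  refine ⟨{y | ∃ k, k < n ∧ f k = y}, ⟨n, f, s.hf, fun y => Iff.rfl⟩, ⟨0, by omega, s.f0⟩, ?_⟩
  intro k hk
  by_cases h : k = n
  · exact ⟨0, by omega, by rw [h, s.hf.2.1]⟩
  · exact ⟨k, by omega, rfl⟩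

theorem Str.adj {G : SimpleGraph V} {u : V} {K : Set V} {n : ℕ} {f : ℕ → V} {i j : ℕ}
    (s : Str G u K n f i j) (k : ℕ) (hk : k < n) : G.Adj (f k) (f (k + 1)) := by
  have := s.hf.1
  exact (s.hf.ext k (k+1) (by omega) (by omega) (by omega)).2.2 (by omega)

theorem Str.nadj {G : SimpleGraph V} {u : V} {K : Set V} {n : ℕ} {f : ℕ → V} {i j : ℕ}
    (s : Str G u K n f i j) (k l : ℕ) (hk : k + 2 ≤ l) (hl : l < n) (h0 : 1 ≤ k) :
    ¬ G.Adj (f k) (f l) ∧ f k ≠ f l := by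
  have := s.hf.ext k l (by omega) (by omega) (by omega)
  refine ⟨?_, this.1⟩
  rw [this.2]; omega

theorem Str.neu {G : SimpleGraph V} {u : V} {K : Set V} {n : ℕ} {f : ℕ → V} {i j : ℕ}
    (s : Str G u K n f i j) (k : ℕ) (h0 : 1 ≤ k) (hl : k < n) : u ≠ f k := by
  rw [← s.f0]
  exact (s.hf.2.2 0 k (by omega) hl).1

theorem Str.arm {G : SimpleGraph V} {u : V} {K : Set V} {n : ℕ} {f : ℕ → V} {i j : ℕ}
    (s : Str G u K n f i j) (hin : i + 2 ≤ n) : Arm G u K i (fun k => f (i - k)) := by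
  have h1 := s.i1
  have h2 := s.jn
  have h3 := s.ij
  obtain ⟨Y, hY, huY, hfY⟩ := s.hole
  refine ⟨?_, h1, by simpa using s.iS, by simpa using s.f0, ?_, ?_, ?_⟩
  · intro a b hab hb
    have := s.hf.ext (i - b) (i - a) (by omega) (by omega) (by omega)
    refine ⟨this.1.symm, ?_⟩
    dsimp only
    rw [G.adj_comm, this.2]; omega
  · intro k hk hk2; exact s.out _ (by omega) (by omega)
  · intro k hk; exact s.notK _ (by omega)
  · intro _; exact ⟨Y, hY, huY, fun k hk => hfY _ (by omega)⟩

theorem Arm.congr {G : SimpleGraph V} {u : V} {K : Set V} {l : ℕ} {α β : ℕ → V}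
    (A : Arm G u K l α) (h : ∀ k ≤ l, β k = α k) : Arm G u K l β := by
  have hp := A.pos
  refine ⟨?_, hp, ?_, ?_, ?_, ?_, ?_⟩
  · intro a b hab hb
    rw [h a (by omega), h b hb]; exact A.ip a b hab hb
  · rw [h 0 (by omega)]; exact A.start
  · rw [h l le_rfl]; exact A.fin
  · intro k hk hk2; rw [h k hk2]; exact A.out k hk hk2
  · intro k hk; rw [h k hk]; exact A.notK k hk
  · intro h2
    obtain ⟨Y, hY, huY, hA⟩ := A.hole h2
    exact ⟨Y, hY, huY, fun k hk => by rw [h k hk]; exact hA k hk⟩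

structure Src (G : SimpleGraph V) (u : V) (K : Set V) (l : ℕ) (α : ℕ → V) : Prop where
  arm : Arm G u K l α
  str : 2 ≤ l → ∃ n f i j, Str G u K n f i j ∧ l = i ∧ ∀ k ≤ l, α k = f (i - k)

theorem Str.src {G : SimpleGraph V} {u : V} {K : Set V} {n : ℕ} {f : ℕ → V} {i j : ℕ}
    (s : Str G u K n f i j) (hin : i + 2 ≤ n) : Src G u K i (fun k => f (i - k)) :=
  ⟨s.arm hin, fun _ => ⟨n, f, i, j, s, rfl, fun _ _ => rfl⟩⟩

theorem Str.src2 {G : SimpleGraph V} {u : V} {K : Set V} {n : ℕ} {f : ℕ → V} {i j : ℕ}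
    (s : Str G u K n f i j) (hj2 : 2 ≤ j) : Src G u K (n - j) (fun k => f (j + k)) := by
  have h2 := s.jn
  have key : ∀ k ≤ n - j, f (j + k) = f (n - (n - j - k)) := by
    intro k hk; congr 1; omega
  exact ⟨(s.rev.arm (by omega)).congr key, fun _ => ⟨n, _, _, _, s.rev, rfl, key⟩⟩

theorem opt1 {G : SimpleGraph V} {u : V} {K : Set V} (c : Ctx G u K) {n : ℕ} {f : ℕ → V} {i j : ℕ}
    (s : Str G u K n f i j) (hi : 2 ≤ i) {l : ℕ} {α : ℕ → V} (A : Arm G u K l α)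
    (hne : α 0 ≠ f i) (hna : ¬ G.Adj (α 0) (f i)) (had : G.Adj (α 0) (f (i - 1))) :
    j = i ∧ 2 ≤ l ∧ G.Adj (α 1) (f i) ∧ ∀ k, i ≤ k → k ≤ n → ¬ G.Adj (α 0) (f k) := by
  classical
  have h2 := s.jn
  have hua : u ≠ α 0 := fun h => c.uS (h ▸ A.start)
  obtain ⟨Y, hY, huY, hfY⟩ := s.hole
  have e1 : G.Adj (f (i-1)) (f i) := by
    have := s.adj (i-1) (by rcases s.ij with h | h <;> omega)
    rwa [show i - 1 + 1 = i by omega] at this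
  rcases s.ij with hj | hj
  · subst hj
    have B := (s.src2 (by omega)).arm
    rcases contact c A B hne hna with ⟨h, hm⟩ | ⟨hl, hno, h⟩ | ⟨hl, hm, hno, h, h'⟩
    · exfalso
      have h3 := s.nadj (j-1) (j+1) (by omega) (by omega) (by omega)
      refine bad3 c.nc hY huY (hfY (j-1) (by omega)) (hfY j (by omega)) (hfY (j+1) (by omega))
        (conn_singleton (α 0)) e1 (s.adj j (by omega)) h3.1 h3.2 ?_ ?_ ⟨_, rfl, had.symm⟩
        ⟨_, rfl, h.symm⟩ (s.neu _ (by omega) (by omega)) (s.neu _ (by omega) (by omega))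
        (s.neu _ (by omega) (by omega)) hua
      · exact fun e => hne e.symm
      · rintro w rfl h; exact hna h.symm
    · refine ⟨rfl, hl, h, ?_⟩
      intro k hk hk2
      have := hno (k - j) (by omega)
      simpa [show j + (k - j) = k by omega] using this
    · exfalso
      have h3 := s.nadj (j-1) (j+1) (by omega) (by omega) (by omega)
      refine bad3 c.nc hY huY (hfY (j-1) (by omega)) (hfY j (by omega)) (hfY (j+1) (by omega))
        (conn_pair ((A.ip 0 1 (by omega) (by omega)).2.2 rfl)) e1 (s.adj j (by omega)) h3.1 h3.2
        ?_ ?_ ⟨α 0, by simp, had.symm⟩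
        ⟨α 1, by simp, h.symm⟩ (s.neu _ (by omega) (by omega)) (s.neu _ (by omega) (by omega))
        (s.neu _ (by omega) (by omega)) ?_
      · rintro (e | e)
        · exact hne e.symm
        · exact A.out 1 (by omega) (by omega) (e ▸ s.iS)
      · rintro w (rfl | rfl) h
        · exact hna h.symm
        · exact h' h.symm
      · rintro (e | e)
        · exact hua e
        · exact (A.ip 1 l (by omega) le_rfl).1 (by rw [A.fin, ← e])
  · exfalso
    subst hj
    by_cases haj : G.Adj (α 0) (f (i+1))
    · have h3 := s.nadj (i-1) (i+1) (by omega) (by omega) (by omega)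
      refine bad3 c.nc hY huY (hfY (i-1) (by omega)) (hfY i (by omega)) (hfY (i+1) (by omega))
        (conn_singleton (α 0)) e1 (s.adj i (by omega)) h3.1 h3.2 ?_ ?_ ⟨_, rfl, had.symm⟩
        ⟨_, rfl, haj.symm⟩ (s.neu _ (by omega) (by omega)) (s.neu _ (by omega) (by omega))
        (s.neu _ (by omega) (by omega)) hua
      · exact fun e => hne e.symm
      · rintro w rfl h; exact hna h.symm
    · have hnej : α 0 ≠ f (i+1) := by
        intro e
        exact (s.nadj (i-1) (i+1) (by omega) (by omega) (by omega)).1 (e ▸ had.symm)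
      have B := (s.src2 (by omega)).arm
      have hno : ∀ k ≤ n - (i+1), ¬ G.Adj (α 0) (f (i + 1 + k)) := by
        rcases contact c A B hnej haj with ⟨h, hm⟩ | ⟨hl, hno, h⟩ | ⟨hl, hm, hno, h, h'⟩
        · exfalso
          have h3 := s.nadj (i-1) (i+1) (by omega) (by omega) (by omega)
          have h4 := s.nadj i (i+1+1) (by omega) (by omega) (by omega)
          have h5 := s.nadj (i-1) (i+1+1) (by omega) (by omega) (by omega)
          refine bad4 c.nc hY huY (hfY (i-1) (by omega)) (hfY i (by omega)) (hfY (i+1) (by omega))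
            (conn_singleton (α 0)) e1 (s.adj i (by omega)) (s.adj (i+1) (by omega)) h3.1 h3.2
            h4.1 h4.2 h5.1 h5.2 ?_ ?_ ⟨_, rfl, had.symm⟩
            ⟨_, rfl, h.symm⟩ (s.neu _ (by omega) (by omega)) (s.neu _ (by omega) (by omega))
            (s.neu _ (by omega) (by omega)) (s.neu _ (by omega) (by omega)) hua
          · rintro w rfl h; exact hna h.symm
          · rintro w rfl h; exact haj h.symm
        · exact hno
        · exact hno
      have hex : ∃ k, k ≤ i - 1 ∧ G.Adj (α 0) (f k) := ⟨i-1, le_rfl, had⟩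
      obtain ⟨hk, hadk⟩ := Nat.find_spec hex
      have hmin : ∀ k, k < Nat.find hex → ¬ (k ≤ i - 1 ∧ G.Adj (α 0) (f k)) :=
        fun k hk => Nat.find_min hex hk
      generalize Nat.find hex = k0 at *
      have hk0 : 1 ≤ k0 := by
        by_contra h
        have : k0 = 0 := by omega
        subst this
        have := hno (n - (i+1)) le_rfl
        rw [show i + 1 + (n - (i+1)) = n by omega, s.fn, ← s.f0] at this
        exact this hadk
      have hw := s.hf.wrap (k := k0) (j := i + 1) (by omega) (by omega)
      have hp := hw.snoc (a := α 0) (by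
        intro t ht
        by_cases h1 : t ≤ n - (i+1)
        · rw [if_pos h1]
          refine ⟨?_, ?_⟩
          · by_cases h0 : t = 0
            · subst h0; exact hnej.symm
            · intro e; exact s.out (i+1+t) (by omega) (by omega) (e ▸ A.start)
          · constructor
            · intro h; exact absurd h.symm (hno t h1)
            · intro h; omega
        · rw [if_neg h1]
          refine ⟨?_, ?_⟩
          · intro e; exact s.out (t - (n - (i+1))) (by omega) (by omega) (e ▸ A.start)
          · constructor
            · intro h
              by_contra hc
              exact hmin _ (by omega) ⟨by omega, h.symm⟩
            · intro h
              rw [show t - (n - (i+1)) = k0 by omega]; exact hadk.symm)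
      obtain ⟨Z, hZ, hpZ, -, y, hyZ, hyK⟩ := close_path c.conn hp (by omega) (by
          intro t ht
          split_ifs
          · exact s.notK _ (by omega)
          · exact s.notK _ (by omega)
          · exact A.notK 0 (by omega)) (by
          intro t ht ht2
          apply not_adj_of_not_nb
          · rw [if_pos (by omega)]
            split_ifs
            · exact s.out _ (by omega) (by omega)
            · exact s.out _ (by omega) (by omega)
          · rw [if_pos (by omega)]
            split_ifs
            · exact s.notK _ (by omega)
            · exact s.notK _ (by omega)) (by
          rw [if_pos (by omega), if_pos (by omega)]; exact s.jS.2) (by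
          rw [if_neg (by omega)]; exact A.start.2)
      have := hpZ (n - (i+1)) (by omega)
      rw [if_pos (by omega), if_pos le_rfl, show i + 1 + (n - (i+1)) = n by omega, s.fn] at this
      exact c.hole Z hZ this y hyZ hyK

theorem opt1_false {G : SimpleGraph V} {u : V} {K : Set V} (c : Ctx G u K) {l m : ℕ} {α β : ℕ → V}
    (A : Src G u K l α) (B : Src G u K m β) (hne : α 0 ≠ β 0) (hna : ¬ G.Adj (α 0) (β 0))
    (had : G.Adj (α 0) (β 1)) (hm : 2 ≤ m) : False := by
  obtain ⟨n, f, i, j, s, rfl, hβ⟩ := B.str hm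
  have b0 : β 0 = f m := hβ 0 (by omega)
  have b1 : β 1 = f (m - 1) := hβ 1 (by omega)
  rw [b0] at hne hna
  rw [b1] at had
  obtain ⟨hj, hl, h1, hno⟩ := opt1 c s hm A.arm hne hna had
  obtain ⟨n', f', i', j', s', rfl, hα⟩ := A.str hl
  have a0 : α 0 = f' l := hα 0 (by omega)
  have a1 : α 1 = f' (l - 1) := hα 1 (by omega)
  obtain ⟨hj', hl', h1', hno'⟩ := opt1 c s' hl B.arm (by rw [← a0, b0]; exact hne.symm)
    (by rw [← a0, b0]; exact fun h => hna h.symm) (by rw [← a1, b0]; exact h1.symm)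
  subst hj hj'
  have hjn := s.jn
  have hjn' := s'.jn
  rcases contact c (s'.src2 (by omega)).arm (s.src2 (by omega)).arm (by simpa [← a0] using hne)
    (by simpa [← a0] using hna) with ⟨h, hm2⟩ | ⟨hl2, hno2, h⟩ | ⟨hl2, hm2, hno2, h, h'⟩
  · simp only [Nat.add_zero, ← a0] at h
    exact hno (j+1) (by omega) (by omega) h
  · simp only [Nat.add_zero, ← b0] at h
    exact hno' (j'+1) (by omega) (by omega) h.symm
  · simp only [Nat.add_zero] at h h'
    obtain ⟨Y, hY, huY, hfY⟩ := s.hole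
    have h3 := s.nadj (j-1) (j+1) (by omega) (by omega) (by omega)
    have e1 : G.Adj (f (j-1)) (f j) := by
      have := s.adj (j-1) (by omega)
      rwa [show j - 1 + 1 = j by omega] at this
    have e2 : G.Adj (α 0) (f' (j'+1)) := by rw [a0]; exact s'.adj j' (by omega)
    refine bad3 c.nc hY huY (hfY (j-1) (by omega)) (hfY j (by omega)) (hfY (j+1) (by omega))
      (conn_pair e2) e1 (s.adj j (by omega)) h3.1 h3.2
      ?_ ?_ ⟨α 0, by simp, had.symm⟩
      ⟨f' (j'+1), by simp, h.symm⟩ (s.neu _ (by omega) (by omega)) (s.neu _ (by omega) (by omega))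
      (s.neu _ (by omega) (by omega)) ?_
    · rintro (e | e)
      · exact hne e.symm
      · exact s'.out (j'+1) (by omega) (by omega) (e ▸ s.iS)
    · rintro w (rfl | rfl) h
      · exact hna h.symm
      · exact h' h.symm
    · rintro (e | e)
      · exact c.uS (e ▸ A.arm.start)
      · exact s'.neu (j'+1) (by omega) (by omega) e

theorem src_contact {G : SimpleGraph V} {u : V} {K : Set V} (c : Ctx G u K) {l m : ℕ}
    {α β : ℕ → V}
    (A : Src G u K l α) (B : Src G u K m β) (hne : α 0 ≠ β 0) (hna : ¬ G.Adj (α 0) (β 0)) :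
    (2 ≤ l ∧ 2 ≤ m ∧ G.Adj (α 1) (β 1) ∧ ¬ G.Adj (α 1) (β 0)) := by
  rcases contact c A.arm B.arm hne hna with ⟨h, hm⟩ | ⟨hl, hno, h⟩ | ⟨hl, hm, hno, h, h'⟩
  · exact (opt1_false c A B hne hna h hm).elim
  · exact (opt1_false c B A hne.symm (fun h => hna h.symm) h.symm hl).elim
  · exact ⟨hl, hm, h, h'⟩

theorem claim_final {G : SimpleGraph V} {u : V} {K : Set V} (c : Ctx G u K) {l m : ℕ}
    {α β : ℕ → V}
    (A : Src G u K l α) (B : Src G u K m β) (hne : α 0 ≠ β 0) (hna : ¬ G.Adj (α 0) (β 0)) :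
    False := by
  obtain ⟨hl, hm, h, h'⟩ := src_contact c A B hne hna
  obtain ⟨n, f, i, j, s, rfl, hβ⟩ := B.str hm
  have b0 : β 0 = f m := hβ 0 (by omega)
  have b1 : β 1 = f (m - 1) := hβ 1 (by omega)
  rw [b0] at hne hna h'
  rw [b1] at h
  have hjn := s.jn
  obtain ⟨Y, hY, huY, hfY⟩ := s.hole
  have e1 : G.Adj (f (m-1)) (f m) := by
    have := s.adj (m-1) (by rcases s.ij with h | h <;> omega)
    rwa [show m - 1 + 1 = m by omega] at this
  have hua : u ≠ α 0 := fun h => c.uS (h ▸ A.arm.start)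
  have hu1 : u ≠ α 1 := fun h =>
    (A.arm.ip 1 l (by omega) le_rfl).1 (by rw [A.arm.fin, ← h])
  have hS1 : α 1 ∉ Nb G K := A.arm.out 1 (by omega) (by omega)
  rcases s.ij with hj | hj
  · subst hj
    obtain ⟨-, hm2, h2, -⟩ := src_contact c A (s.src2 (by omega)) hne hna
    have h3 := s.nadj (j-1) (j+1) (by omega) (by omega) (by omega)
    refine bad3 c.nc hY huY (hfY (j-1) (by omega)) (hfY j (by omega)) (hfY (j+1) (by omega))
      (conn_singleton (α 1)) e1 (s.adj j (by omega)) h3.1 h3.2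
      ?_ ?_ ⟨α 1, by simp, h.symm⟩
      ⟨α 1, by simp, h2.symm⟩ (s.neu _ (by omega) (by omega)) (s.neu _ (by omega) (by omega))
      (s.neu _ (by omega) (by omega)) hu1
    · exact fun e => hS1 (e ▸ s.iS)
    · rintro w rfl h; exact h' h.symm
  · subst hj
    have h3 := s.nadj (m-1) (m+1) (by omega) (by omega) (by omega)
    by_cases haj : G.Adj (α 0) (f (m+1))
    · refine bad3 c.nc hY huY (hfY (m-1) (by omega)) (hfY m (by omega)) (hfY (m+1) (by omega))
        (conn_pair ((A.arm.ip 0 1 (by omega) (by omega)).2.2 rfl)) e1 (s.adj m (by omega)) h3.1 h3.2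
        ?_ ?_ ⟨α 1, by simp, h.symm⟩
        ⟨α 0, by simp, haj.symm⟩ (s.neu _ (by omega) (by omega)) (s.neu _ (by omega) (by omega))
        (s.neu _ (by omega) (by omega)) ?_
      · rintro (e | e)
        · exact hne e.symm
        · exact hS1 (e ▸ s.iS)
      · rintro w (rfl | rfl) h
        · exact hna h.symm
        · exact h' h.symm
      · rintro (e | e)
        · exact hua e
        · exact hu1 e
    · have hnej : α 0 ≠ f (m+1) := by
        intro e; exact hna (e ▸ (s.adj m (by omega)).symm)
      obtain ⟨-, hm2, h2, h2'⟩ := src_contact c A (s.src2 (by omega)) hnej haj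
      have h4 := s.nadj m (m+1+1) (by omega) (by omega) (by omega)
      have h5 := s.nadj (m-1) (m+1+1) (by omega) (by omega) (by omega)
      refine bad4 c.nc hY huY (hfY (m-1) (by omega)) (hfY m (by omega)) (hfY (m+1) (by omega))
        (conn_singleton (α 1)) e1 (s.adj m (by omega)) (s.adj (m+1) (by omega)) h3.1 h3.2
        h4.1 h4.2 h5.1 h5.2 ?_ ?_ ⟨_, rfl, h.symm⟩
        ⟨_, rfl, h2.symm⟩ (s.neu _ (by omega) (by omega)) (s.neu _ (by omega) (by omega))
        (s.neu _ (by omega) (by omega)) (s.neu _ (by omega) (by omega)) hu1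
      · rintro w rfl h; exact h' h.symm
      · rintro w rfl h; exact h2' h.symm

theorem exists_src {G : SimpleGraph V} {u : V} {K : Set V} (c : Ctx G u K) {b : V}
    (hb : b ∈ Nb G K) (hW : G.Adj b u ∨ ∃ Y, HS G Y ∧ u ∈ Y ∧ b ∈ Y) :
    ∃ l α, Src G u K l α ∧ α 0 = b := by
  classical
  by_cases h : G.Adj b u
  · refine ⟨1, fun k => if k = 0 then b else u, ⟨⟨?_, le_rfl, by simpa using hb, by simp, ?_, ?_, ?_⟩,
      fun h => by omega⟩, by simp⟩
    · intro i j hij hj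
      have h1 : i = 0 := by omega
      have h2 : j = 1 := by omega
      subst h1 h2
      simp [h, h.ne]
    · intro k h1 h2
      have h2 : k = 1 := by omega
      subst h2; simpa using c.uS
    · intro k h1
      have h2 : k = 0 ∨ k = 1 := by omega
      rcases h2 with rfl | rfl
      · simpa using hb.1
      · simpa using c.uK
    · intro h; omega
  · obtain ⟨Y, hY, huY, hbY⟩ := hW.resolve_left h
    obtain ⟨n, f, hf, hf0, hfY⟩ := hY.based huY
    obtain ⟨r, hr, hrb⟩ := (hfY b).1 hbY
    have hex : ∃ k, k < n ∧ f k ∈ Nb G K := ⟨r, hr, hrb ▸ hb⟩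
    have hex2 : ∃ k, k < n ∧ f (n - 1 - k) ∈ Nb G K :=
      ⟨n - 1 - r, by omega, by rw [show n - 1 - (n - 1 - r) = r by omega]; exact hrb ▸ hb⟩
    obtain ⟨hin, hiS⟩ := Nat.find_spec hex
    have hmin : ∀ k, k < Nat.find hex → ¬ (k < n ∧ f k ∈ Nb G K) :=
      fun k hk => Nat.find_min hex hk
    generalize Nat.find hex = i at *
    obtain ⟨hjn, hjS⟩ := Nat.find_spec hex2
    have hmin2 : ∀ k, k < Nat.find hex2 → ¬ (k < n ∧ f (n - 1 - k) ∈ Nb G K) :=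
      fun k hk => Nat.find_min hex2 hk
    generalize Nat.find hex2 = j' at *
    obtain ⟨j, hj⟩ : ∃ j, j = n - 1 - j' := ⟨_, rfl⟩
    rw [← hj] at hjS
    have hfn : f n = u := by rw [hf.2.1, hf0]
    have hout : ∀ k ≤ n, (k < i ∨ j < k) → f k ∉ Nb G K := by
      intro k hk hk2 hS
      by_cases hkn : k = n
      · subst hkn; exact c.uS (hfn ▸ hS)
      rcases hk2 with hk2 | hk2
      · exact hmin k hk2 ⟨by omega, hS⟩
      · exact hmin2 (n - 1 - k) (by omega)
          ⟨by omega, by rwa [show n - 1 - (n - 1 - k) = k by omega]⟩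
    have hnK : ∀ k ≤ n, f k ∉ K := by
      intro k hk
      by_cases hkn : k = n
      · subst hkn; rw [hfn]; exact c.uK
      · exact c.hole Y hY huY _ ((hfY _).2 ⟨k, by omega, rfl⟩)
    have hi1 : 1 ≤ i := by
      by_contra h
      have : i = 0 := by omega
      subst this; exact c.uS (hf0 ▸ hiS)
    have hij : i ≤ j := by
      by_contra h
      exact hout j (by omega) (by omega) hjS
    have hji : j ≤ i + 1 := by
      by_contra h
      have hp := hf.wrap (k := i) (j := j) (by omega) (by omega)
      obtain ⟨Z, hZ, hpZ, -, y, hyZ, hyK⟩ := close_path c.conn hp (by omega) (by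
          intro t ht
          split_ifs
          · exact hnK _ (by omega)
          · exact hnK _ (by omega)) (by
          intro t ht ht2
          apply not_adj_of_not_nb
          · split_ifs
            · exact hout _ (by omega) (by omega)
            · exact hout _ (by omega) (by omega)
          · split_ifs
            · exact hnK _ (by omega)
            · exact hnK _ (by omega)) (by
          rw [if_pos (by omega)]; exact hjS.2) (by
          rw [if_neg (by omega), show n - j + i - (n - j) = i by omega]; exact hiS.2)
      have := hpZ (n - j) (by omega)
      rw [if_pos le_rfl, show j + (n - j) = n by omega, hfn] at this
      exact c.hole Z hZ this y hyZ hyK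
    have s : Str G u K n f i j :=
      ⟨hf, hf0, hi1, by omega, by omega, hiS, hjS, hout, hnK⟩
    have hri : r = i ∨ r = j := by
      by_contra h
      exact hout r (by omega) (by
        by_contra h2
        omega) (hrb ▸ hb)
    rcases hri with rfl | rfl
    · refine ⟨_, _, s.src ?_, by simpa using hrb⟩
      by_contra hc
      apply h
      have := s.adj r (by omega)
      rwa [hrb, show r + 1 = n by omega, hfn] at this
    · refine ⟨_, _, s.src2 ?_, by simpa using hrb⟩
      by_contra hc
      apply h
      have := s.adj 0 (by omega)
      rw [hf0, show 0 + 1 = r by omega, hrb] at this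
      exact this.symm

theorem sep_claim {G : SimpleGraph V} {u : V} {K : Set V} (c : Ctx G u K)
    (hW : ∀ b ∈ Nb G K, G.Adj b u ∨ ∃ Y, HS G Y ∧ u ∈ Y ∧ b ∈ Y) {a b : V}
    (ha : a ∈ Nb G K) (hb : b ∈ Nb G K) (hne : a ≠ b) : G.Adj a b := by
  by_contra hna
  obtain ⟨l, α, A, rfl⟩ := exists_src c ha (hW a ha)
  obtain ⟨m, β, B, rfl⟩ := exists_src c hb (hW b hb)
  exact claim_final c A B hne hna

/-! ### Restricted graphs, components, splitting -/

/-- The subgraph of `G` with edges inside `U`. -/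
def Gr (G : SimpleGraph V) (U : Set V) : SimpleGraph V where
  Adj x y := G.Adj x y ∧ x ∈ U ∧ y ∈ U
  symm := by constructor; intro x y h; exact ⟨h.1.symm, h.2.2, h.2.1⟩
  loopless := by constructor; intro x h; exact G.loopless.irrefl x h.1

theorem rtg_mono {r s : V → V → Prop} (hrs : ∀ a b, r a b → s a b) {x y : V}
    (h : Relation.ReflTransGen r x y) : Relation.ReflTransGen s x y := by
  induction h with
  | refl => exact Relation.ReflTransGen.refl
  | tail h1 h2 ih => exact ih.tail (hrs _ _ h2)

theorem HS_Gr {G : SimpleGraph V} {U Y : Set V} : HS (Gr G U) Y ↔ HS G Y ∧ Y ⊆ U := by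
  constructor
  · rintro ⟨n, f, hf, hY⟩
    have h4 := hf.1
    have hU : ∀ i, i < n → f i ∈ U := by
      intro i hi
      exact ((hf.ext i (i+1) (by omega) (by omega) (by omega)).2.2 (by omega)).2.1
    refine ⟨⟨n, f, ⟨hf.1, hf.2.1, ?_⟩, hY⟩, ?_⟩
    · intro i j hij hj
      have := hf.2.2 i j hij hj
      refine ⟨this.1, ?_⟩
      rw [← this.2]
      exact ⟨fun h => ⟨h, hU _ (by omega), hU _ hj⟩, fun h => h.1⟩
    · intro y hy
      obtain ⟨i, hi, rfl⟩ := (hY y).1 hy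
      exact hU i hi
  · rintro ⟨⟨n, f, hf, hY⟩, hU⟩
    refine ⟨n, f, ⟨hf.1, hf.2.1, ?_⟩, hY⟩
    intro i j hij hj
    have := hf.2.2 i j hij hj
    refine ⟨this.1, ?_⟩
    rw [← this.2]
    exact ⟨fun h => h.1, fun h => ⟨h, hU ((hY _).2 ⟨i, by omega, rfl⟩),
      hU ((hY _).2 ⟨j, by omega, rfl⟩)⟩⟩

theorem Conn.of_Gr {G : SimpleGraph V} {U X : Set V} (h : Conn (Gr G U) X) : Conn G X := by
  intro x hx y hy
  exact rtg_mono (fun a b h => ⟨h.1.1, h.2⟩) (h x hx y hy)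

def Comp (H : SimpleGraph V) (A : Set V) (x : V) : Set V :=
  {y | Relation.ReflTransGen (fun a b => H.Adj a b ∧ b ∈ A) x y}

theorem self_mem_Comp {H : SimpleGraph V} {A : Set V} {x : V} : x ∈ Comp H A x :=
  Relation.ReflTransGen.refl

theorem Comp_sub {H : SimpleGraph V} {A : Set V} {x : V} (hx : x ∈ A) : Comp H A x ⊆ A := by
  intro y hy
  rcases Relation.ReflTransGen.cases_tail hy with h | ⟨z, -, h⟩
  · rwa [h]
  · exact h.2

theorem Comp_step {H : SimpleGraph V} {A : Set V} {x y z : V} (hy : y ∈ Comp H A x)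
    (h : H.Adj y z) (hz : z ∈ A) : z ∈ Comp H A x :=
  Relation.ReflTransGen.tail hy ⟨h, hz⟩

theorem conn_of_center {H : SimpleGraph V} {X : Set V} {c : V} (hc : c ∈ X)
    (h : ∀ y ∈ X, Relation.ReflTransGen (fun a b => H.Adj a b ∧ b ∈ X) c y) : Conn H X := by
  intro y hy z hz
  refine Relation.ReflTransGen.trans ?_ (h z hz)
  have key : y ∈ X ∧ Relation.ReflTransGen (fun a b => H.Adj a b ∧ b ∈ X) y c := by
    have := h y hy
    clear hy
    induction this with
    | refl => exact ⟨hc, Relation.ReflTransGen.refl⟩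
    | tail h1 h2 ih => exact ⟨h2.2, Relation.ReflTransGen.head ⟨h2.1.symm, ih.1⟩ ih.2⟩
  exact key.2

theorem Comp_conn {H : SimpleGraph V} {A : Set V} {x : V} : Conn H (Comp H A x) := by
  refine conn_of_center self_mem_Comp ?_
  intro y hy
  have : Relation.ReflTransGen (fun a b => H.Adj a b ∧ b ∈ A) x y := hy
  clear hy
  induction this with
  | refl => exact Relation.ReflTransGen.refl
  | tail h1 h2 ih => exact ih.tail ⟨h2.1, Comp_step h1 h2.1 h2.2⟩

theorem Nb_Comp {H : SimpleGraph V} {A : Set V} {x s : V} (hs : s ∈ Nb H (Comp H A x)) :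
    s ∉ A := by
  obtain ⟨h1, y, hy, h2⟩ := hs
  exact fun h => h1 (Comp_step hy h2.symm h)

theorem Conn.union {H : SimpleGraph V} {X Y : Set V} (hX : Conn H X) (hY : Conn H Y) {c : V}
    (h1 : c ∈ X) (h2 : c ∈ Y) : Conn H (X ∪ Y) := by
  refine conn_of_center (Or.inl h1) ?_
  rintro y (hy | hy)
  · exact rtg_mono (fun a b h => ⟨h.1, Or.inl h.2⟩) (hX c h1 y hy)
  · exact rtg_mono (fun a b h => ⟨h.1, Or.inr h.2⟩) (hY c h2 y hy)

theorem conn_path {H : SimpleGraph V} {m : ℕ} {p : ℕ → V} (hp : IP H m p) (a : ℕ) (ha : a ≤ m) :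
    Conn H {y | ∃ k, a ≤ k ∧ k ≤ m ∧ p k = y} := by
  refine conn_of_center (c := p a) ⟨a, le_rfl, ha, rfl⟩ ?_
  rintro y ⟨k, hak, hkm, rfl⟩
  induction k, hak using Nat.le_induction with
  | base => exact Relation.ReflTransGen.refl
  | succ k hk ih =>
    exact (ih (by omega)).tail ⟨(hp k (k+1) (by omega) hkm).2.2 rfl, k + 1, by omega, hkm, rfl⟩

def PP (G : SimpleGraph V) (gd : Set V → V → Prop) (U : Set V) : Prop :=
  ∀ Q : Set V, G.IsClique Q → ¬ U ⊆ Q → ∃ v ∈ U, v ∉ Q ∧ gd U v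

def Local (G : SimpleGraph V) (gd : Set V → V → Prop) : Prop :=
  ∀ U' U v, U' ⊆ U → v ∈ U' → gd U' v → (∀ x ∈ U, G.Adj v x → x ∈ U') → gd U v

theorem split {G : SimpleGraph V} {gd : Set V → V → Prop} (hl : Local G gd) {U K : Set V}
    (hKU : K ⊆ U) (hK : K.Nonempty) (hS : G.IsClique (Nb (Gr G U) K)) {z : V} (hz : z ∈ U)
    (hzK : z ∉ K) (hzS : z ∉ Nb (Gr G U) K) (ih : ∀ U', U' ⊂ U → PP G gd U') : PP G gd U := by
  intro Q hQ hUQ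
  have hSU : Nb (Gr G U) K ⊆ U := by
    rintro s ⟨-, x, -, h⟩; exact h.2.1
  have hnb : ∀ v ∈ U, v ∉ K → ∀ x ∈ K, G.Adj v x → v ∈ Nb (Gr G U) K :=
    fun v hv hvK x hx had => ⟨hvK, x, hx, had, hv, hKU hx⟩
  by_cases hqe : ∃ q ∈ Q, q ∈ K
  · obtain ⟨q, hq, hqK⟩ := hqe
    obtain ⟨v, ⟨hvU, hvK⟩, hvS, hg⟩ := ih (U \ K) ⟨Set.sdiff_subset, fun h => (h (hKU hqK)).2 hqK⟩
      (Nb (Gr G U) K) hS (fun h => hzS (h ⟨hz, hzK⟩))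
    refine ⟨v, hvU, ?_, ?_⟩
    · intro hvQ
      have hne : v ≠ q := fun e => hvK (e ▸ hqK)
      exact hvS (hnb v hvU hvK q hqK (hQ hvQ hq hne))
    · refine hl _ _ v Set.sdiff_subset ⟨hvU, hvK⟩ hg ?_
      intro x hx had
      exact ⟨hx, fun hxK => hvS (hnb v hvU hvK x hxK had)⟩
  · obtain ⟨k, hk⟩ := hK
    have hsub : K ∪ Nb (Gr G U) K ⊆ U := Set.union_subset hKU hSU
    obtain ⟨v, hv, hvS, hg⟩ := ih (K ∪ Nb (Gr G U) K)
      ⟨hsub, fun h => by rcases h hz with h | h; exacts [hzK h, hzS h]⟩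
      (Nb (Gr G U) K) hS (fun h => (h (Or.inl hk)).1 hk)
    have hvK : v ∈ K := hv.resolve_right hvS
    refine ⟨v, hKU hvK, fun h => hqe ⟨v, h, hvK⟩, ?_⟩
    refine hl _ _ v hsub hv hg ?_
    intro x hx had
    by_cases hxK : x ∈ K
    · exact Or.inl hxK
    · exact Or.inr (hnb x hx hxK v hvK had.symm)

def simpl (G : SimpleGraph V) (U : Set V) (v : V) : Prop := G.IsClique {x | x ∈ U ∧ G.Adj v x}

theorem simpl_local {G : SimpleGraph V} : Local G (simpl G) := by
  intro U' U v hU hv h hN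
  intro x hx y hy hne
  exact h ⟨hN x hx.1 hx.2, hx.2⟩ ⟨hN y hy.1 hy.2, hy.2⟩ hne

theorem dirac [Finite V] {G : SimpleGraph V} (U : Set V) (hfree : ∀ Y, HS G Y → ¬ Y ⊆ U) :
    PP G (simpl G) U := by
  induction U using WellFoundedLT.induction with
  | ind U ih =>
  by_cases hU : G.IsClique U
  · intro Q hQ hUQ
    obtain ⟨v, hv, hvQ⟩ := Set.not_subset.1 hUQ
    exact ⟨v, hv, hvQ, fun x hx y hy hne => hU hx.1 hy.1 hne⟩
  · have : ∃ x ∈ U, ∃ y ∈ U, x ≠ y ∧ ¬ G.Adj x y := by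
      by_contra hc
      push Not at hc
      exact hU (fun x hx y hy hne => hc x hx y hy hne)
    obtain ⟨x, hx, y, hy, hne, hna⟩ := this
    let A : Set V := {a | a ∈ U ∧ a ≠ x ∧ ¬ G.Adj x a}
    have hyA : y ∈ A := ⟨hy, hne.symm, hna⟩
    have hKA := Comp_sub (H := Gr G U) hyA
    have hSx : ∀ s ∈ Nb (Gr G U) (Comp (Gr G U) A y), s ∈ U ∧ G.Adj s x := by
      intro s hs
      have h1 := Nb_Comp hs
      obtain ⟨-, k, hk, had⟩ := hs
      refine ⟨had.2.1, ?_⟩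
      by_contra hc
      refine h1 ⟨had.2.1, ?_, fun h => hc h.symm⟩
      rintro rfl
      exact (hKA hk).2.2 had.1
    refine split simpl_local (K := Comp (Gr G U) A y) (fun a ha => (hKA ha).1) ⟨y, self_mem_Comp⟩
      ?_ hx (fun h => (hKA h).2.1 rfl) (fun h => (hSx x h).2.ne rfl) ?_
    · intro s hs t ht hst
      by_contra hst'
      have h1 := hSx s hs
      have h2 := hSx t ht
      obtain ⟨Y, hY, -⟩ := close3 (G := Gr G U) Comp_conn (x := s) (y := x) (z := t)
        ⟨h1.2, h1.1, hx⟩ ⟨h2.2.symm, hx, h2.1⟩ (fun h => hst' h.1) hst hs.1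
        (fun h => (hKA h).2.1 rfl) ht.1 (fun w hw h => (hKA hw).2.2 h.1) hs.2 ht.2
      exact hfree Y (HS_Gr.1 hY).1 (HS_Gr.1 hY).2
    · intro U' hU'
      exact ih U' hU' (fun Y hY h => hfree Y hY (h.trans hU'.1))

/-! ### The main elimination argument -/

structure NCG (G : SimpleGraph V) (C : Set V) : Prop where
  nc : ∀ u ∈ C, NCu G u
  cov : ∀ Y, HS G Y → ∃ u ∈ C, u ∈ Y
  uniq : ∀ Y, HS G Y → ∀ u ∈ C, ∀ v ∈ C, u ∈ Y → v ∈ Y → u = v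

theorem NCG.gr {G : SimpleGraph V} {C : Set V} (h : NCG G C) (U : Set V) : NCG (Gr G U) C := by
  refine ⟨?_, fun Y hY => h.cov Y (HS_Gr.1 hY).1, fun Y hY => h.uniq Y (HS_Gr.1 hY).1⟩
  intro u hu Y Z hY hZ huY huZ x y z hne hxy hyz
  exact h.nc u hu Y Z (HS_Gr.1 hY).1 (HS_Gr.1 hZ).1 huY huZ x y z hne hxy.1 hyz.1

/-- Local situation at the end: `v` is a vertex outside `C` whose closed neighbourhood outside
`C` is a clique. -/
structure Term (H : SimpleGraph V) (C : Set V) (v : V) : Prop where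
  g : NCG H C
  vC : v ∉ C
  cl : ∀ x y, x ∉ C → y ∉ C → H.Adj v x → H.Adj v y → x ≠ y → H.Adj x y
  cc : ∀ x y, x ∈ C → y ∈ C → H.Adj v x → H.Adj v y → x ≠ y → H.Adj x y
  w : ∀ u x, u ∈ C → H.Adj v u → H.Adj v x → x ≠ u → ¬ H.Adj u x →
    ∃ Y, HS H Y ∧ u ∈ Y ∧ x ∈ Y

theorem Term.t1 {H : SimpleGraph V} {C : Set V} {v : V} (T : Term H C v) {u x : V} (hu : u ∈ C)
    (hx : x ∉ C) (huv : H.Adj v u) (hxv : H.Adj v x) (hux : ¬ H.Adj u x) :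
    ∃ m p, IP H m p ∧ 2 ≤ m ∧ p 0 = u ∧ p m = x ∧
      (∀ k, 0 < k → k < m → p k ≠ v ∧ ¬ H.Adj v (p k)) ∧ ∀ k, 0 < k → k ≤ m → p k ∉ C := by
  have hne : x ≠ u := fun e => hx (e ▸ hu)
  obtain ⟨Y, hY, huY, hxY⟩ := T.w u x hu huv hxv hne hux
  obtain ⟨n, f, hf, hf0, hfY⟩ := hY.based huY
  have key : ∀ (g : ℕ → V), HF H n g → g 0 = u → (∀ k, 0 < k → k < n → g k ∉ C) → ∀ r, r < n →
      g r = x → (∀ k, 0 < k → k < r → g k ≠ v ∧ ¬ H.Adj v (g k)) → 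
      ∃ m p, IP H m p ∧ 2 ≤ m ∧ p 0 = u ∧ p m = x ∧
      (∀ k, 0 < k → k < m → p k ≠ v ∧ ¬ H.Adj v (p k)) ∧ ∀ k, 0 < k → k ≤ m → p k ∉ C := by
    intro g hg hg0 hgC r hrn hgr hInt
    have h4 := hg.1
    have hr0 : r ≠ 0 := by rintro rfl; exact hne (by rw [← hgr, hg0])
    have hr := hg.2.2 0 r (by omega) hrn
    rw [hg0, hgr] at hr
    have hr2 : ¬ (r = 0 + 1 ∨ (0 = 0 ∧ r + 1 = n)) := fun h => hux (hr.2.2 h)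
    refine ⟨r, g, ?_, by omega, hg0, hgr, hInt, fun k h1 h2 => hgC k h1 (by omega)⟩
    intro i j hij hj
    have := hg.2.2 i j hij (by omega)
    refine ⟨this.1, ?_⟩
    rw [this.2]; omega
  have hfC : ∀ k, 0 < k → k < n → f k ∉ C := by
    intro k h1 h2 hC
    have := T.g.uniq Y hY u hu (f k) hC huY ((hfY _).2 ⟨k, h2, rfl⟩)
    exact (hf.2.2 0 k h1 h2).1 (by rw [hf0, this])
  obtain ⟨r, hr, hrx⟩ := (hfY x).1 hxY
  by_cases h1 : ∀ k, 0 < k → k < r → f k ≠ v ∧ ¬ H.Adj v (f k)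
  · exact key f hf hf0 hfC r hr hrx h1
  · have hr0 : r ≠ 0 := by rintro rfl; exact hne (by rw [← hrx, hf0])
    refine key _ hf.rev (by simp [hf.2.1, hf0]) (fun k h1 h2 => hfC _ (by omega) (by omega)) (n - r)
      (by omega) (by rw [show n - (n - r) = r by omega, hrx]) ?_
    intro k hk0 hk
    push Not at h1
    obtain ⟨t, ht0, htr, ht⟩ := h1
    have h4 := hf.1
    have hd := hf.2.2 t (n - k) (by omega) (by omega)
    have hd2 : ¬ H.Adj (f t) (f (n - k)) := by rw [hd.2]; omega
    have c1 := hfC t (by omega) (by omega)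
    have c2 := hfC (n - k) (by omega) (by omega)
    constructor
    · intro e
      have := ht (fun e' => hd.1 (by rw [e, e']))
      exact hd2 (e ▸ this.symm)
    · intro had
      by_cases e : f t = v
      · exact hd2 (e ▸ had)
      · exact hd2 (T.cl _ _ c1 c2 (ht e) had hd.1)

theorem Term.t2a {H : SimpleGraph V} {C : Set V} {v : V} (T : Term H C v) {u u' x : V}
    (hu' : u' ∈ C) (hne : u ≠ u') (huv' : H.Adj v u') (hxv : H.Adj v x)
    (hux' : ¬ H.Adj u' x) (huv : H.Adj v u)
    {m : ℕ} {p : ℕ → V} (hp : IP H m p) (hm : 2 ≤ m) (hp0 : p 0 = u) (hpm : p m = x)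
    (hInt : ∀ k, 0 < k → k < m → p k ≠ v ∧ ¬ H.Adj v (p k))
    (hpC : ∀ k, 0 < k → k ≤ m → p k ∉ C) : ∀ k, 1 ≤ k → k ≤ m → ¬ H.Adj u' (p k) := by
  classical
  intro k1 h1 h2 h3
  have hex : ∃ t, t < m ∧ H.Adj u' (p (m - t)) := ⟨m - k1, by omega, by
    rwa [show m - (m - k1) = k1 by omega]⟩
  obtain ⟨ht, had⟩ := Nat.find_spec hex
  have hmin : ∀ k, k < Nat.find hex → ¬ (k < m ∧ H.Adj u' (p (m - k))) :=
    fun k hk => Nat.find_min hex hk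
  generalize Nat.find hex = t at *
  have ht0 : t ≠ 0 := by
    rintro rfl
    rw [Nat.sub_zero, hpm] at had
    exact hux' had
  have hpv : ∀ k ≤ m, p k ≠ v := by
    intro k hk
    by_cases h0 : k = 0
    · rw [h0, hp0]; exact huv.ne'
    by_cases h0 : k = m
    · rw [h0, hpm]; exact hxv.ne'
    exact (hInt k (by omega) (by omega)).1
  have hp' : IP H t (fun s => p (m - t + s)) := by
    intro i j hij hj
    have := hp (m - t + i) (m - t + j) (by omega) (by omega)
    refine ⟨this.1, ?_⟩
    rw [this.2]; omega
  have hR := hp'.snoc (a := v) (by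
    intro s hs
    refine ⟨hpv _ (by omega), ?_⟩
    constructor
    · intro h
      by_contra hc
      exact (hInt _ (by omega) (by omega)).2 h.symm
    · rintro rfl
      rw [show m - s + s = m by omega, hpm]; exact hxv.symm)
  obtain ⟨Z, hZ, hRZ, -, y, hyZ, rfl⟩ := close_path (conn_singleton u') hR (by omega) (by
      intro s hs
      split_ifs with hst
      · intro e
        exact hpC (m - t + s) (by omega) (by omega) (e ▸ hu')
      · exact huv'.ne) (by
      intro s hs hs2
      rw [if_pos (by omega)]
      rintro w rfl h
      exact hmin (t - s) (by omega) ⟨by omega, by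
        rw [show m - (t - s) = m - t + s by omega]; exact h.symm⟩)
      ⟨_, rfl, by rw [if_pos (by omega)]; exact had.symm⟩
      ⟨_, rfl, by rw [if_neg (by omega)]; exact huv'⟩
  obtain ⟨Y, hY, hpY, hYs, y', hyY, rfl⟩ := close_path (conn_singleton v) hp hm
    (fun i hi e => hpv i hi e) (by
      rintro i hi hi2 w rfl h
      exact (hInt i hi hi2).2 h.symm) ⟨_, rfl, by rw [hp0]; exact huv.symm⟩
      ⟨_, rfl, by rw [hpm]; exact hxv.symm⟩
  have z1 := hRZ (t - 1) (by omega)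
  have z2 := hRZ t (by omega)
  have z3 := hRZ (t + 1) (by omega)
  rw [if_pos (by omega), show m - t + (t - 1) = m - 1 by omega] at z1
  rw [if_pos (by omega), show m - t + t = m by omega] at z2
  rw [if_neg (by omega)] at z3
  refine T.g.nc y hu' Z Y hZ hY hyZ ?_ (p (m - 1)) (p m) y' (hpv _ (by omega))
    ((hp (m-1) m (by omega) le_rfl).2.2 (by omega)) (by rw [hpm]; exact hxv.symm) z1 z2 z3
    (hpY _ (by omega)) (hpY _ le_rfl) hyY
  intro h
  rcases hYs _ h with h | ⟨i, hi, h⟩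
  · exact huv'.ne' h
  · by_cases h0 : i = 0
    · subst h0; exact hne (hp0 ▸ h)
    · exact hpC i (by omega) hi (h ▸ hu')

theorem Term.t2 {H : SimpleGraph V} {C : Set V} {v : V} (T : Term H C v) {u u' x : V}
    (hu : u ∈ C) (hu' : u' ∈ C) (hne : u ≠ u') (huv : H.Adj v u) (huv' : H.Adj v u')
    (hx : x ∉ C) (hxv : H.Adj v x) (hux : ¬ H.Adj u x) : H.Adj u' x := by
  by_contra hux'
  obtain ⟨m, p, hp, hm, hp0, hpm, hInt, hpC⟩ := T.t1 hu hx huv hxv hux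
  obtain ⟨m', p', hp', hm', hp0', hpm', hInt', hpC'⟩ := T.t1 hu' hx huv' hxv hux'
  have a1 := T.t2a hu' hne huv' hxv hux' huv hp hm hp0 hpm hInt hpC
  have a2 := T.t2a hu hne.symm huv hxv hux huv' hp' hm' hp0' hpm' hInt' hpC'
  have hX := (conn_path hp 2 hm).union (conn_path hp' 1 (by omega)) (c := x)
    ⟨m, hm, le_rfl, hpm⟩ ⟨m', by omega, le_rfl, hpm'⟩
  have hCX : ∀ w ∈ ({y | ∃ k, 2 ≤ k ∧ k ≤ m ∧ p k = y} ∪ {y | ∃ k, 1 ≤ k ∧ k ≤ m' ∧ p' k = y} :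
      Set V), w ∉ C := by
    rintro w (⟨k, h1, h2, rfl⟩ | ⟨k, h1, h2, rfl⟩)
    · exact hpC k (by omega) h2
    · exact hpC' k (by omega) h2
  have hu1 : H.Adj u (p 1) := by rw [← hp0]; exact (hp 0 1 (by omega) (by omega)).2.2 rfl
  obtain ⟨Y, hY, y1, y2, -⟩ := close3 hX (x := u') (y := u) (z := p 1)
    (T.cc _ _ hu' hu huv' huv hne.symm)
    hu1 (a1 1 le_rfl (by omega)) (fun e => hpC 1 (by omega) (by omega) (e ▸ hu'))
    (fun h => hCX _ h hu') (fun h => hCX _ h hu) (by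
      rintro (⟨k, h1, h2, e⟩ | ⟨k, h1, h2, e⟩)
      · exact (hp 1 k (by omega) h2).1 e.symm
      · exact a2 k h1 h2 (e ▸ hu1)) (by
      rintro w (⟨k, h1, h2, rfl⟩ | ⟨k, h1, h2, rfl⟩)
      · rw [← hp0, (hp 0 k (by omega) h2).2]; omega
      · exact a2 k h1 h2) 
      ⟨p' 1, Or.inr ⟨1, le_rfl, by omega, rfl⟩, by
        rw [← hp0']; exact (hp' 0 1 (by omega) (by omega)).2.2 rfl⟩
      ⟨p 2, Or.inl ⟨2, le_rfl, hm, rfl⟩, (hp 1 2 (by omega) (by omega)).2.2 rfl⟩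
  exact hne (T.g.uniq Y hY u hu u' hu' y2 y1)

theorem Term.t3 {H : SimpleGraph V} {C : Set V} {v : V} (T : Term H C v) {u u' x x' : V}
    (hu : u ∈ C) (hu' : u' ∈ C) (hne : u ≠ u') (huv : H.Adj v u) (huv' : H.Adj v u')
    (hx : x ∉ C) (hxv : H.Adj v x) (hux : ¬ H.Adj u x)
    (hx' : x' ∉ C) (hxv' : H.Adj v x') (hux' : ¬ H.Adj u' x') : False := by
  have h1 := T.t2 hu hu' hne huv huv' hx hxv hux
  have h2 := T.t2 hu' hu hne.symm huv' huv hx' hxv' hux'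
  have hxx : x ≠ x' := by rintro rfl; exact hux h2
  have h3 := T.cl x x' hx hx' hxv hxv' hxx
  obtain ⟨Y, hY, y1, y2, -⟩ := close3 (conn_singleton x') (x := u) (y := u') (z := x)
    (T.cc _ _ hu hu' huv huv' hne) h1 hux (fun e => hx (e ▸ hu)) (fun e => hx' (e ▸ hu))
    (fun e => hx' (e ▸ hu')) hxx (by rintro w rfl; exact hux') ⟨_, rfl, h2⟩ ⟨_, rfl, h3⟩
  exact hne (T.g.uniq Y hY u hu u' hu' y1 y2)

/-- `v` has a neighbourhood in `U` which yields a clique and a clique minor. -/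
def good (G : SimpleGraph V) (U : Set V) (v : V) : Prop :=
  ∃ S D : Set V, G.IsClique S ∧ S.ncard = {x | x ∈ U ∧ G.Adj v x}.ncard ∧ D.Nonempty ∧ Conn G D ∧
    (∀ x ∈ S, x ∉ D) ∧ ∀ x ∈ S, ∃ d ∈ D, G.Adj x d

theorem good_local {G : SimpleGraph V} : Local G (good G) := by
  rintro U' U v hU hv ⟨S, D, h1, h2, h⟩ hN
  refine ⟨S, D, h1, ?_, h⟩
  rw [h2]
  congr 1
  ext x
  exact ⟨fun h => ⟨hU h.1, h.2⟩, fun h => ⟨hN x h.1 h.2, h.2⟩⟩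

theorem good_of_simpl {G : SimpleGraph V} {U : Set V} {v : V} (h : simpl G U v) : good G U v :=
  ⟨{x | x ∈ U ∧ G.Adj v x}, {v}, h, rfl, ⟨v, rfl⟩, conn_singleton v,
    fun x hx e => hx.2.ne e.symm, fun x hx => ⟨v, rfl, hx.2.symm⟩⟩

theorem good_of_term [Finite V] {G : SimpleGraph V} {U C : Set V} {v : V} (hv : v ∈ U)
    (T : Term (Gr G U) C v) : good G U v := by
  by_cases hs : simpl G U v
  · exact good_of_simpl hs
  have hA : ∀ {x}, x ∈ {x | x ∈ U ∧ G.Adj v x} ↔ (Gr G U).Adj v x :=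
    fun {x} => ⟨fun h => ⟨h.2, hv, h.1⟩, fun h => ⟨h.2.2, h.1⟩⟩
  have hex : ∃ u x, u ∈ C ∧ x ∉ C ∧ (Gr G U).Adj v u ∧ (Gr G U).Adj v x ∧ ¬ (Gr G U).Adj u x := by
    by_contra hc
    push Not at hc
    apply hs
    intro a ha b hb hab
    have ha' := hA.1 ha
    have hb' := hA.1 hb
    by_cases h1 : a ∈ C <;> by_cases h2 : b ∈ C
    · exact (T.cc a b h1 h2 ha' hb' hab).1
    · exact (hc a b h1 h2 ha' hb').1
    · exact (hc b a h2 h1 hb' ha').1.symm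
    · exact (T.cl a b h1 h2 ha' hb' hab).1
  obtain ⟨u, x0, hu, hx0, huv, hxv0, hux0⟩ := hex
  let N : Set V := {x | x ∈ U ∧ G.Adj v x}
  let S : Set V := insert v (N \ {u})
  let A : Set V := {a | a ∉ S}
  have huA : u ∈ A := by
    rintro (h | h)
    · exact huv.ne' h
    · exact h.2 rfl
  have hDA := Comp_sub (H := Gr G U) huA
  refine ⟨S, Comp (Gr G U) A u, ?_, ?_, ⟨u, self_mem_Comp⟩, Comp_conn.of_Gr,
    fun x hx h => hDA h hx, ?_⟩
  · have hN : ∀ a ∈ N \ {u}, ∀ b ∈ N \ {u}, a ≠ b → G.Adj a b := by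
      rintro a ⟨ha, hau⟩ b ⟨hb, hbu⟩ hab
      have ha' := hA.1 ha
      have hb' := hA.1 hb
      by_cases h1 : a ∈ C <;> by_cases h2 : b ∈ C
      · exact (T.cc a b h1 h2 ha' hb' hab).1
      · by_contra hc
        exact T.t3 hu h1 (fun e => hau e.symm) huv ha' hx0 hxv0 hux0 h2 hb' (fun h => hc h.1)
      · by_contra hc
        exact T.t3 hu h2 (fun e => hbu e.symm) huv hb' hx0 hxv0 hux0 h1 ha' (fun h => hc h.1.symm)
      · exact (T.cl a b h1 h2 ha' hb' hab).1
    rintro a (rfl | ha) b (rfl | hb) hab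
    · exact absurd rfl hab
    · exact hb.1.2
    · exact ha.1.2.symm
    · exact hN a ha b hb hab
  · have hvN : v ∉ N \ {u} := fun h => h.1.2.ne rfl
    rw [Set.ncard_insert_of_notMem hvN (Set.toFinite _)]
    exact Set.ncard_sdiff_singleton_add_one (hA.2 huv) (Set.toFinite _)
  · intro x hx
    rcases hx with rfl | ⟨hxN, hxu⟩
    · exact ⟨u, self_mem_Comp, huv.1⟩
    · by_cases had : G.Adj u x
      · exact ⟨u, self_mem_Comp, had.symm⟩
      have hxC : x ∉ C := fun h => had (T.cc u x hu h huv (hA.1 hxN) (fun e => hxu e.symm)).1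
      obtain ⟨m, p, hp, hm, hp0, hpm, hInt, hpC⟩ :=
        T.t1 hu hxC huv (hA.1 hxN) (fun h => had h.1)
      have key : ∀ k, k < m → p k ∈ Comp (Gr G U) A u := by
        intro k
        induction k with
        | zero => intro _; rw [hp0]; exact self_mem_Comp
        | succ k ih =>
          intro hk
          refine Comp_step (ih (by omega)) ((hp k (k+1) (by omega) (by omega)).2.2 rfl) ?_
          have := hInt (k+1) (by omega) hk
          rintro (h | h)
          · exact this.1 h
          · exact this.2 (hA.1 h.1)
      refine ⟨p (m-1), key _ (by omega), ?_⟩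
      rw [← hpm, G.adj_comm]
      exact ((hp (m-1) m (by omega) le_rfl).2.2 (by omega)).1

theorem main_elim [Finite V] {G : SimpleGraph V} {C : Set V} (hG : NCG G C) (U : Set V) :
    PP G (good G) U := by
  induction U using WellFoundedLT.induction with
  | ind U ih =>
  by_cases hfree : ∀ Y, HS G Y → ¬ Y ⊆ U
  · intro Q hQ hUQ
    obtain ⟨v, h1, h2, h3⟩ := dirac U hfree Q hQ hUQ
    exact ⟨v, h1, h2, good_of_simpl h3⟩
  push Not at hfree
  obtain ⟨Y0, hY0, hY0U⟩ := hfree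
  let W : V → Set V := fun u => {x | x = u ∨ (Gr G U).Adj u x ∨
    ∃ Y, HS (Gr G U) Y ∧ u ∈ Y ∧ x ∈ Y}
  have g := hG.gr U
  by_cases hW : ∃ u ∈ C, u ∈ U ∧ ∃ x ∈ U, x ∉ W u
  · obtain ⟨u, hu, huU, x, hxU, hxW⟩ := hW
    let A : Set V := {a | a ∈ U ∧ a ∉ W u}
    have hxA : x ∈ A := ⟨hxU, hxW⟩
    have hKA := Comp_sub (H := Gr G U) hxA
    have c : Ctx (Gr G U) u (Comp (Gr G U) A x) := by
      refine ⟨g.nc u hu, Comp_conn, ?_, ?_, ?_⟩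
      · intro Y hY huY y hy hyK
        exact (hKA hyK).2 (Or.inr (Or.inr ⟨Y, hY, huY, hy⟩))
      · intro h; exact (hKA h).2 (Or.inl rfl)
      · rintro ⟨-, k, hk, had⟩
        exact (hKA hk).2 (Or.inr (Or.inl had))
    refine split good_local (K := Comp (Gr G U) A x) (fun a ha => (hKA ha).1) ⟨x, self_mem_Comp⟩
      ?_ huU c.uK c.uS ih
    intro a ha b hb hab
    refine (sep_claim c ?_ ha hb hab).1
    intro b hb
    have h1 := Nb_Comp hb
    have hbU : b ∈ U := by obtain ⟨-, k, -, h⟩ := hb; exact h.2.1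
    have h2 : b ∈ W u := by
      by_contra h; exact h1 ⟨hbU, h⟩
    rcases h2 with rfl | h | h
    · exact absurd hb c.uS
    · exact Or.inl h.symm
    · exact Or.inr h
  · push Not at hW
    have hcc : ∀ x y, x ∈ C → y ∈ C → x ∈ U → y ∈ U → x ≠ y → (Gr G U).Adj x y := by
      intro x y hx hy hxU hyU hne
      rcases hW x hx hxU y hyU with h | h | ⟨Y, hY, h1, h2⟩
      · exact absurd h.symm hne
      · exact h
      · exact absurd (g.uniq Y hY x hx y hy h1 h2) hne
    intro Q hQ hUQ
    have hsub : ¬ U \ C ⊆ Q := by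
      intro hs
      obtain ⟨n, f, hf, hfY⟩ := id hY0
      have h4 := hf.1
      have hfm : ∀ k, k < n → f k ∈ Y0 := fun k hk => (hfY _).2 ⟨k, hk, rfl⟩
      have one : ∀ i j, i < j → j < n → f i ∈ C → f j ∉ C := fun i j hij hj h1 h2 =>
        (hf.2.2 i j hij hj).1 (hG.uniq Y0 hY0 _ h1 _ h2 (hfm _ (by omega)) (hfm _ hj))
      have two : ∀ i j, i + 2 = j → j ≤ 3 → f i ∉ C → f j ∉ C → False := by
        intro i j hij hj h1 h2
        have h3 := hf.2.2 i j (by omega) (by omega)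
        have := hQ (hs ⟨hY0U (hfm i (by omega)), h1⟩) (hs ⟨hY0U (hfm j (by omega)), h2⟩) h3.1
        rw [h3.2] at this
        omega
      by_cases c0 : f 0 ∈ C
      · exact two 1 3 rfl le_rfl (one 0 1 (by omega) (by omega) c0) (one 0 3 (by omega) (by omega) c0)
      · by_cases c2 : f 2 ∈ C
        · refine two 1 3 rfl le_rfl (fun h => one 1 2 (by omega) (by omega) h c2)
            (one 2 3 (by omega) (by omega) c2)
        · exact two 0 2 rfl (by omega) c0 c2
    obtain ⟨v, ⟨hvU, hvC⟩, hvQ, hsv⟩ := dirac (U \ C) (by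
      intro Y hY hYU
      obtain ⟨u, hu, huY⟩ := hG.cov Y hY
      exact (hYU huY).2 hu) Q hQ hsub
    refine ⟨v, hvU, hvQ, good_of_term (C := C) hvU ⟨g, hvC, ?_, ?_, ?_⟩⟩
    · intro x y hx hy hxv hyv hne
      exact ⟨hsv ⟨⟨hxv.2.2, hx⟩, hxv.1⟩ ⟨⟨hyv.2.2, hy⟩, hyv.1⟩ hne, hxv.2.2, hyv.2.2⟩
    · intro x y hx hy hxv hyv hne
      exact hcc x y hx hy hxv.2.2 hyv.2.2 hne
    · intro u x hu huv hxv hne hna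
      rcases hW u hu huv.2.2 x hxv.2.2 with h | h | h
      · exact absurd h hne
      · exact absurd h hna
      · exact h

/-! ### Finish -/

theorem NCG_of {G : SimpleGraph V} {C : Set V} (h1 : IsHoleCover G C) (h2 : SetNC G C) :
    NCG G C := by
  refine ⟨?_, ?_, ?_⟩
  · rintro u hu Y Z ⟨n, f, hf, hY⟩ ⟨n', f', hf', hZ⟩ huY huZ x y z hne hxy hyz xY yY zY xZ yZ zZ
    obtain ⟨a, w, hw, hws⟩ := hole_of_HF hf
    obtain ⟨a', w', hw', hws'⟩ := hole_of_HF hf'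
    have e1 : ∀ x, x ∈ w.support ↔ x ∈ Y := fun x => by rw [hws, hY]
    have e2 : ∀ x, x ∈ w'.support ↔ x ∈ Z := fun x => by rw [hws', hZ]
    exact h2.1 u hu a a' w w' hw hw' ((e1 u).2 huY) (fun h => huZ ((e2 u).1 h))
      ⟨x, y, z, hne, hw.2.2 x y ((e1 x).2 xY) ((e1 y).2 yY) hxy,
        hw.2.2 y z ((e1 y).2 yY) ((e1 z).2 zY) hyz,
        hw'.2.2 x y ((e2 x).2 xZ) ((e2 y).2 yZ) hxy,
        hw'.2.2 y z ((e2 y).2 yZ) ((e2 z).2 zZ) hyz⟩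
  · rintro Y ⟨n, f, hf, hY⟩
    obtain ⟨a, w, hw, hws⟩ := hole_of_HF hf
    obtain ⟨u, hu, huw⟩ := h1.2 a w hw
    exact ⟨u, hu, (hY u).2 ((hws u).1 huw)⟩
  · rintro Y ⟨n, f, hf, hY⟩ u hu v hv huY hvY
    obtain ⟨a, w, hw, hws⟩ := hole_of_HF hf
    exact h2.2 a w hw u hu v hv ((hws u).2 ((hY u).1 huY)) ((hws v).2 ((hY v).1 hvY))

theorem Conn.induce {G : SimpleGraph V} {X : Set V} (h : Conn G X) (hn : X.Nonempty) :
    (G.induce X).Connected := by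
  obtain ⟨c, hc⟩ := hn
  haveI : Nonempty X := ⟨⟨c, hc⟩⟩
  refine ⟨?_⟩
  rintro ⟨x, hx⟩ ⟨y, hy⟩
  have key : ∃ hy : y ∈ X, (G.induce X).Reachable ⟨x, hx⟩ ⟨y, hy⟩ := by
    have := h x hx y hy
    clear hy
    induction this with
    | refl => exact ⟨hx, Reachable.refl _⟩
    | tail h1 h2 ih =>
      obtain ⟨hy, hr⟩ := ih
      refine ⟨h2.2, hr.trans (Adj.reachable ?_)⟩
      exact h2.1
  exact key.2

theorem minor_of [Finite V] {G : SimpleGraph V} {S D : Set V} (hS : G.IsClique S)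
    (hD : D.Nonempty) (hc : Conn G D) (hd : ∀ x ∈ S, x ∉ D) (ha : ∀ x ∈ S, ∃ d ∈ D, G.Adj x d)
    {n : ℕ} (hn : n ≤ S.ncard + 1) : HasMinor G (⊤ : SimpleGraph (Fin n)) := by
  classical
  haveI := Fintype.ofFinite S
  have hcard : Fintype.card (Fin n) ≤ Fintype.card (Option S) := by
    rw [Fintype.card_fin, Fintype.card_option, ← Nat.card_eq_fintype_card, Nat.card_coe_set_eq]
    exact hn
  obtain ⟨e⟩ := Function.Embedding.nonempty_of_card_le hcard
  let B : Option S → Set V := fun o => o.elim D (fun x => {x.1})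
  have hB1 : ∀ o, (B o).Nonempty := by
    rintro (_ | x)
    · exact hD
    · exact ⟨x.1, rfl⟩
  have hB2 : ∀ o, Conn G (B o) := by
    rintro (_ | x)
    · exact hc
    · exact conn_singleton x.1
  have hB3 : ∀ o o', o ≠ o' → Disjoint (B o) (B o') := by
    rintro (_ | x) (_ | y) hne
    · exact absurd rfl hne
    · exact Set.disjoint_singleton_right.2 (hd y.1 y.2)
    · exact Set.disjoint_singleton_left.2 (hd x.1 x.2)
    · refine Set.disjoint_singleton.2 (fun h => hne ?_)
      rw [Subtype.ext h]
  have hB4 : ∀ o o', o ≠ o' → ∃ a ∈ B o, ∃ b ∈ B o', G.Adj a b := by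
    rintro (_ | x) (_ | y) hne
    · exact absurd rfl hne
    · obtain ⟨d, h1, h2⟩ := ha y.1 y.2
      exact ⟨d, h1, y.1, rfl, h2.symm⟩
    · obtain ⟨d, h1, h2⟩ := ha x.1 x.2
      exact ⟨x.1, rfl, d, h1, h2⟩
    · refine ⟨x.1, rfl, y.1, rfl, hS x.2 y.2 (fun h => hne ?_)⟩
      rw [Subtype.ext h]
  refine ⟨fun i => B (e i), fun i => hB1 _, fun i => (hB2 _).induce (hB1 _), ?_, ?_⟩
  · intro i j hij
    exact hB3 _ _ (fun h => hij (e.injective h))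
  · intro i j hij
    exact hB4 _ _ (fun h => hij.ne (e.injective h))

theorem dp_of_degen [Finite V] [Nonempty V] {G : SimpleGraph V} {k : ℕ}
    (h : ∀ U : Set V, U.Nonempty → ∃ v ∈ U, {x | x ∈ U ∧ G.Adj v x}.ncard < k) :
    DPColorable G k := by
  classical
  intro H hH
  have hk : 0 < k := by
    obtain ⟨v, -, hv⟩ := h Set.univ Set.univ_nonempty
    omega
  suffices hs : ∀ U : Set V, ∃ f : V → Fin k, ∀ u ∈ U, ∀ v ∈ U, ¬ H.Adj (u, f u) (v, f v) by
    obtain ⟨f, hf⟩ := hs Set.univ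
    exact ⟨f, fun u v => hf u trivial v trivial⟩
  intro U
  induction U using WellFoundedLT.induction with
  | ind U ih =>
  by_cases hU : U.Nonempty
  · obtain ⟨v, hv, hvk⟩ := h U hU
    obtain ⟨f, hf⟩ := ih (U \ {v}) ⟨Set.sdiff_subset, fun h => (h hv).2 rfl⟩
    have hex : ∃ j : Fin k, ∀ w ∈ U, w ≠ v → ¬ H.Adj (w, f w) (v, j) := by
      by_contra hc
      push Not at hc
      choose g hgU hgv hg using hc
      have hmap : ∀ j : Fin k, g j ∈ {x | x ∈ U ∧ G.Adj v x} := fun j =>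
        ⟨hgU j, (hH.2.1 _ _ _ _ (hgv j) (hg j)).symm⟩
      have hinj : Function.Injective g := by
        intro i j hij
        have h1 := hg i
        rw [hij] at h1
        exact hH.2.2 _ _ _ _ _ (hgv j) h1 (hg j)
      have : (Set.range g).ncard ≤ {x | x ∈ U ∧ G.Adj v x}.ncard :=
        Set.ncard_le_ncard (by rintro _ ⟨j, rfl⟩; exact hmap j) (Set.toFinite _)
      rw [← Nat.card_coe_set_eq, Nat.card_range_of_injective hinj, Nat.card_fin] at this
      omega
    obtain ⟨j, hj⟩ := hex
    refine ⟨Function.update f v j, ?_⟩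
    intro a ha b hb hab
    by_cases hav : a = v <;> by_cases hbv : b = v
    · subst hav; subst hbv; exact H.loopless.irrefl _ hab
    · subst hav
      rw [Function.update_self, Function.update_of_ne hbv] at hab
      exact hj b hb hbv hab.symm
    · subst hbv
      rw [Function.update_self, Function.update_of_ne hav] at hab
      exact hj a ha hav hab
    · rw [Function.update_of_ne hav, Function.update_of_ne hbv] at hab
      exact hf a ⟨ha, hav⟩ b ⟨hb, hbv⟩ hab
  · exact ⟨fun _ => ⟨0, hk⟩, fun u hu => absurd ⟨u, hu⟩ hU⟩

/-- If a finite simple graph `G` satisfies the NC property, then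
`χ_DP(G) ≤ ω(G) + 1`; moreover if `G` has no `K_n` minor then `χ_DP(G) ≤ n - 1`. -/
theorem stmt0 {V : Type*} [Fintype V] [DecidableEq V] (G : SimpleGraph V)
    (hNC : HasNCProperty G) :
    dpChromaticNumber G ≤ G.cliqueNum + 1 ∧
      ∀ n : ℕ, ¬ HasMinor G (⊤ : SimpleGraph (Fin n)) → dpChromaticNumber G ≤ n - 1 := by
  obtain ⟨C, h1, h2⟩ := hNC
  have hG := NCG_of h1 h2
  obtain ⟨c, -⟩ := h1.1
  haveI : Nonempty V := ⟨c⟩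
  have key : ∀ U : Set V, U.Nonempty → ∃ v ∈ U, good G U v := by
    intro U hU
    obtain ⟨x, hx⟩ := hU
    obtain ⟨v, h1, -, h2⟩ := main_elim hG U ∅ (by intro a ha; exact ha.elim) (fun h => h hx)
    exact ⟨v, h1, h2⟩
  constructor
  · apply Nat.sInf_le
    apply dp_of_degen
    intro U hU
    obtain ⟨v, hv, S, D, hS, hc, -⟩ := key U hU
    refine ⟨v, hv, ?_⟩
    rw [← hc]
    classical
    have : G.IsClique (S.toFinset : Set V) := by rwa [Set.coe_toFinset]
    have h3 := this.card_le_cliqueNum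
    rw [← Set.ncard_eq_toFinset_card'] at h3
    omega
  · intro n hn
    apply Nat.sInf_le
    apply dp_of_degen
    intro U hU
    obtain ⟨v, hv, S, D, hS, hc, hD, hcD, hd, ha⟩ := key U hU
    refine ⟨v, hv, ?_⟩
    rw [← hc]
    by_contra h
    exact hn (minor_of hS hD hcD hd ha (by omega))
end

section
/- If G is a planar finite simple graph satisfying the NC property, then χ_DP(G) ≤ 4. -/
open SimpleGraph

variable {V : Type*}

/-- Planarity, via Wagner's characterization: no `K₅` minor and no `K_{3,3}` minor. -/
def IsPlanar {V : Type*} (G : SimpleGraph V) : Prop :=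
  ¬ HasMinor G (⊤ : SimpleGraph (Fin 5)) ∧
    ¬ HasMinor G (completeBipartiteGraph (Fin 3) (Fin 3))

section NCProof

/-- An induced path. -/
def IndPath (G : SimpleGraph V) {x y : V} (P : G.Walk x y) : Prop :=
  P.IsPath ∧ ∀ a b : V, a ∈ P.support → b ∈ P.support → G.Adj a b → s(a, b) ∈ P.edges

/-- Interiors are disjoint and anticomplete. -/
def Anti (G : SimpleGraph V) {x y : V} (P R : G.Walk x y) : Prop :=
  ∀ a ∈ P.support, a ≠ x → a ≠ y → ∀ b ∈ R.support, b ≠ x → b ≠ y → a ≠ b ∧ ¬ G.Adj a b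

/-- Reachable within `T`. -/
def ReachIn (G : SimpleGraph V) (T : Set V) (x y : V) : Prop :=
  ∃ p : G.Walk x y, ∀ z ∈ p.support, z ∈ T

theorem indPath_two_le {G : SimpleGraph V} {x y : V} (P : G.Walk x y)
    (hxy : x ≠ y) (hadj : ¬ G.Adj x y) : 2 ≤ P.length := by
  match P with
  | .nil => exact absurd rfl hxy
  | .cons h .nil => exact absurd h hadj
  | .cons h (.cons h' p) => simp

theorem exists_hole_of_paths {G : SimpleGraph V} {x y : V} {P R : G.Walk x y}
    (hxy : x ≠ y) (hadj : ¬ G.Adj x y) (hP : IndPath G P) (hR : IndPath G R)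
    (hA : Anti G P R) :
    ∃ w : G.Walk x x, IsHole G w ∧ (∀ z, z ∈ w.support ↔ z ∈ P.support ∨ z ∈ R.support) ∧
      ∀ e ∈ P.edges, e ∈ w.edges := by
  have h1 := indPath_two_le P hxy hadj
  have h2 := indPath_two_le R hxy hadj
  have hsup : ∀ z, z ∈ (P.append R.reverse).support ↔ z ∈ P.support ∨ z ∈ R.support := by
    intro z
    simp [Walk.mem_support_append_iff]
  refine ⟨P.append R.reverse, ⟨?_, ?_, ?_⟩, hsup, ?_⟩
  · apply Walk.IsPath.isCycle_append hP.1 hR.1.reverse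
    · intro z hz hz'
      have hx : z ≠ x := by
        rintro rfl
        have := hP.1.support_nodup
        rw [← P.cons_tail_support] at this
        exact (List.nodup_cons.1 this).1 hz
      have hy : z ≠ y := by
        rintro rfl
        have := hR.1.reverse.support_nodup
        rw [← R.reverse.cons_tail_support] at this
        exact (List.nodup_cons.1 this).1 hz'
      have hzP := List.mem_of_mem_tail hz
      have hzR := List.mem_of_mem_tail hz'
      rw [Walk.support_reverse, List.mem_reverse] at hzR
      exact (hA z hzP hx hy z hzR hx hy).1 rfl
    · left; omega
  · simp; omega
  · intro a b ha hb hab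
    rw [hsup] at ha hb
    rw [Walk.edges_append, List.mem_append, Walk.edges_reverse, List.mem_reverse]
    have key : ∀ a b, a ∈ P.support → b ∈ R.support → G.Adj a b →
        s(a, b) ∈ P.edges ∨ s(a, b) ∈ R.edges := by
      intro a b ha hb hab
      by_cases haR : a ∈ R.support
      · exact Or.inr (hR.2 a b haR hb hab)
      by_cases hbP : b ∈ P.support
      · exact Or.inl (hP.2 a b ha hbP hab)
      exact absurd hab (hA a ha (fun h => haR (h ▸ R.start_mem_support))
        (fun h => haR (h ▸ R.end_mem_support)) b hb (fun h => hbP (h ▸ P.start_mem_support))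
        (fun h => hbP (h ▸ P.end_mem_support))).2
    rcases ha with ha | ha <;> rcases hb with hb | hb
    · exact Or.inl (hP.2 a b ha hb hab)
    · exact key a b ha hb hab
    · rw [Sym2.eq_swap]; exact key b a hb ha hab.symm
    · exact Or.inr (hR.2 a b ha hb hab)
  · intro e he
    rw [Walk.edges_append]
    exact List.mem_append_left _ he

theorem nc_contra {G : SimpleGraph V} {u x y : V} (hu : VertexNC G u) {P R R' : G.Walk x y}
    (hxy : x ≠ y) (hadj : ¬ G.Adj x y) (hP : IndPath G P) (hR : IndPath G R)
    (hR' : IndPath G R') (hA : Anti G P R) (hA' : Anti G P R')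
    (h1 : u ∈ R.support) (h2 : u ∉ P.support) (h3 : u ∉ R'.support) : False := by
  obtain ⟨w, hw, hs, he⟩ := exists_hole_of_paths hxy hadj hP hR hA
  obtain ⟨w', hw', hs', he'⟩ := exists_hole_of_paths hxy hadj hP hR' hA'
  refine hu _ _ w w' hw hw' ((hs u).2 (Or.inr h1)) (fun h => ((hs' u).1 h).elim h2 h3) ?_
  have hl := indPath_two_le P hxy hadj
  have hp := hP.1
  clear hP hA hA' hs hs'
  match P with
  | .nil => exact absurd rfl hxy
  | .cons h .nil => exact absurd h hadj
  | .cons (v := a) h (.cons (v := b) h' p) =>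
    refine ⟨x, a, b, ?_, he _ (by simp), he _ (by simp), he' _ (by simp), he' _ (by simp)⟩
    rintro rfl
    simp [Walk.cons_isPath_iff] at hp

theorem indPath_via {G : SimpleGraph V} {x y u : V} (hxy : x ≠ y) (hadj : ¬ G.Adj x y)
    (hx : G.Adj x u) (hy : G.Adj u y) :
    ∃ R : G.Walk x y, IndPath G R ∧ ∀ z, z ∈ R.support ↔ z = x ∨ z = u ∨ z = y := by
  refine ⟨.cons hx (.cons hy .nil), ⟨?_, ?_⟩, ?_⟩
  · simp [Walk.cons_isPath_iff, hx.ne, hy.ne, hxy]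
  · intro a b ha hb hab
    have hadj' : ¬ G.Adj y x := fun h => hadj h.symm
    simp at ha hb ⊢
    rcases ha with rfl | rfl | rfl <;> rcases hb with rfl | rfl | rfl <;> simp_all
  · simp

theorem ReachIn.exists_indPath {G : SimpleGraph V} {T : Set V} {x y : V}
    (h : ReachIn G T x y) :
    ∃ P : G.Walk x y, IndPath G P ∧ ∀ z ∈ P.support, z ∈ T := by
  classical
  obtain ⟨p, hp⟩ := h
  induction hn : p.length using Nat.strong_induction_on generalizing p with
  | _ n ih =>
    by_cases hpath : p.IsPath
    swap
    · have hlt : p.bypass.length < n := by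
        rcases (p.length_bypass_le_length).lt_or_eq with h | h
        · omega
        · exact absurd (p.bypass_eq_self_of_length_le_length_bypass h.ge ▸ p.bypass_isPath) hpath
      exact ih _ hlt p.bypass (fun z hz => hp z (p.support_bypass_subset_support hz)) rfl
    by_cases hind : ∀ a b : V, a ∈ p.support → b ∈ p.support → G.Adj a b → s(a, b) ∈ p.edges
    · exact ⟨p, ⟨hpath, hind⟩, hp⟩
    have key : ∀ (a b : V) (p1 : G.Walk x a) (p2 : G.Walk a b) (p3 : G.Walk b y),
        p1.append (p2.append p3) = p → G.Adj a b → s(a, b) ∉ p.edges →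
        ∃ q : G.Walk x y, q.length < n ∧ ∀ z ∈ q.support, z ∈ T := by
      intro a b p1 p2 p3 e1 hab hne
      have hl : 2 ≤ p2.length := by
        subst e1
        clear * - hne hab
        match p2 with
        | .nil => exact absurd rfl hab.ne
        | .cons h .nil => simp at hne
        | .cons h (.cons h' p) => simp
      refine ⟨p1.append (.cons hab p3), ?_, ?_⟩
      · rw [← hn, ← e1]; simp; omega
      · intro z hz
        apply hp
        rw [← e1]
        simp only [Walk.mem_support_append_iff, Walk.support_cons, List.mem_cons] at hz ⊢
        rcases hz with h | rfl | h
        · exact Or.inl h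
        · left; exact p1.end_mem_support
        · exact Or.inr (Or.inr h)
    have : ∃ q : G.Walk x y, q.length < n ∧ ∀ z ∈ q.support, z ∈ T := by
      push Not at hind
      obtain ⟨a, b, ha, hb, hab, hne⟩ := hind
      have e1 := p.take_spec ha
      have : b ∈ (p.takeUntil a ha).support ∨ b ∈ (p.dropUntil a ha).support := by
        rw [← Walk.mem_support_append_iff, e1]; exact hb
      rcases this with h | h
      · refine key b a ((p.takeUntil a ha).takeUntil b h) ((p.takeUntil a ha).dropUntil b h)
          (p.dropUntil a ha) ?_ hab.symm (by rwa [Sym2.eq_swap])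
        rw [Walk.append_assoc, Walk.take_spec, Walk.take_spec]
      · refine key a b (p.takeUntil a ha) ((p.dropUntil a ha).takeUntil b h)
          ((p.dropUntil a ha).dropUntil b h) ?_ hab hne
        rw [Walk.take_spec, Walk.take_spec]
    obtain ⟨q, hq, hqT⟩ := this
    exact ih _ hq q hqT rfl

theorem ReachIn.symm {G : SimpleGraph V} {T : Set V} {x y : V} (h : ReachIn G T x y) :
    ReachIn G T y x := by
  obtain ⟨p, hp⟩ := h
  exact ⟨p.reverse, by simpa using hp⟩

theorem ReachIn.trans {G : SimpleGraph V} {T : Set V} {x y z : V} (h : ReachIn G T x y)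
    (h' : ReachIn G T y z) : ReachIn G T x z := by
  obtain ⟨p, hp⟩ := h
  obtain ⟨q, hq⟩ := h'
  refine ⟨p.append q, fun a ha => ?_⟩
  rw [Walk.mem_support_append_iff] at ha
  exact ha.elim (hp a) (hq a)

theorem ReachIn.mono {G : SimpleGraph V} {T T' : Set V} (hT : T ⊆ T') {x y : V}
    (h : ReachIn G T x y) : ReachIn G T' x y := by
  obtain ⟨p, hp⟩ := h
  exact ⟨p, fun a ha => hT (hp a ha)⟩

theorem ReachIn.step {G : SimpleGraph V} {T : Set V} {x y : V} (hx : x ∈ T) (hy : y ∈ T)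
    (h : G.Adj x y) : ReachIn G T x y :=
  ⟨.cons h .nil, by simp [hx, hy]⟩

theorem ReachIn.closed {G : SimpleGraph V} {T D : Set V}
    (hD : ∀ a ∈ D, ∀ b ∈ T, G.Adj a b → b ∈ D) {x y : V} (hx : x ∈ D)
    (h : ReachIn G T x y) : y ∈ D := by
  obtain ⟨p, hp⟩ := h
  induction p with
  | nil => exact hx
  | cons h p ih =>
    refine ih (hD _ hx _ (hp _ (by simp)) h) (fun z hz => hp z (by simp [hz]))

/-- The connected component of `x` inside `T`. -/
def compIn (G : SimpleGraph V) (T : Set V) (x : V) : Set V := {y | ReachIn G T x y}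

theorem mem_compIn_self {G : SimpleGraph V} {T : Set V} {x : V} (hx : x ∈ T) :
    x ∈ compIn G T x := ⟨.nil, by simpa using hx⟩

theorem compIn_subset {G : SimpleGraph V} {T : Set V} {x : V} : compIn G T x ⊆ T := by
  rintro y ⟨p, hp⟩
  exact hp y p.end_mem_support

theorem compIn_closed {G : SimpleGraph V} {T : Set V} {x : V} :
    ∀ a ∈ compIn G T x, ∀ b ∈ T, G.Adj a b → b ∈ compIn G T x := by
  intro a ha b hb hab
  exact ReachIn.trans ha (ReachIn.step (compIn_subset ha) hb hab)

theorem compIn_reach {G : SimpleGraph V} {T : Set V} {x y z : V} (hy : y ∈ compIn G T x)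
    (hz : z ∈ compIn G T x) : ReachIn G (compIn G T x) y z := by
  classical
  obtain ⟨p, hp⟩ := ReachIn.trans (ReachIn.symm hy) hz
  refine ⟨p, fun a ha => ReachIn.trans hy ⟨p.takeUntil a ha, fun b hb => ?_⟩⟩
  exact hp b (p.support_takeUntil_subset_support ha hb)

/-- An induced path through a connected set. -/
theorem exists_path_through {G : SimpleGraph V} {T : Set V} {z x y a b : V}
    (ha : a ∈ compIn G T z) (hb : b ∈ compIn G T z) (hxa : G.Adj x a) (hyb : G.Adj y b) :
    ∃ P : G.Walk x y, IndPath G P ∧ ∀ c ∈ P.support, c = x ∨ c = y ∨ c ∈ compIn G T z := by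
  have h : ReachIn G (insert x (insert y (compIn G T z))) x y := by
    refine ReachIn.trans (ReachIn.step (by simp) (by simp [ha]) hxa) (ReachIn.trans
      ((compIn_reach ha hb).mono ?_) (ReachIn.step (by simp [hb]) (by simp) hyb.symm))
    intro c hc; simp [hc]
  obtain ⟨P, hP, hT⟩ := h.exists_indPath
  exact ⟨P, hP, fun c hc => by simpa using hT c hc⟩

theorem hole_far {G : SimpleGraph V} {a u : V} {w : G.Walk a a} (hw : IsHole G w)
    (hu : u ∈ w.support) : ∃ d ∈ w.support, d ≠ u ∧ ¬ G.Adj u d := by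
  classical
  obtain ⟨hc, hl, hi⟩ := hw
  have hc' := hc.rotate hu
  have hs : ∀ z, z ∈ (w.rotate u hu).support ↔ z ∈ w.support :=
    fun z => Walk.mem_support_rotate_iff w u hu
  have he : ∀ e, e ∈ (w.rotate u hu).edges ↔ e ∈ w.edges :=
    fun e => (Walk.rotate_edges w u hu).mem_iff
  have hl' : 4 ≤ (w.rotate u hu).length := by simpa using hl
  generalize w.rotate u hu = w' at *
  match w' with
  | .nil => simp at hl'
  | .cons (v := a') h1 .nil => simp at hl'
  | .cons (v := a') h1 (.cons (v := c) h2 p) =>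
    have hcs : c ∈ w.support := (hs c).1 (by simp)
    rw [Walk.cons_isCycle_iff, Walk.cons_isPath_iff] at hc'
    obtain ⟨⟨hp, hap⟩, hne⟩ := hc'
    have hlp : 2 ≤ p.length := by simp at hl'; omega
    refine ⟨c, hcs, ?_, ?_⟩
    · rintro rfl
      have := Walk.nil_iff_length_eq.1 (Walk.isPath_iff_nil.1 hp)
      omega
    · intro huc
      have h3 := (he _).2 (hi u c hu hcs huc)
      simp only [Walk.edges_cons, List.mem_cons] at h3
      rcases h3 with h3 | h3 | h3
      · have : c = a' := by
          rcases Sym2.eq_iff.1 h3 with h | h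
          · exact h.2
          · exact absurd h.1 h1.ne
        exact h2.ne this.symm
      · have : u = a' := by
          rcases Sym2.eq_iff.1 h3 with h | h
          · exact h.1
          · exact absurd h.1 huc.ne
        exact h1.ne this
      · have := hp.length_eq_one_of_mem_edges (by rwa [Sym2.eq_swap] at h3)
        omega

/-- Neighbours of `a` in `S`. -/
def nbIn (G : SimpleGraph V) (S : Set V) (a : V) : Set V := {w | w ∈ S ∧ G.Adj a w}

/-- Either a clique or two nonadjacent vertices whose neighbourhoods satisfy `L`. -/
def GoodL (G : SimpleGraph V) (L : Set V → Prop) (S : Set V) : Prop :=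
  G.IsClique S ∨ ∃ a ∈ S, ∃ b ∈ S, a ≠ b ∧ ¬ G.Adj a b ∧ L (nbIn G S a) ∧ L (nbIn G S b)

/-- No clique separators inside `S`. -/
def AtomIn (G : SimpleGraph V) (S : Set V) : Prop :=
  ∀ K : Set V, G.IsClique K → ∀ A : Set V, A.Nonempty → A ⊆ S \ K →
    (∀ a ∈ A, ∀ b ∈ S \ K, G.Adj a b → b ∈ A) → S \ K ⊆ A

theorem goodL_or_atom {G : SimpleGraph V} {L : Set V → Prop}
    (hL : ∀ S a, G.IsClique S → a ∈ S → L (nbIn G S a)) {S : Set V}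
    (ih : ∀ S', S' ⊂ S → GoodL G L S') : GoodL G L S ∨ AtomIn G S := by
  by_contra hcon
  push Not at hcon
  obtain ⟨hng, hna⟩ := hcon
  unfold AtomIn at hna
  push Not at hna
  obtain ⟨K, hK, A, hAne, hAS, hAc, hnot⟩ := hna
  obtain ⟨b0, hb0, hb0A⟩ := Set.not_subset.1 hnot
  -- one side
  have side : ∀ A : Set V, A.Nonempty → A ⊆ S \ K → (∀ a ∈ A, ∀ b ∈ S \ K, G.Adj a b → b ∈ A) →
      (∃ b ∈ S \ K, b ∉ A) → ∃ a ∈ A, L (nbIn G S a) := by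
    rintro A ⟨a0, ha0⟩ hAS hAc ⟨b, hb, hbA⟩
    have hss : A ∪ (K ∩ S) ⊂ S := by
      refine ⟨?_, fun h => ?_⟩
      · rintro x (hx | hx)
        · exact (hAS hx).1
        · exact hx.2
      · rcases h hb.1 with h | h
        · exact hbA h
        · exact hb.2 h.1
    have hloc : ∀ a ∈ A, nbIn G (A ∪ (K ∩ S)) a = nbIn G S a := by
      intro a ha
      ext w
      constructor
      · rintro ⟨h1, h2⟩; exact ⟨hss.1 h1, h2⟩
      · rintro ⟨h1, h2⟩
        refine ⟨?_, h2⟩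
        by_cases hwK : w ∈ K
        · exact Or.inr ⟨hwK, h1⟩
        · exact Or.inl (hAc a ha w ⟨h1, hwK⟩ h2)
    rcases ih _ hss with h | ⟨x, hx, y, hy, hxy, hadj, hLx, hLy⟩
    · refine ⟨a0, ha0, ?_⟩
      rw [← hloc a0 ha0]
      exact hL _ _ h (Or.inl ha0)
    · rcases hx with hx | hx
      · exact ⟨x, hx, hloc x hx ▸ hLx⟩
      rcases hy with hy | hy
      · exact ⟨y, hy, hloc y hy ▸ hLy⟩
      exact absurd (hK hx.1 hy.1 hxy) hadj
  obtain ⟨a, ha, hLa⟩ := side A hAne hAS hAc ⟨b0, hb0, hb0A⟩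
  obtain ⟨b, hb, hLb⟩ := side ((S \ K) \ A) ⟨b0, hb0, hb0A⟩ Set.diff_subset
    (by
      intro x hx y hy hxy
      exact ⟨hy, fun h => hx.2 (hAc y h x hx.1 hxy.symm)⟩)
    ⟨hAne.some, hAS hAne.some_mem, fun h => h.2 hAne.some_mem⟩
  exact hng (Or.inr ⟨a, (hAS ha).1, b, hb.1.1, fun h => hb.2 (h ▸ ha),
    fun h => hb.2 (hAc a ha b hb.1 h), hLa, hLb⟩)

/-- Facts on a vertex `u` and a component `D` of `S \ N[u]`. -/
theorem bd_subset {G : SimpleGraph V} {S : Set V} {u d x y : V}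
    (hx : x ∈ S) (hxD : x ∉ compIn G {z | z ∈ S ∧ z ≠ u ∧ ¬ G.Adj u z} d)
    (hy : y ∈ compIn G {z | z ∈ S ∧ z ≠ u ∧ ¬ G.Adj u z} d) (hxy : G.Adj x y) : G.Adj u x := by
  by_contra h
  by_cases hxu : x = u
  · subst hxu
    exact (compIn_subset hy).2.2 hxy
  · exact hxD (compIn_closed y hy x ⟨hx, hxu, h⟩ hxy.symm)

/-- The boundary of `D` in `S`. -/
def bdIn (G : SimpleGraph V) (S D : Set V) : Set V := {x | x ∈ S ∧ x ∉ D ∧ ∃ y ∈ D, G.Adj x y}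

/-- In an atom, a vertex `u` with a nonneighbour `d` : boundary of component is not a clique. -/
theorem bd_not_clique {G : SimpleGraph V} {S : Set V} (hS : AtomIn G S) {u d : V} (hu : u ∈ S)
    (hd : d ∈ S) (hdu : d ≠ u) (hud : ¬ G.Adj u d) :
    ∃ x ∈ bdIn G S (compIn G {z | z ∈ S ∧ z ≠ u ∧ ¬ G.Adj u z} d),
    ∃ y ∈ bdIn G S (compIn G {z | z ∈ S ∧ z ≠ u ∧ ¬ G.Adj u z} d), x ≠ y ∧ ¬ G.Adj x y := by
  by_contra hcon
  push Not at hcon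
  set D := compIn G {z | z ∈ S ∧ z ≠ u ∧ ¬ G.Adj u z} d with hD
  have hdD : d ∈ D := mem_compIn_self ⟨hd, hdu, hud⟩
  have huD : u ∉ D := fun h => (compIn_subset h).2.1 rfl
  have := hS (bdIn G S D) (fun x hx y hy hxy => hcon x hx y hy hxy) D ⟨d, hdD⟩
    (fun z hz => ⟨(compIn_subset hz).1, fun h => h.2.1 hz⟩)
    (fun a ha b hb hab => by
      by_contra hbD
      exact hb.2 ⟨hb.1, hbD, a, ha, hab.symm⟩)
  refine huD (this ⟨hu, fun h => ?_⟩)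
  obtain ⟨-, -, y, hy, huy⟩ := h
  exact (compIn_subset hy).2.2 huy

theorem dirac_s1 {G : SimpleGraph V} [Finite V] (S : Set V)
    (hS : ∀ (a : V) (w : G.Walk a a), IsHole G w → ¬ ∀ z ∈ w.support, z ∈ S) :
    GoodL G (fun N => G.IsClique N) S := by
  induction S using WellFoundedLT.induction with
  | _ S ih =>
    rcases goodL_or_atom (L := fun N => G.IsClique N)
      (fun S a hS _ => hS.subset (fun w hw => hw.1))
      (fun S' hS' => ih S' hS' (fun a w hw h => hS a w hw (fun z hz => hS'.1 (h z hz))))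
      with h | hat
    · exact h
    left
    intro u hu d hd hdu
    by_contra hud
    obtain ⟨x, hx, y, hy, hxy, hadj⟩ := bd_not_clique hat hu hd hdu.symm hud
    obtain ⟨hxS, hxD, a, ha, hxa⟩ := hx
    obtain ⟨hyS, hyD, b, hb, hyb⟩ := hy
    have hux := bd_subset hxS hxD ha hxa
    have huy := bd_subset hyS hyD hb hyb
    obtain ⟨P, hP, hPs⟩ := exists_path_through ha hb hxa hyb
    obtain ⟨R, hR, hRs⟩ := indPath_via hxy hadj hux.symm huy
    obtain ⟨w, hw, hws, -⟩ := exists_hole_of_paths hxy hadj hP hR (by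
      intro p hp hpx hpy r hr hrx hry
      have hpD : p ∈ _ := ((hPs p hp).resolve_left hpx).resolve_left hpy
      have hru : r = u := by have := (hRs r).1 hr; tauto
      subst hru
      exact ⟨(compIn_subset hpD).2.1, fun h => (compIn_subset hpD).2.2 h.symm⟩)
    refine hS _ w hw (fun z hz => ?_)
    rcases (hws z).1 hz with h | h
    · rcases hPs z h with rfl | rfl | h
      · exact hxS
      · exact hyS
      · exact (compIn_subset h).1
    · rcases (hRs z).1 h with rfl | rfl | rfl <;> assumption

/-- Vertices of `C` on a hole inside `S`. -/
def holeVerts (G : SimpleGraph V) (C S : Set V) : Set V :=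
  {u | u ∈ C ∧ ∃ (a : V) (w : G.Walk a a), IsHole G w ∧ u ∈ w.support ∧ ∀ z ∈ w.support, z ∈ S}

/-- Structure of an atom around a vertex with the NC property lying on a hole. -/
theorem atom_nbr {G : SimpleGraph V} {S : Set V} (hS : AtomIn G S) {u d : V} (hu : u ∈ S)
    (hnc : VertexNC G u) (hd : d ∈ S) (hdu : d ≠ u) (hud : ¬ G.Adj u d) {w : V} (hw : w ∈ S)
    (huw : G.Adj u w) : w ∈ bdIn G S (compIn G {z | z ∈ S ∧ z ≠ u ∧ ¬ G.Adj u z} d) := by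
  set D := compIn G {z | z ∈ S ∧ z ≠ u ∧ ¬ G.Adj u z} d with hD
  have hdD : d ∈ D := mem_compIn_self ⟨hd, hdu, hud⟩
  have huD : u ∉ D := fun h => (compIn_subset h).2.1 rfl
  have hwD : w ∉ D := fun h => (compIn_subset h).2.2 huw
  by_contra hwB
  set E := compIn G {z | z ∈ S ∧ z ≠ u ∧ z ∉ bdIn G S D} w with hE
  have hwE : w ∈ E := mem_compIn_self ⟨hw, huw.ne', hwB⟩
  have hDc : ∀ a ∈ D, ∀ b ∈ S, G.Adj a b → b ∉ bdIn G S D → b ∈ D := by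
    intro a ha b hb hab hbB
    by_contra h
    exact hbB ⟨hb, h, a, ha, hab.symm⟩
  have hDE : ∀ z ∈ D, z ∉ E := by
    intro z hzD hzE
    exact hwD (ReachIn.closed (fun a ha b hb hab => hDc a ha b hb.1 hab hb.2.2) hzD
      (ReachIn.symm hzE))
  have hbu : ∀ x ∈ bdIn G S D, G.Adj u x := by
    rintro x ⟨h1, h2, y, hy, hxy⟩
    exact bd_subset h1 h2 hy hxy
  set K : Set V := insert u {x | x ∈ bdIn G S D ∧ ∃ e ∈ E, G.Adj x e} with hK
  have hKc : G.IsClique K := by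
    refine SimpleGraph.IsClique.insert ?_ (fun b hb _ => hbu b hb.1)
    rintro x ⟨hx, e, he, hxe⟩ y ⟨hy, f, hf, hyf⟩ hxy
    by_contra hadj
    have hux := hbu x hx
    have huy := hbu y hy
    obtain ⟨hxS, hxD, a, ha, hxa⟩ := hx
    obtain ⟨hyS, hyD, b, hb, hyb⟩ := hy
    obtain ⟨P, hP, hPs⟩ := exists_path_through ha hb hxa hyb
    obtain ⟨R, hR, hRs⟩ := indPath_via hxy hadj hux.symm huy
    obtain ⟨R', hR', hRs'⟩ := exists_path_through he hf hxe hyf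
    refine nc_contra hnc hxy hadj hP hR hR' ?_ ?_ ((hRs u).2 (by simp)) ?_ ?_
    · intro p hp hpx hpy r hr hrx hry
      have hpD : p ∈ D := ((hPs p hp).resolve_left hpx).resolve_left hpy
      have hru : r = u := by have := (hRs r).1 hr; tauto
      subst hru
      exact ⟨(compIn_subset hpD).2.1, fun h => (compIn_subset hpD).2.2 h.symm⟩
    · intro p hp hpx hpy r hr hrx hry
      have hpD : p ∈ D := ((hPs p hp).resolve_left hpx).resolve_left hpy
      have hrE : r ∈ E := ((hRs' r hr).resolve_left hrx).resolve_left hry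
      refine ⟨fun h => hDE p hpD (h ▸ hrE), fun h => ?_⟩
      exact hDE r (hDc p hpD r (compIn_subset hrE).1 h (compIn_subset hrE).2.2) hrE
    · intro h
      rcases hPs u h with h | h | h
      · exact hux.ne h
      · exact huy.ne h
      · exact huD h
    · intro h
      rcases hRs' u h with h | h | h
      · exact hux.ne h
      · exact huy.ne h
      · exact (compIn_subset h).2.1 rfl
  have hsub := hS K hKc E ⟨w, hwE⟩
    (by
      intro z hz
      refine ⟨(compIn_subset hz).1, fun h => ?_⟩
      rcases h with h | h
      · exact (compIn_subset hz).2.1 h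
      · exact (compIn_subset hz).2.2 h.1)
    (by
      intro a ha b hb hab
      refine compIn_closed a ha b ⟨hb.1, fun h => hb.2 (Or.inl h), fun h => ?_⟩ hab
      exact hb.2 (Or.inr ⟨h, a, ha, hab.symm⟩))
  refine hDE d hdD (hsub ⟨hd, fun h => ?_⟩)
  rcases h with h | h
  · exact hdu h
  · exact h.1.2.1 hdD

theorem atom_dom {G : SimpleGraph V} {C S : Set V} (hC : SetNC G C) (hS : AtomIn G S)
    {u v : V} (hu : u ∈ holeVerts G C S) (hv : v ∈ C) (hvS : v ∈ S) (huv : G.Adj u v)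
    {x : V} (hxS : x ∈ S) (hux : G.Adj u x) (hxv : x ≠ v) : G.Adj v x := by
  obtain ⟨huC, a, w, hw, huw, hwS⟩ := hu
  obtain ⟨d, hdw, hdu, hud⟩ := hole_far hw huw
  have hd := hwS d hdw
  have huS := hwS u huw
  have hnc := hC.1 u huC
  by_contra hadj
  have hadj' : ¬ G.Adj x v := fun h => hadj h.symm
  obtain ⟨-, hxD, a, ha, hxa⟩ := atom_nbr hS huS hnc hd hdu hud hxS hux
  obtain ⟨-, hvD, b, hb, hvb⟩ := atom_nbr hS huS hnc hd hdu hud hvS huv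
  obtain ⟨P, hP, hPs⟩ := exists_path_through ha hb hxa hvb
  obtain ⟨R, hR, hRs⟩ := indPath_via hxv hadj' hux.symm huv
  obtain ⟨w, hw, hws, -⟩ := exists_hole_of_paths hxv hadj' hP hR (by
    intro p hp hpx hpy r hr hrx hry
    have hpD : p ∈ _ := ((hPs p hp).resolve_left hpx).resolve_left hpy
    have hru : r = u := by have := (hRs r).1 hr; tauto
    subst hru
    exact ⟨(compIn_subset hpD).2.1, fun h => (compIn_subset hpD).2.2 h.symm⟩)
  exact huv.ne (hC.2 _ w hw u huC v hv ((hws u).2 (Or.inr ((hRs u).2 (by simp))))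
    ((hws v).2 (Or.inl P.end_mem_support)))

theorem atom_indep {G : SimpleGraph V} {C S : Set V} (hC : SetNC G C) (hS : AtomIn G S)
    {u v : V} (hu : u ∈ holeVerts G C S) (hv : v ∈ holeVerts G C S) : ¬ G.Adj u v := by
  intro huv
  have hu' := hu
  have hv' := hv
  obtain ⟨huC, a, w, hw, huw, hwS⟩ := hu
  obtain ⟨hvC, a', w', hw', hvw, hwS'⟩ := hv
  obtain ⟨d, hdw, hdu, hud⟩ := hole_far hw huw
  have hd := hwS d hdw
  have huS := hwS u huw
  have hvS := hwS' v hvw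
  obtain ⟨x, ⟨hxS, hxD, a, ha, hxa⟩, y, ⟨hyS, hyD, b, hb, hyb⟩, hxy, hadj⟩ :=
    bd_not_clique hS huS hd hdu hud
  have hux := bd_subset hxS hxD ha hxa
  have huy := bd_subset hyS hyD hb hyb
  have hxv : x ≠ v := by
    rintro rfl
    exact hadj (atom_dom hC hS hu' hvC hvS huv hyS huy hxy.symm)
  have hyv : y ≠ v := by
    rintro rfl
    exact hadj (atom_dom hC hS hu' hvC hvS huv hxS hux hxy).symm
  have hvx := atom_dom hC hS hu' hvC hvS huv hxS hux hxv
  have hvy := atom_dom hC hS hu' hvC hvS huv hyS huy hyv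
  obtain ⟨P, hP, hPs⟩ := exists_path_through ha hb hxa hyb
  obtain ⟨R, hR, hRs⟩ := indPath_via hxy hadj hux.symm huy
  obtain ⟨R', hR', hRs'⟩ := indPath_via hxy hadj hvx.symm hvy
  refine nc_contra (hC.1 u huC) hxy hadj hP hR hR' ?_ ?_ ((hRs u).2 (by simp)) ?_ ?_
  · intro p hp hpx hpy r hr hrx hry
    have hpD : p ∈ _ := ((hPs p hp).resolve_left hpx).resolve_left hpy
    have hru : r = u := by have := (hRs r).1 hr; tauto
    subst hru
    exact ⟨(compIn_subset hpD).2.1, fun h => (compIn_subset hpD).2.2 h.symm⟩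
  · intro p hp hpx hpy r hr hrx hry
    have hpD : p ∈ _ := ((hPs p hp).resolve_left hpx).resolve_left hpy
    have hru : r = v := by have := (hRs' r).1 hr; tauto
    subst hru
    have h3 := compIn_subset hpD
    refine ⟨fun h => h3.2.2 (h ▸ huv), fun h => h3.2.2 ?_⟩
    exact atom_dom hC hS hv' huC huS huv.symm h3.1 h.symm h3.2.1
  · intro h
    rcases hPs u h with h | h | h
    · exact hux.ne h
    · exact huy.ne h
    · exact (compIn_subset h).2.1 rfl
  · intro h
    rcases (hRs' u).1 h with h | h | h
    · exact hux.ne h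
    · exact huv.ne h
    · exact huy.ne h

theorem k5_of {G : SimpleGraph V} [Finite V] {Q F : Set V} (hQ : G.IsClique Q)
    (hc : 4 ≤ Q.ncard) (hne : F.Nonempty) (hF : ∀ x ∈ F, ∀ y ∈ F, ReachIn G F x y)
    (hd : ∀ q ∈ Q, q ∉ F) (hadj : ∀ q ∈ Q, ∃ b ∈ F, G.Adj q b) :
    HasMinor G (⊤ : SimpleGraph (Fin 5)) := by
  have e : Q ≃ Fin (Nat.card Q) := Finite.equivFin Q
  have hc' : 4 ≤ Nat.card Q := hc
  let f : Fin 4 → Q := fun i => e.symm (Fin.castLE hc' i)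
  have hf : Function.Injective f := fun i j h => by
    have := e.symm.injective h
    exact Fin.castLE_injective hc' this
  have hfa : ∀ i j, i ≠ j → G.Adj (f i : V) (f j) := fun i j hij =>
    hQ (f i).2 (f j).2 (fun h => hij (hf (Subtype.ext h)))
  refine ⟨Fin.cases F (fun i => {(f i : V)}), ?_, ?_, ?_, ?_⟩
  · intro i
    cases i using Fin.cases with
    | zero => exact hne
    | succ i => simp
  · intro i
    cases i using Fin.cases with
    | zero =>
      simp only [Fin.cases_zero]
      haveI : Nonempty F := hne.to_subtype
      refine ⟨fun x y => ?_⟩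
      obtain ⟨p, hp⟩ := hF x x.2 y y.2
      exact ⟨p.induce F hp⟩
    | succ i =>
      simp only [Fin.cases_succ]
      haveI : Nonempty ({(f i : V)} : Set V) := ⟨⟨_, rfl⟩⟩
      refine ⟨fun x y => ?_⟩
      have : x = y := Subsingleton.elim _ _
      rw [this]
  · intro i j hij
    cases i using Fin.cases with
    | zero =>
      cases j using Fin.cases with
      | zero => exact absurd rfl hij
      | succ j => simpa using hd _ (f j).2
    | succ i =>
      cases j using Fin.cases with
      | zero => simpa using hd _ (f i).2
      | succ j =>
        have := (hfa i j (fun h => hij (by rw [h]))).ne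
        simpa using this
  · intro i j hij
    have hij := hij.ne
    cases i using Fin.cases with
    | zero =>
      cases j using Fin.cases with
      | zero => exact absurd rfl hij
      | succ j =>
        obtain ⟨b, hb, h⟩ := hadj _ (f j).2
        exact ⟨b, hb, f j, rfl, h.symm⟩
    | succ i =>
      cases j using Fin.cases with
      | zero =>
        obtain ⟨b, hb, h⟩ := hadj _ (f i).2
        exact ⟨f i, rfl, b, hb, h⟩
      | succ j => exact ⟨f i, rfl, f j, rfl, hfa i j (fun h => hij (by rw [h]))⟩

theorem nb_clique {G : SimpleGraph V} [Finite V] (hG : ¬ HasMinor G (⊤ : SimpleGraph (Fin 5)))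
    {S : Set V} {a : V} (hS : G.IsClique S) (ha : a ∈ S) : (nbIn G S a).ncard ≤ 3 := by
  by_contra h
  push Not at h
  refine hG (k5_of (Q := nbIn G S a) (F := {a}) (hS.subset fun w hw => hw.1) h (by simp) ?_ ?_ ?_)
  · rintro x rfl y rfl
    exact ⟨.nil, by simp⟩
  · rintro q hq rfl
    exact G.loopless.irrefl _ hq.2
  · intro q hq
    exact ⟨a, rfl, hq.2.symm⟩

theorem atom_no4 {G : SimpleGraph V} [Finite V] (hG : ¬ HasMinor G (⊤ : SimpleGraph (Fin 5)))
    {S Q : Set V} (hS : AtomIn G S) (hn : ¬ G.IsClique S) (hQ : G.IsClique Q) (hQS : Q ⊆ S) :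
    Q.ncard ≤ 3 := by
  by_contra h
  push Not at h
  obtain ⟨f, hf⟩ : (S \ Q).Nonempty := by
    by_contra h'
    rw [Set.not_nonempty_iff_eq_empty, Set.sdiff_eq_empty] at h'
    exact hn (hQ.subset h')
  refine hG (k5_of (Q := Q) (F := compIn G (S \ Q) f) hQ h ⟨f, mem_compIn_self hf⟩
    (fun x hx y hy => compIn_reach hx hy) (fun q hq h => (compIn_subset h).2 hq) ?_)
  intro q hq
  by_contra hno
  push Not at hno
  have := hS (Q \ {q}) (hQ.subset Set.sdiff_subset) (compIn G (S \ Q) f) ⟨f, mem_compIn_self hf⟩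
    (fun x hx => ⟨(compIn_subset hx).1, fun h => (compIn_subset hx).2 h.1⟩) ?_
    ⟨hQS hq, by simp⟩
  · exact (compIn_subset this).2 hq
  · intro a ha b hb hab
    by_cases hbq : b = q
    · subst hbq; exact absurd hab.symm (hno a ha)
    · exact compIn_closed a ha b ⟨hb.1, fun h => hb.2 ⟨h, hbq⟩⟩ hab

theorem atom_U {G : SimpleGraph V} {C S : Set V} (hC : SetNC G C) (hS : AtomIn G S) {s : V}
    (hs : s ∈ S \ holeVerts G C S)
    (hsimp : G.IsClique (nbIn G (S \ holeVerts G C S) s)) {u v : V}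
    (hu : u ∈ holeVerts G C S) (hv : v ∈ holeVerts G C S) (huS : u ∈ S) (hvS : v ∈ S)
    (hsu : G.Adj s u) (hsv : G.Adj s v) : u = v := by
  by_contra huv
  set S0 := S \ holeVerts G C S with hS0
  set K := insert s (nbIn G S0 s) with hK
  set T := {z | z ∈ S \ K ∧ ¬ (z ∈ holeVerts G C S ∧ G.Adj s z ∧ z ≠ u)} with hT
  have hKc : G.IsClique K := hsimp.insert (fun b hb _ => hb.2)
  have hnK : ∀ z ∈ holeVerts G C S, z ∉ K := by
    rintro z hz (rfl | h)
    · exact hs.2 hz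
    · exact h.1.2 hz
  have huT : u ∈ T := ⟨⟨huS, hnK u hu⟩, fun h => h.2.2 rfl⟩
  set M := compIn G T u with hM
  have huM : u ∈ M := mem_compIn_self huT
  have hvM : v ∉ M := fun h => (compIn_subset h).2 ⟨hv, hsv, fun h => huv h.symm⟩
  obtain ⟨a, ha, w, hw, haw, hwM⟩ : ∃ a ∈ M, ∃ w ∈ S \ K, G.Adj a w ∧ w ∉ M := by
    by_contra hcon
    push Not at hcon
    exact hvM (hS K hKc M ⟨u, huM⟩ (fun z hz => (compIn_subset hz).1) hcon ⟨hvS, hnK v hv⟩)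
  have hwU : w ∈ holeVerts G C S ∧ G.Adj s w ∧ w ≠ u := by
    by_contra h
    exact hwM (compIn_closed a ha w ⟨hw, h⟩ haw)
  have hreach : ReachIn G (insert w M) u w :=
    ((compIn_reach huM ha).mono (Set.subset_insert _ _)).trans
      (ReachIn.step (Or.inr ha) (Or.inl rfl) haw)
  obtain ⟨P, hP, hPT⟩ := hreach.exists_indPath
  have huw : ¬ G.Adj u w := atom_indep hC hS hu hwU.1
  obtain ⟨R, hR, hRs⟩ := indPath_via (Ne.symm hwU.2.2) huw hsu.symm hwU.2.1
  obtain ⟨h, hh, hhs, -⟩ := exists_hole_of_paths (Ne.symm hwU.2.2) huw hP hR (by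
    intro z hz hzu hzw b hb hbu hbw
    have hbs : b = s := by
      rcases (hRs b).1 hb with h | h | h
      · exact absurd h hbu
      · exact h
      · exact absurd h hbw
    subst hbs
    have hzM : z ∈ M := (hPT z hz).resolve_left hzw
    have hzT := compIn_subset hzM
    refine ⟨fun h => hzT.1.2 (by simp [hK, h]), fun h => ?_⟩
    by_cases hzh : z ∈ holeVerts G C S
    · exact hzT.2 ⟨hzh, h.symm, hzu⟩
    · exact hzT.1.2 (Or.inr ⟨⟨hzT.1.1, hzh⟩, h.symm⟩))
  exact hwU.2.2 (hC.2 _ h hh w hwU.1.1 u hu.1 ((hhs w).2 (Or.inl P.end_mem_support))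
    ((hhs u).2 (Or.inl P.start_mem_support)))

theorem main_good {G : SimpleGraph V} [Finite V] {C : Set V}
    (hcov : ∀ (a : V) (w : G.Walk a a), IsHole G w → ∃ u ∈ C, u ∈ w.support)
    (hC : SetNC G C) (hG : ¬ HasMinor G (⊤ : SimpleGraph (Fin 5))) (S : Set V) :
    GoodL G (fun N => N.ncard ≤ 3) S := by
  induction S using WellFoundedLT.induction with
  | _ S ih =>
    rcases goodL_or_atom (L := fun N => N.ncard ≤ 3)
      (fun S a hS ha => nb_clique hG hS ha) (fun S' hS' => ih S' hS') with h | hat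
    · exact h
    by_cases hcl : G.IsClique S
    · exact Or.inl hcl
    have key : ∀ s ∈ S \ holeVerts G C S, G.IsClique (nbIn G (S \ holeVerts G C S) s) →
        (nbIn G S s).ncard ≤ 3 := by
      intro s hs hQ
      set Q := nbIn G (S \ holeVerts G C S) s with hQdef
      have h1 : (insert s Q).ncard ≤ 3 := atom_no4 hG hat hcl (hQ.insert (fun b hb _ => hb.2))
        (Set.insert_subset hs.1 (fun z hz => hz.1.1))
      rw [Set.ncard_insert_of_notMem (fun h => G.loopless.irrefl _ h.2)] at h1
      have h2 : (nbIn G S s ∩ holeVerts G C S).ncard ≤ 1 := by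
        rw [Set.ncard_le_one]
        intro u hu v hv
        exact atom_U hC hat hs hQ hu.2 hv.2 hu.1.1 hv.1.1 hu.1.2 hv.1.2
      have h3 : nbIn G S s ⊆ Q ∪ (nbIn G S s ∩ holeVerts G C S) := by
        intro z hz
        by_cases hzh : z ∈ holeVerts G C S
        · exact Or.inr ⟨hz, hzh⟩
        · exact Or.inl ⟨⟨hz.1, hzh⟩, hz.2⟩
      have h4 := Set.ncard_le_ncard h3
      have h5 := Set.ncard_union_le Q (nbIn G S s ∩ holeVerts G C S)
      show (nbIn G S s).ncard ≤ 3
      omega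
    rcases dirac_s1 (G := G) (S \ holeVerts G C S) (by
      intro a w hw h
      obtain ⟨u, hu, huw⟩ := hcov a w hw
      exact (h u huw).2 ⟨hu, a, w, hw, huw, fun z hz => (h z hz).1⟩) with h0 | h0
    · exfalso
      by_cases he : (holeVerts G C S).Nonempty
      · obtain ⟨u, hu⟩ := he
        obtain ⟨huC, a, w, hw, huw, hwS⟩ := id hu
        obtain ⟨d, hdw, hdu, hud⟩ := hole_far hw huw
        obtain ⟨x, hx, y, hy, hxy, hadj⟩ := bd_not_clique hat (hwS u huw) (hwS d hdw) hdu hud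
        have hb : ∀ x ∈ bdIn G S (compIn G {z | z ∈ S ∧ z ≠ u ∧ ¬ G.Adj u z} d),
            x ∈ S \ holeVerts G C S := by
          rintro x ⟨h1, h2, y, h3, h4⟩
          exact ⟨h1, fun h => atom_indep hC hat hu h (bd_subset h1 h2 h3 h4)⟩
        exact hadj (h0 (hb x hx) (hb y hy) hxy)
      · rw [Set.not_nonempty_iff_eq_empty] at he
        rw [he, Set.sdiff_empty] at h0
        exact hcl h0
    · obtain ⟨a, ha, b, hb, hab, hadj, hLa, hLb⟩ := h0
      exact Or.inr ⟨a, ha.1, b, hb.1, hab, hadj, key a ha hLa, key b hb hLb⟩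

theorem dp_greedy {G : SimpleGraph V} [Finite V]
    (hdeg : ∀ S : Set V, S.Nonempty → ∃ a ∈ S, (nbIn G S a).ncard ≤ 3) : DPColorable G 4 := by
  classical
  intro H hH
  have main : ∀ S : Set V, ∃ f : V → Fin 4, ∀ u ∈ S, ∀ v ∈ S, ¬ H.Adj (u, f u) (v, f v) := by
    intro S
    induction S using WellFoundedLT.induction with
    | _ S ih =>
      rcases S.eq_empty_or_nonempty with rfl | hne
      · exact ⟨fun _ => 0, by simp⟩
      obtain ⟨a, ha, hd⟩ := hdeg S hne
      obtain ⟨f, hf⟩ := ih (S \ {a}) ⟨Set.sdiff_subset, fun h => (h ha).2 rfl⟩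
      let bad : Set (Fin 4) := {c | ∃ w ∈ nbIn G S a, H.Adj (w, f w) (a, c)}
      have hbad : bad.ncard ≤ (nbIn G S a).ncard := by
        let g : V → Fin 4 := fun w => if h : ∃ c, H.Adj (w, f w) (a, c) then h.choose else 0
        have : bad ⊆ g '' (nbIn G S a) := by
          rintro c ⟨w, hw, hc⟩
          have hex : ∃ c, H.Adj (w, f w) (a, c) := ⟨c, hc⟩
          refine ⟨w, hw, ?_⟩
          simp only [g, dif_pos hex]
          exact hH.2.2 w a (f w) _ _ hw.2.ne' hex.choose_spec hc
        exact (Set.ncard_le_ncard this).trans (Set.ncard_image_le)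
      obtain ⟨c, hc⟩ : ∃ c, c ∉ bad := by
        by_contra hcon
        push Not at hcon
        have : bad = Set.univ := Set.eq_univ_of_forall hcon
        rw [this, Set.ncard_univ] at hbad
        simp at hbad
        omega
      have hac : ∀ w ∈ S, w ≠ a → ¬ H.Adj (w, f w) (a, c) := fun w hw hwa h =>
        hc ⟨w, ⟨hw, (hH.2.1 w a _ _ hwa h).symm⟩, h⟩
      refine ⟨Function.update f a c, fun u hu v hv h => ?_⟩
      by_cases hua : u = a <;> by_cases hva : v = a
      · rw [hua, hva] at h
        exact H.loopless.irrefl _ h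
      · subst hua
        simp [Function.update_of_ne hva] at h
        exact hac v hv hva h.symm
      · subst hva
        simp [Function.update_of_ne hua] at h
        exact hac u hu hua h
      · simp [Function.update_of_ne hua, Function.update_of_ne hva] at h
        exact hf u ⟨hu, hua⟩ v ⟨hv, hva⟩ h
  obtain ⟨f, hf⟩ := main Set.univ
  exact ⟨f, fun u v => hf u trivial v trivial⟩

end NCProof

/-- a planar finite simple graph with the NC property has `χ_DP(G) ≤ 4`. -/
theorem stmt1 {V : Type*} [Fintype V] [DecidableEq V] (G : SimpleGraph V)
    (hplanar : IsPlanar G) (hNC : HasNCProperty G) :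
    dpChromaticNumber G ≤ 4 := by

  obtain ⟨C, ⟨-, hcov⟩, hC⟩ := hNC
  refine Nat.sInf_le (dp_greedy (fun S hne => ?_))
  rcases main_good hcov hC hplanar.1 S with h | ⟨a, ha, -, -, -, -, h, -⟩
  · obtain ⟨a, ha⟩ := hne
    exact ⟨a, ha, nb_clique hplanar.1 h ha⟩
  · exact ⟨a, ha, h⟩
end

section
/- Let G be a finite simple graph with a hole cover C satisfying the NC property, and let Ĝ(C) be the chordal graph obtained from G by recursive local chordalizations by the vertices of C. If u and w are vertices of C that are adjacent in G, then there is no vertex v such that both uv and wv are newly added edges (edges of Ĝ(C) that are not edges of G). -/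
open SimpleGraph

variable {V : Type*}

namespace NCaux

variable {V : Type*}

/-- `a` and `b` are joined by a walk of `G` inside `S`. -/
def Conn (G : SimpleGraph V) (S : Set V) (a b : V) : Prop :=
  ∃ p : G.Walk a b, ∀ z ∈ p.support, z ∈ S

lemma Conn.mono {G : SimpleGraph V} {S T : Set V} {a b : V} (h : Conn G S a b) (hST : S ⊆ T) :
    Conn G T a b := by
  obtain ⟨p, hp⟩ := h
  exact ⟨p, fun z hz => hST (hp z hz)⟩

lemma Conn.trans {G : SimpleGraph V} {S : Set V} {a b c : V} (h : Conn G S a b)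
    (h' : Conn G S b c) : Conn G S a c := by
  obtain ⟨p, hp⟩ := h
  obtain ⟨q, hq⟩ := h'
  refine ⟨p.append q, fun z hz => ?_⟩
  rw [Walk.mem_support_append_iff] at hz
  exact hz.elim (hp z) (hq z)

lemma Conn.symm {G : SimpleGraph V} {S : Set V} {a b : V} (h : Conn G S a b) :
    Conn G S b a := by
  obtain ⟨p, hp⟩ := h
  exact ⟨p.reverse, fun z hz => hp z (by simpa using hz)⟩

lemma Conn.of_adj {G : SimpleGraph V} {S : Set V} {a b : V} (h : G.Adj a b) (ha : a ∈ S)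
    (hb : b ∈ S) : Conn G S a b :=
  ⟨Walk.cons h Walk.nil, by simp [ha, hb]⟩

lemma Conn.refl {G : SimpleGraph V} {S : Set V} {a : V} (ha : a ∈ S) : Conn G S a a :=
  ⟨Walk.nil, by simp [ha]⟩

/-- `S` is connected in `G`. -/
def ConnSet (G : SimpleGraph V) (S : Set V) : Prop :=
  ∀ a ∈ S, ∀ b ∈ S, Conn G S a b

/-- A union of two connected sets joined by an edge is connected. -/
lemma ConnSet.union {G : SimpleGraph V} {S T : Set V} (hS : ConnSet G S) (hT : ConnSet G T)
    {s t : V} (hs : s ∈ S) (ht : t ∈ T) (hst : G.Adj s t) : ConnSet G (S ∪ T) := by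
  have key : ∀ a ∈ S, ∀ b ∈ T, Conn G (S ∪ T) a b := fun a ha b hb =>
    (((hS a ha s hs).mono Set.subset_union_left).trans
      (Conn.of_adj hst (Or.inl hs) (Or.inr ht))).trans
      ((hT t ht b hb).mono Set.subset_union_right)
  rintro a (ha | ha) b (hb | hb)
  · exact (hS a ha b hb).mono Set.subset_union_left
  · exact key a ha b hb
  · exact (key b hb a ha).symm
  · exact (hT a ha b hb).mono Set.subset_union_right

lemma ConnSet.singleton (G : SimpleGraph V) (x : V) : ConnSet G {x} := by
  rintro a rfl b rfl
  exact Conn.refl rfl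

/-- Shortest walks are chordless paths. -/
lemma Conn.exists_chordless {G : SimpleGraph V} {S : Set V} {a b : V} (h : Conn G S a b) :
    ∃ p : G.Walk a b, (∀ z ∈ p.support, z ∈ S) ∧ p.IsPath ∧
      ∀ x y : V, x ∈ p.support → y ∈ p.support → G.Adj x y → s(x, y) ∈ p.edges := by
  classical
  have hex : ∃ n, ∃ p : G.Walk a b, (∀ z ∈ p.support, z ∈ S) ∧ p.length = n := by
    obtain ⟨p, hp⟩ := h
    exact ⟨_, p, hp, rfl⟩
  obtain ⟨p, hpS, hpn⟩ := Nat.find_spec hex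
  have hmin : ∀ q : G.Walk a b, (∀ z ∈ q.support, z ∈ S) → p.length ≤ q.length := by
    intro q hq
    rw [hpn]
    exact Nat.find_min' hex ⟨q, hq, rfl⟩
  refine ⟨p.bypass, fun z hz => hpS z (p.support_bypass_subset_support hz), p.bypass_isPath, ?_⟩
  have hmin' : ∀ q : G.Walk a b, (∀ z ∈ q.support, z ∈ S) → p.bypass.length ≤ q.length :=
    fun q hq => (p.length_bypass_le_length).trans (hmin q hq)
  have hS' : ∀ z ∈ p.bypass.support, z ∈ S :=
    fun z hz => hpS z (p.support_bypass_subset_support hz)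
  generalize p.bypass = r at hmin' hS'
  -- ordered version
  have key : ∀ x y : V, ∀ (r1 : G.Walk a x) (r2 : G.Walk x y) (r3 : G.Walk y b),
      r = r1.append (r2.append r3) → G.Adj x y → s(x, y) ∈ r.edges := by
    intro x y r1 r2 r3 hr hadj
    have h1 := hmin' (r1.append (Walk.cons hadj r3)) (by
      intro z hz
      apply hS'
      rw [hr]
      simp only [Walk.mem_support_append_iff, Walk.support_cons, List.mem_cons] at hz ⊢
      rcases hz with hz | hz | hz
      · exact Or.inl hz
      · left; rw [hz]; exact r1.end_mem_support
      · exact Or.inr (Or.inr hz))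
    rw [hr] at h1
    simp only [Walk.length_append, Walk.length_cons] at h1
    have h2 : r2.length ≤ 1 := by omega
    rw [hr]
    simp only [Walk.edges_append, List.mem_append]
    right; left
    cases r2 with
    | nil => exact absurd hadj (G.loopless.irrefl _)
    | cons h' t =>
      cases t with
      | nil => simp
      | cons h'' t' => simp at h2
  intro x y hx hy hadj
  have hy' := hy
  rw [← Walk.take_spec r hx, Walk.mem_support_append_iff] at hy'
  rcases hy' with hy' | hy'
  · rw [Sym2.eq_swap]
    refine key y x ((r.takeUntil x hx).takeUntil y hy') ((r.takeUntil x hx).dropUntil y hy')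
      (r.dropUntil x hx) ?_ hadj.symm
    rw [Walk.append_assoc, Walk.take_spec, Walk.take_spec]
  · refine key x y (r.takeUntil x hx) ((r.dropUntil x hx).takeUntil y hy')
      ((r.dropUntil x hx).dropUntil y hy') ?_ hadj
    rw [Walk.take_spec, Walk.take_spec]

/-- Building a hole through the induced path `a x b`. -/
lemma exists_hole {G : SimpleGraph V} {x a b : V} {S : Set V} (hxS : x ∉ S)
    (hxa : G.Adj x a) (hxb : G.Adj x b) (hab : a ≠ b) (hnab : ¬ G.Adj a b)
    (huniq : ∀ z ∈ S, G.Adj x z → z = a ∨ z = b) (hc : Conn G S a b) :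
    ∃ (p : G.Walk a b) (w : G.Walk x x), (∀ z ∈ p.support, z ∈ S) ∧ IsHole G w ∧
      (∀ z, z ∈ w.support ↔ z = x ∨ z ∈ p.support) ∧ s(x, a) ∈ w.edges ∧ s(x, b) ∈ w.edges := by
  obtain ⟨p, hpS, hpath, hch⟩ := hc.exists_chordless
  have hxp : x ∉ p.support := fun h => hxS (hpS x h)
  have hsup : ∀ z, z ∈ (Walk.cons hxa (p.concat hxb.symm)).support ↔ z = x ∨ z ∈ p.support := by
    intro z
    simp only [Walk.support_cons, Walk.support_concat, List.mem_cons, List.mem_append]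
    simp
    tauto
  have hed : ∀ e, e ∈ (Walk.cons hxa (p.concat hxb.symm)).edges ↔
      e = s(x, a) ∨ e ∈ p.edges ∨ e = s(b, x) := by
    intro e
    simp [Walk.edges_concat]
  refine ⟨p, Walk.cons hxa (p.concat hxb.symm), hpS, ⟨?_, ?_, ?_⟩, hsup, ?_, ?_⟩
  · rw [Walk.cons_isCycle_iff]
    refine ⟨hpath.concat hxp hxb.symm, ?_⟩
    rw [Walk.edges_concat]
    intro h
    simp only [List.concat_eq_append, List.mem_append, List.mem_singleton] at h
    rcases h with h | h
    · exact hxp (p.fst_mem_support_of_mem_edges h)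
    · have : a = b := by
        rw [Sym2.eq_iff] at h
        rcases h with ⟨h1, h2⟩ | ⟨h1, h2⟩
        · exact absurd h1 hxb.ne
        · exact h2
      exact hab this
  · simp only [Walk.length_cons, Walk.length_concat]
    cases p with
    | nil => exact absurd rfl hab
    | cons h t =>
      cases t with
      | nil => exact absurd h hnab
      | cons h' t' => simp
  · intro y z hy hz hyz
    rw [hsup] at hy hz
    rw [hed]
    rcases hy with rfl | hy
    · rcases hz with rfl | hz
      · exact absurd hyz (G.loopless.irrefl _)
      · rcases huniq z (hpS z hz) hyz with rfl | rfl
        · exact Or.inl rfl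
        · exact Or.inr (Or.inr Sym2.eq_swap)
    · rcases hz with rfl | hz
      · rcases huniq y (hpS y hy) hyz.symm with rfl | rfl
        · exact Or.inl Sym2.eq_swap
        · exact Or.inr (Or.inr rfl)
      · exact Or.inr (Or.inl (hch y z hy hz hyz))
  · rw [hed]; exact Or.inl rfl
  · rw [hed]; exact Or.inr (Or.inr Sym2.eq_swap)

lemma exists_arm {G : SimpleGraph V} {q u : V} {P : Set V} (hqu : q ≠ u)
    (hc : Conn G (P ∪ {q, u}) q u) (hadj : ¬ G.Adj q u) :
    ∃ (a : V) (p : G.Walk a u), G.Adj q a ∧ a ∈ P ∧ (∀ z ∈ p.support, z = u ∨ z ∈ P) ∧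
      q ∉ p.support ∧ ∀ z ∈ p.support, G.Adj q z → z = a := by
  obtain ⟨p, hpS, hpath, hch⟩ := hc.exists_chordless
  cases p with
  | nil => exact absurd rfl hqu
  | @cons _ a _ h p =>
    rw [Walk.cons_isPath_iff] at hpath
    have hP : ∀ z ∈ p.support, z = u ∨ z ∈ P := by
      intro z hz
      have h1 := hpS z (by simp [hz])
      have h2 : z ≠ q := fun h => hpath.2 (h ▸ hz)
      simp only [Set.mem_union, Set.mem_insert_iff, Set.mem_singleton_iff] at h1
      tauto
    refine ⟨a, p, h, ?_, hP, hpath.2, ?_⟩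
    · rcases hP a p.start_mem_support with rfl | h'
      · exact absurd h hadj
      · exact h'
    · intro z hz hqz
      have := hch q z (by simp) (by simp [hz]) hqz
      simp only [Walk.edges_cons, List.mem_cons] at this
      rcases this with h1 | h1
      · rw [Sym2.eq_iff] at h1
        rcases h1 with ⟨_, h1⟩ | ⟨h1, h2⟩
        · exact h1
        · exact absurd h1 h.ne
      · exact absurd (p.fst_mem_support_of_mem_edges h1) hpath.2

lemma walk_stays {G : SimpleGraph V} {P T : Set V} (hno : ∀ x ∈ P, ∀ y ∈ T, ¬ G.Adj x y)
    {a b : V} (p : G.Walk a b) (ha : a ∈ P) (hp : ∀ z ∈ p.support, z ∈ P ∨ z ∈ T) : b ∈ P := by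
  induction p with
  | nil => exact ha
  | @cons a c b h p ih =>
    apply ih
    · rcases hp c (by simp) with h' | h'
      · exact h'
      · exact absurd h (hno _ ha _ h')
    · intro z hz
      exact hp z (by simp [hz])

/-- A hole through `u` and `q` from two non-touching connected sets. -/
lemma exists_hole_two {G : SimpleGraph V} {u q : V} {P T : Set V} (hqu : q ≠ u)
    (hadj : ¬ G.Adj q u) (hP : ConnSet G P) (hT : ConnSet G T)
    (hno : ∀ x ∈ P, ∀ y ∈ T, ¬ G.Adj x y) (hdis : ∀ x ∈ P, x ∉ T)
    (h1 : ∃ z ∈ P, G.Adj q z) (h2 : ∃ z ∈ P, G.Adj u z)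
    (h3 : ∃ z ∈ T, G.Adj q z) (h4 : ∃ z ∈ T, G.Adj u z) :
    ∃ w : G.Walk q q, IsHole G w ∧ q ∈ w.support ∧ u ∈ w.support := by
  have conn : ∀ A : Set V, ConnSet G A → (∃ z ∈ A, G.Adj q z) → (∃ z ∈ A, G.Adj u z) →
      Conn G (A ∪ {q, u}) q u := by
    rintro A hA ⟨y, hy, hqy⟩ ⟨z, hz, huz⟩
    exact ((Conn.of_adj hqy (by simp) (Or.inl hy)).trans
      ((hA y hy z hz).mono Set.subset_union_left)).trans
      (Conn.of_adj huz.symm (Or.inl hz) (by simp))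
  obtain ⟨a, p, hqa, haP, hpS, hqp, hpu⟩ := exists_arm hqu (conn P hP h1 h2) hadj
  obtain ⟨b, r, hqb, hbT, hrS, hqr, hru⟩ := exists_arm hqu (conn T hT h3 h4) hadj
  obtain ⟨m, w, hmS, hw, hws, -, -⟩ := exists_hole (G := G) (x := q) (a := a) (b := b)
    (S := {z | z ∈ p.support ∨ z ∈ r.support}) (by simp [hqp, hqr]) hqa hqb
    (fun h => hdis a haP (h ▸ hbT)) (hno a haP b hbT)
    (by
      rintro z (hz | hz) hqz
      · exact Or.inl (hpu z hz hqz)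
      · exact Or.inr (hru z hz hqz))
    (Conn.trans (b := u) ⟨p, fun z hz => Or.inl hz⟩
      (Conn.symm ⟨r, fun z hz => Or.inr hz⟩))
  refine ⟨w, hw, w.start_mem_support, ?_⟩
  rw [hws]
  right
  by_contra hu
  apply hdis b _ hbT
  apply walk_stays hno m haP
  intro z hz
  have hzu : z ≠ u := fun h => hu (h ▸ hz)
  rcases hmS z hz with h | h
  · exact Or.inl ((hpS z h).resolve_left hzu)
  · exact Or.inr ((hrS z h).resolve_left hzu)

/-- Decomposition of a hole (vertex list `s`, edge list `E`) at two nonadjacent vertices. -/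
structure Split (G : SimpleGraph V) (s : List V) (E : List (Sym2 V)) (u x : V) (L R : Set V) :
    Prop where
  connL : ConnSet G L
  connR : ConnSet G R
  uL : u ∉ L
  uR : u ∉ R
  xL : x ∉ L
  xR : x ∉ R
  no : ∀ y ∈ L, ∀ z ∈ R, ¬ G.Adj y z
  dis : ∀ y ∈ L, y ∉ R
  xaL : ∃ a ∈ L, G.Adj x a ∧ s(x, a) ∈ E ∧ ∀ z ∈ L, G.Adj x z → z = a
  xaR : ∃ a ∈ R, G.Adj x a ∧ s(x, a) ∈ E ∧ ∀ z ∈ R, G.Adj x z → z = a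
  uaL : ∃ a ∈ L, G.Adj u a ∧ ∀ z ∈ L, G.Adj u z → z = a
  uaR : ∃ a ∈ R, G.Adj u a ∧ ∀ z ∈ R, G.Adj u z → z = a
  mem : ∀ z, z ∈ s ↔ z = u ∨ z = x ∨ z ∈ L ∨ z ∈ R

lemma Split.swap {G : SimpleGraph V} {s : List V} {E : List (Sym2 V)} {u x : V} {L R : Set V}
    (h : Split G s E u x L R) : Split G s E u x R L where
  connL := h.connR
  connR := h.connL
  uL := h.uR
  uR := h.uL
  xL := h.xR
  xR := h.xL
  no := fun y hy z hz hyz => h.no z hz y hy hyz.symm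
  dis := fun y hy hy' => h.dis y hy' hy
  xaL := h.xaR
  xaR := h.xaL
  uaL := h.uaR
  uaR := h.uaL
  mem := fun z => by rw [h.mem]; tauto

lemma connSet_support {G : SimpleGraph V} {a b : V} (p : G.Walk a b) :
    ConnSet G {z | z ∈ p.support} := by
  classical
  have key : ∀ c ∈ p.support, Conn G {z | z ∈ p.support} a c := fun c hc =>
    ⟨p.takeUntil c hc, fun z hz => p.support_takeUntil_subset_support hc hz⟩
  intro c hc d hd
  exact (key c hc).symm.trans (key d hd)

/-- Strip the ends off a walk. -/
lemma strip {G : SimpleGraph V} {u x : V} (p : G.Walk u x) (hux : u ≠ x) (hadj : ¬ G.Adj u x) :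
    ∃ (a b : V) (m : G.Walk a b) (h : G.Adj u a) (h' : G.Adj b x),
      p = Walk.cons h (m.concat h') := by
  cases p with
  | nil => exact absurd rfl hux
  | @cons _ a _ h p =>
    cases p with
    | nil => exact absurd h hadj
    | cons h1 t =>
      obtain ⟨b, m, h', e⟩ := Walk.exists_cons_eq_concat h1 t
      exact ⟨a, b, m, h, h', by rw [e]⟩

lemma nodup_aux {u x : V} {l l' : List V} (h : (l ++ [x] ++ (l' ++ [u])).Nodup) :
    x ∉ l ∧ x ∉ l' ∧ u ∉ l ∧ u ∉ l' ∧ ∀ z ∈ l, z ∉ l' := by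
  grind

lemma exists_split {G : SimpleGraph V} {c : V} {w : G.Walk c c} (hw : IsHole G w) {u x : V}
    (hu : u ∈ w.support) (hx : x ∈ w.support) (hux : u ≠ x) (hadj : ¬ G.Adj u x) :
    ∃ L R, Split G w.support w.edges u x L R := by
  classical
  obtain ⟨hcyc, hlen, hind⟩ := hw
  have hcyc' := hcyc.rotate hu
  have hs : ∀ z, z ∈ (w.rotate u hu).support ↔ z ∈ w.support :=
    fun z => Walk.mem_support_rotate_iff ..
  have he : ∀ e, e ∈ (w.rotate u hu).edges ↔ e ∈ w.edges :=
    fun e => (w.rotate_edges u hu).perm.mem_iff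
  generalize w.rotate u hu = w' at hcyc' hs he
  have hx' : x ∈ w'.support := (hs x).2 hx
  have hsp := Walk.take_spec w' hx'
  obtain ⟨a, b, m, ha, hb, hm⟩ := strip (w'.takeUntil x hx') hux hadj
  obtain ⟨a', b', m', ha', hb', hm'⟩ := strip (w'.dropUntil x hx') hux.symm
    (fun h => hadj h.symm)
  rw [hm, hm'] at hsp
  clear hm hm'
  subst hsp
  have hnd := hcyc'.support_nodup
  simp only [Walk.support_append, Walk.support_cons, Walk.support_concat, List.tail_cons,
    List.cons_append] at hnd
  simp only [Walk.edges_append, Walk.edges_cons, Walk.edges_concat, List.mem_append,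
    List.concat_eq_append, List.mem_cons, List.mem_singleton, List.cons_append,
    List.not_mem_nil, or_false] at he
  simp only [Walk.mem_support_append_iff, Walk.support_cons, Walk.support_concat,
    List.concat_eq_append, List.mem_append, List.mem_cons, List.mem_singleton,
    List.not_mem_nil, or_false] at hs
  obtain ⟨hxm, hxm', hum, hum', hdis⟩ := nodup_aux hnd
  have hme : ∀ y z, s(y, z) ∈ m.edges → y ∈ m.support ∧ z ∈ m.support := fun y z h =>
    ⟨m.fst_mem_support_of_mem_edges h, m.snd_mem_support_of_mem_edges h⟩
  have hme' : ∀ y z, s(y, z) ∈ m'.edges → y ∈ m'.support ∧ z ∈ m'.support := fun y z h =>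
    ⟨m'.fst_mem_support_of_mem_edges h, m'.snd_mem_support_of_mem_edges h⟩
  have am := m.start_mem_support
  have bm := m.end_mem_support
  have am' := m'.start_mem_support
  have bm' := m'.end_mem_support
  have hadj' : ∀ y z, y ∈ w.support → z ∈ w.support → G.Adj y z →
      s(y, z) = s(u, a) ∨ s(y, z) ∈ m.edges ∨ s(y, z) = s(b, x) ∨ s(y, z) = s(x, a') ∨
      s(y, z) ∈ m'.edges ∨ s(y, z) = s(b', u) := by
    intro y z hy hz hyz
    have := (he _).2 (hind y z hy hz hyz)
    tauto
  have hmw : ∀ z ∈ m.support, z ∈ w.support := fun z hz => (hs z).1 (Or.inl (Or.inr (Or.inl hz)))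
  have hmw' : ∀ z ∈ m'.support, z ∈ w.support :=
    fun z hz => (hs z).1 (Or.inr (Or.inr (Or.inl hz)))
  have heb : s(x, b) ∈ w.edges := (he _).1 (by simp [Sym2.eq_swap])
  have hea' : s(x, a') ∈ w.edges := (he _).1 (by simp)
  have hmem : ∀ z, z ∈ w.support ↔ z = u ∨ z = x ∨ z ∈ m.support ∨ z ∈ m'.support := by
    intro z
    rw [← hs z]
    constructor
    · rintro ((h | h | h) | h | h | h) <;> simp [h]
    · rintro (h | h | h | h) <;> simp [h]
  clear hs he hind hnd hcyc' hx' hcyc hlen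
  refine ⟨{z | z ∈ m.support}, {z | z ∈ m'.support}, connSet_support m, connSet_support m',
    hum, hum', hxm, hxm', fun y hy z hz hyz => ?_, hdis,
    ⟨b, bm, hb.symm, heb, fun z hz hxz => ?_⟩, ⟨a', am', ha', hea', fun z hz hxz => ?_⟩,
    ⟨a, am, ha, fun z hz hxz => ?_⟩, ⟨b', bm', hb'.symm, fun z hz hxz => ?_⟩, hmem⟩
  · have h1 := hadj' y z (hmw _ hy) (hmw' _ hz) hyz
    have hz' := hdis y hy
    have h3 := hdis z
    have h2 := hme y z
    have h2' := hme' y z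
    simp only [Sym2.eq_iff, Set.mem_ofPred_eq] at h1 hy hz
    rcases h1 with (⟨h, h'⟩ | ⟨h, h'⟩) | h | (⟨h, h'⟩ | ⟨h, h'⟩) | (⟨h, h'⟩ | ⟨h, h'⟩) | h |
      (⟨h, h'⟩ | ⟨h, h'⟩) <;> subst_vars <;> tauto
  · have h1 := hadj' x z hx (hmw _ hz) hxz
    have h3 := hdis z
    have h2 := hme x z
    have h2' := hme' x z
    simp only [Sym2.eq_iff, Set.mem_ofPred_eq] at h1 hz
    rcases h1 with (⟨h, h'⟩ | ⟨h, h'⟩) | h | (⟨h, h'⟩ | ⟨h, h'⟩) | (⟨h, h'⟩ | ⟨h, h'⟩) | h |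
      (⟨h, h'⟩ | ⟨h, h'⟩) <;> subst_vars <;> tauto
  · have h1 := hadj' x z hx (hmw' _ hz) hxz
    have h3 := hdis z
    have h2 := hme x z
    have h2' := hme' x z
    simp only [Sym2.eq_iff, Set.mem_ofPred_eq] at h1 hz
    rcases h1 with (⟨h, h'⟩ | ⟨h, h'⟩) | h | (⟨h, h'⟩ | ⟨h, h'⟩) | (⟨h, h'⟩ | ⟨h, h'⟩) | h |
      (⟨h, h'⟩ | ⟨h, h'⟩) <;> subst_vars <;> tauto
  · have h1 := hadj' u z hu (hmw _ hz) hxz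
    have h3 := hdis z
    have h2 := hme u z
    have h2' := hme' u z
    simp only [Sym2.eq_iff, Set.mem_ofPred_eq] at h1 hz
    rcases h1 with (⟨h, h'⟩ | ⟨h, h'⟩) | h | (⟨h, h'⟩ | ⟨h, h'⟩) | (⟨h, h'⟩ | ⟨h, h'⟩) | h |
      (⟨h, h'⟩ | ⟨h, h'⟩) <;> subst_vars <;> tauto
  · have h1 := hadj' u z hu (hmw' _ hz) hxz
    have h3 := hdis z
    have h2 := hme u z
    have h2' := hme' u z
    simp only [Sym2.eq_iff, Set.mem_ofPred_eq] at h1 hz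
    rcases h1 with (⟨h, h'⟩ | ⟨h, h'⟩) | h | (⟨h, h'⟩ | ⟨h, h'⟩) | (⟨h, h'⟩ | ⟨h, h'⟩) | h |
      (⟨h, h'⟩ | ⟨h, h'⟩) <;> subst_vars <;> tauto

/-- The NC property: a connected set avoiding `u` and `N[x]` cannot touch both sides. -/
lemma star {G : SimpleGraph V} {u x c : V} (hNC : VertexNC G u) {w : G.Walk c c}
    (hw : IsHole G w) {L R T : Set V} (hsp : Split G w.support w.edges u x L R)
    (hux : u ≠ x) (hT : ConnSet G T) (huT : u ∉ T) (hxT : x ∉ T) (hTx : ∀ z ∈ T, ¬ G.Adj x z)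
    (h1 : ∃ t ∈ T, ∃ y ∈ L, t = y ∨ G.Adj y t) (h2 : ∃ t ∈ T, ∃ y ∈ R, t = y ∨ G.Adj y t) :
    False := by
  obtain ⟨a, haL, hxa, hae, hau⟩ := hsp.xaL
  obtain ⟨b, hbR, hxb, hbe, hbu⟩ := hsp.xaR
  obtain ⟨t1, ht1, y1, hy1, h1⟩ := h1
  obtain ⟨t2, ht2, y2, hy2, h2⟩ := h2
  have hLS : L ⊆ L ∪ R ∪ T := fun z hz => Or.inl (Or.inl hz)
  have hRS : R ⊆ L ∪ R ∪ T := fun z hz => Or.inl (Or.inr hz)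
  have hTS : T ⊆ L ∪ R ∪ T := fun z hz => Or.inr hz
  have c1 : Conn G (L ∪ R ∪ T) y1 t1 := by
    rcases h1 with rfl | h1
    · exact Conn.refl (hTS ht1)
    · exact Conn.of_adj h1 (hLS hy1) (hTS ht1)
  have c2 : Conn G (L ∪ R ∪ T) y2 t2 := by
    rcases h2 with rfl | h2
    · exact Conn.refl (hTS ht2)
    · exact Conn.of_adj h2 (hRS hy2) (hTS ht2)
  have cab : Conn G (L ∪ R ∪ T) a b :=
    ((((hsp.connL a haL y1 hy1).mono hLS).trans c1).trans ((hT t1 ht1 t2 ht2).mono hTS)).trans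
      (c2.symm.trans ((hsp.connR y2 hy2 b hbR).mono hRS))
  obtain ⟨p, w2, hp, hw2, hs2, hea, heb⟩ := exists_hole (G := G) (x := x)
    (S := L ∪ R ∪ T) (by
      rintro ((h | h) | h)
      · exact hsp.xL h
      · exact hsp.xR h
      · exact hxT h) hxa hxb (fun h => hsp.dis a haL (h ▸ hbR)) (hsp.no a haL b hbR)
    (by
      rintro z ((h | h) | h) hxz
      · exact Or.inl (hau z h hxz)
      · exact Or.inr (hbu z h hxz)
      · exact absurd hxz (hTx z h)) cab
  refine hNC c x w w2 hw hw2 ((hsp.mem u).2 (Or.inl rfl)) ?_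
    ⟨a, x, b, fun h => hsp.dis a haL (h ▸ hbR), ?_, hbe, ?_, heb⟩
  · rw [hs2]
    rintro (h | h)
    · exact hux h
    · rcases hp u h with (h | h) | h
      · exact hsp.uL h
      · exact hsp.uR h
      · exact huT h
  · rw [Sym2.eq_swap]; exact hae
  · rw [Sym2.eq_swap]; exact hea

lemma lc_adj_u {G : SimpleGraph V} {u z : V} :
    (localChordalize G u).Adj u z ↔ G.Adj u z ∨ (u ≠ z ∧
      ∃ (a : V) (w : G.Walk a a), IsHole G w ∧ u ∈ w.support ∧ z ∈ w.support) := by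
  simp only [localChordalize, SimpleGraph.sup_adj, SimpleGraph.fromRel_adj]
  constructor
  · rintro (h | ⟨hne, ⟨-, h⟩ | ⟨h, -⟩⟩)
    · exact Or.inl h
    · exact Or.inr ⟨hne, h⟩
    · exact absurd h.symm hne
  · rintro (h | ⟨hne, h⟩)
    · exact Or.inl h
    · exact Or.inr ⟨hne, Or.inl ⟨trivial, h⟩⟩

lemma lc_adj_ne {G : SimpleGraph V} {u x y : V} (hx : x ≠ u) (hy : y ≠ u) :
    (localChordalize G u).Adj x y ↔ G.Adj x y := by
  simp only [localChordalize, SimpleGraph.sup_adj, SimpleGraph.fromRel_adj]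
  tauto

lemma le_lc (G : SimpleGraph V) (u : V) : G ≤ localChordalize G u := le_sup_left

/-- The heart of the argument. -/
lemma core {G : SimpleGraph V} {u x y q : V} {R : Set V} (hNC : VertexNC G u)
    (hx : (localChordalize G u).Adj u x) (hy : (localChordalize G u).Adj u y)
    (hqu : q ≠ u) (hq : ¬ (localChordalize G u).Adj u q) (hxq : G.Adj x q)
    (hR : ConnSet G R) (huR : u ∉ R) (hxR : x ∉ R) (hRx : ∀ z ∈ R, ¬ G.Adj x z)
    (hyR : y ∈ R) (hqR : ∃ z ∈ R, G.Adj q z) : False := by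
  have hux : u ≠ x := hx.ne
  have huy : u ≠ y := hy.ne
  have h1 : ∃ T, R ⊆ T ∧ ConnSet G T ∧ u ∉ T ∧ x ∉ T ∧ (∀ z ∈ T, ¬ G.Adj x z) ∧
      ∃ z ∈ T, G.Adj u z := by
    by_cases huy' : G.Adj u y
    · exact ⟨R, subset_rfl, hR, huR, hxR, hRx, y, hyR, huy'⟩
    obtain ⟨-, c, w, hw, huw, hyw⟩ := (lc_adj_u.1 hy).resolve_left huy'
    have step : ∀ A B, Split G w.support w.edges u y A B →
        (¬ ∃ t ∈ ({x} : Set V), ∃ z ∈ A, t = z ∨ G.Adj z t) →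
        ∃ T, R ⊆ T ∧ ConnSet G T ∧ u ∉ T ∧ x ∉ T ∧ (∀ z ∈ T, ¬ G.Adj x z) ∧
          ∃ z ∈ T, G.Adj u z := by
      intro A B hsp hno
      obtain ⟨a, ha, hya, -, -⟩ := hsp.xaL
      obtain ⟨b, hb, hub, -⟩ := hsp.uaL
      refine ⟨R ∪ A, Set.subset_union_left, hR.union hsp.connL hyR ha hya, ?_, ?_, ?_,
        b, Or.inr hb, hub⟩
      · rintro (h | h)
        · exact huR h
        · exact hsp.uL h
      · rintro (h | h)
        · exact hxR h
        · exact hno ⟨x, rfl, x, h, Or.inl rfl⟩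
      · rintro z (h | h) hxz
        · exact hRx z h hxz
        · exact hno ⟨x, rfl, z, h, Or.inr hxz.symm⟩
    obtain ⟨A, B, hsp⟩ := exists_split hw huw hyw huy huy'
    by_cases hA : ∃ t ∈ ({x} : Set V), ∃ z ∈ A, t = z ∨ G.Adj z t
    · by_cases hB : ∃ t ∈ ({x} : Set V), ∃ z ∈ B, t = z ∨ G.Adj z t
      · exfalso
        refine star hNC hw hsp huy (ConnSet.singleton G x) hux ?_ ?_ hA hB
        · intro h
          rw [Set.mem_singleton_iff] at h
          exact hxR (h ▸ hyR)
        · rintro z rfl h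
          exact hRx y hyR h.symm
      · exact step B A hsp.swap hB
    · exact step A B hsp hA
  obtain ⟨T, hRT, hT, huT, hxT, hTx, hTu⟩ := h1
  have h2 : ∃ P : Set V, x ∈ P ∧ ConnSet G P ∧ (∀ y ∈ P, ∀ z ∈ T, ¬ G.Adj y z) ∧
      (∀ y ∈ P, y ∉ T) ∧ ∃ z ∈ P, G.Adj u z := by
    by_cases hux' : G.Adj u x
    · refine ⟨{x}, rfl, ConnSet.singleton G x, ?_, ?_, x, rfl, hux'⟩
      · rintro y rfl; exact hTx
      · rintro y rfl; exact hxT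
    obtain ⟨-, c, w, hw, huw, hxw⟩ := (lc_adj_u.1 hx).resolve_left hux'
    have step : ∀ A B, Split G w.support w.edges u x A B →
        (¬ ∃ t ∈ T, ∃ z ∈ A, t = z ∨ G.Adj z t) →
        ∃ P : Set V, x ∈ P ∧ ConnSet G P ∧ (∀ y ∈ P, ∀ z ∈ T, ¬ G.Adj y z) ∧
          (∀ y ∈ P, y ∉ T) ∧ ∃ z ∈ P, G.Adj u z := by
      intro A B hsp hno
      obtain ⟨a, ha, hxa, -, -⟩ := hsp.xaL
      obtain ⟨b, hb, hub, -⟩ := hsp.uaL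
      refine ⟨{x} ∪ A, Or.inl rfl, (ConnSet.singleton G x).union hsp.connL rfl ha hxa, ?_, ?_,
        b, Or.inr hb, hub⟩
      · rintro y (rfl | h) z hz
        · exact hTx z hz
        · exact fun hyz => hno ⟨z, hz, y, h, Or.inr hyz⟩
      · rintro y (rfl | h) hz
        · exact hxT hz
        · exact hno ⟨y, hz, y, h, Or.inl rfl⟩
    obtain ⟨A, B, hsp⟩ := exists_split hw huw hxw hux hux'
    by_cases hA : ∃ t ∈ T, ∃ z ∈ A, t = z ∨ G.Adj z t
    · by_cases hB : ∃ t ∈ T, ∃ z ∈ B, t = z ∨ G.Adj z t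
      · exact (star hNC hw hsp hux hT huT hxT hTx hA hB).elim
      · exact step B A hsp.swap hB
    · exact step A B hsp hA
  obtain ⟨P, hxP, hP, hPT, hdis, hPu⟩ := h2
  obtain ⟨z, hz, hqz⟩ := hqR
  obtain ⟨w, hw, hqw, huw⟩ := exists_hole_two hqu
    (fun h => hq (le_lc G u h.symm)) hP hT hPT hdis ⟨x, hxP, hxq.symm⟩ hPu
    ⟨z, hRT hz, hqz⟩ hTu
  exact hq (lc_adj_u.2 (Or.inr ⟨hqu.symm, q, w, hw, huw, hqw⟩))

/-- On a hole through `u` there is a vertex at distance two from `u`. -/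
lemma exists_dist_two {G : SimpleGraph V} {c u : V} {w : G.Walk c c} (hw : IsHole G w)
    (hu : u ∈ w.support) : ∃ x q, x ∈ w.support ∧ q ∈ w.support ∧ G.Adj u x ∧ G.Adj x q ∧
      q ≠ u ∧ ¬ G.Adj u q := by
  classical
  obtain ⟨hcyc, hlen, hind⟩ := hw
  have hcyc' := hcyc.rotate hu
  have hs : ∀ z, z ∈ (w.rotate u hu).support ↔ z ∈ w.support :=
    fun z => Walk.mem_support_rotate_iff ..
  have he : ∀ e, e ∈ (w.rotate u hu).edges ↔ e ∈ w.edges :=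
    fun e => (w.rotate_edges u hu).perm.mem_iff
  have hl : (w.rotate u hu).length = w.length := Walk.length_rotate ..
  rw [← hl] at hlen
  clear hl
  generalize w.rotate u hu = w' at hcyc' hs he hlen
  cases w' with
  | nil => simp at hlen
  | @cons _ x _ h1 p =>
  cases p with
  | nil => simp at hlen
  | @cons _ q _ h2 p =>
  cases p with
  | nil => simp at hlen
  | @cons _ r _ h3 p =>
  cases p with
  | nil => simp at hlen
  | @cons _ t _ h4 p =>
  rw [Walk.cons_isCycle_iff] at hcyc'
  have hp := hcyc'.1.support_nodup
  have hup := p.end_mem_support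
  simp only [Walk.support_cons, List.nodup_cons, List.mem_cons] at hp
  have hqu : q ≠ u := fun h => hp.2.1 (Or.inr (h ▸ hup))
  have hru : r ≠ u := fun h => hp.2.2.1 (h ▸ hup)
  refine ⟨x, q, (hs x).1 (by simp), (hs q).1 (by simp), h1, h2, hqu, fun huq => ?_⟩
  have := (he _).2 (hind u q hu ((hs q).1 (by simp)) huq)
  simp only [Walk.edges_cons, List.mem_cons] at this
  have h5 : s(u, q) ∈ p.edges → q ∈ p.support := fun h => p.snd_mem_support_of_mem_edges h
  have h1' := h1.ne
  have h2' := h2.ne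
  simp only [Sym2.eq_iff] at this
  rcases this with (⟨_, h⟩ | ⟨h, _⟩) | (⟨h, _⟩ | ⟨h, _⟩) | (⟨h, _⟩ | ⟨h, _⟩) |
    (⟨_, h⟩ | ⟨h, _⟩) | h
  · exact h2' h.symm
  · exact h1' h
  · exact h1' h
  · exact hqu h.symm
  · exact hqu h.symm
  · exact hru h.symm
  · exact hp.2.1 (Or.inr (h ▸ p.start_mem_support))
  · exact hp.2.2.1 (by rename_i h'; exact absurd h'.symm h3.ne')
  · exact hp.2.1 (Or.inr (h5 h))

lemma conn_lc {G : SimpleGraph V} {u : V} {S : Set V} (hu : u ∉ S)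
    (h : ConnSet (localChordalize G u) S) : ConnSet G S := by
  intro a ha b hb
  obtain ⟨p, hp⟩ := h a ha b hb
  refine ⟨p.transfer G ?_, ?_⟩
  · intro e
    induction e with
    | _ x y =>
      intro he
      have h1 := hp x (p.fst_mem_support_of_mem_edges he)
      have h2 := hp y (p.snd_mem_support_of_mem_edges he)
      have hxu : x ≠ u := fun h => hu (h ▸ h1)
      have hyu : y ≠ u := fun h => hu (h ▸ h2)
      exact (lc_adj_ne hxu hyu).1 (p.adj_of_mem_edges he)
  · simpa using hp

/-- No hole of the local chordalization contains `u`. -/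
lemma lc_not_mem {G : SimpleGraph V} {u c : V} (hNC : VertexNC G u)
    {w : (localChordalize G u).Walk c c} (hw : IsHole (localChordalize G u) w) :
    u ∉ w.support := by
  intro hu
  obtain ⟨x, q, hx, hq, hux, hxq, hqu, huq⟩ := exists_dist_two hw hu
  have main : ∀ L R, Split (localChordalize G u) w.support w.edges u q L R → x ∈ L → False := by
    intro L R hsp hxL
    obtain ⟨y, hy, huy, -⟩ := hsp.uaR
    obtain ⟨z, hz, hqz, -⟩ := hsp.xaR
    exact core hNC hux huy hqu huq ((lc_adj_ne hux.ne' hqu).1 hxq) (conn_lc hsp.uR hsp.connR)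
      hsp.uR (hsp.dis x hxL) (fun z hz h => hsp.no x hxL z hz (le_lc G u h)) hy
      ⟨z, hz, (lc_adj_ne hqu (fun h => hsp.uR (h ▸ hz))).1 hqz⟩
  obtain ⟨L, R, hsp⟩ := exists_split hw hu hq hqu.symm huq
  rcases (hsp.mem x).1 hx with h | h | h | h
  · exact hux.ne' h
  · exact hxq.ne h
  · exact main L R hsp h
  · exact main R L hsp.swap h

/-- Holes of the local chordalization are holes of `G`. -/
lemma lc_hole {G : SimpleGraph V} {u c : V} (hNC : VertexNC G u)
    {w : (localChordalize G u).Walk c c} (hw : IsHole (localChordalize G u) w) :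
    ∃ w' : G.Walk c c, IsHole G w' ∧ w'.support = w.support ∧ w'.edges = w.edges := by
  have hu := lc_not_mem hNC hw
  have hE : ∀ e ∈ w.edges, e ∈ G.edgeSet := by
    intro e
    induction e with
    | _ x y =>
      intro he
      have h1 := w.fst_mem_support_of_mem_edges he
      have h2 := w.snd_mem_support_of_mem_edges he
      have hxu : x ≠ u := fun h => hu (h ▸ h1)
      have hyu : y ≠ u := fun h => hu (h ▸ h2)
      exact (lc_adj_ne hxu hyu).1 (w.adj_of_mem_edges he)
  refine ⟨w.transfer G hE, ⟨hw.1.transfer hE, ?_, ?_⟩, ?_, ?_⟩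
  · simpa using hw.2.1
  · intro x y hx hy hxy
    rw [Walk.support_transfer] at hx hy
    rw [Walk.edges_transfer]
    exact hw.2.2 x y hx hy (le_lc G u hxy)
  · simp
  · simp

lemma lc_vertexNC {G : SimpleGraph V} {u v : V} (hu : VertexNC G u) (hv : VertexNC G v) :
    VertexNC (localChordalize G u) v := by
  intro a b w₁ w₂ h₁ h₂ hv₁ hv₂
  obtain ⟨w₁', h₁', s₁, e₁⟩ := lc_hole hu h₁
  obtain ⟨w₂', h₂', s₂, e₂⟩ := lc_hole hu h₂
  rw [← e₁, ← e₂]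
  exact hv a b w₁' w₂' h₁' h₂' (s₁ ▸ hv₁) (s₂ ▸ hv₂)

/-- New edges come from holes of `G`. -/
lemma new_edge (l : List V) : ∀ (G : SimpleGraph V), (∀ u ∈ l, VertexNC G u) → ∀ x y : V,
    (chordalizeList G l).Adj x y → G.Adj x y ∨
      ∃ (a : V) (w : G.Walk a a), IsHole G w ∧ x ∈ w.support ∧ y ∈ w.support := by
  induction l with
  | nil => intro G _ x y h; exact Or.inl h
  | cons u l ih =>
    intro G hG x y h
    have hu := hG u (by simp)
    rcases ih (localChordalize G u)
      (fun v hv => lc_vertexNC hu (hG v (by simp [hv]))) x y h with h | ⟨a, w, hw, hx, hy⟩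
    · by_cases hxu : x = u
      · subst hxu
        exact (lc_adj_u.1 h).imp id And.right
      · by_cases hyu : y = u
        · subst hyu
          rcases lc_adj_u.1 h.symm with h | ⟨-, a, w, hw, h1, h2⟩
          · exact Or.inl h.symm
          · exact Or.inr ⟨a, w, hw, h2, h1⟩
        · exact Or.inl ((lc_adj_ne hxu hyu).1 h)
    · obtain ⟨w', hw', s', -⟩ := lc_hole hu hw
      exact Or.inr ⟨a, w', hw', s' ▸ hx, s' ▸ hy⟩

/-- An arm of a hole through `u` and `v` not touched by the vertex `w`. -/
lemma exists_free_arm {G : SimpleGraph V} {u v w c : V} (hNC : VertexNC G u) {p : G.Walk c c}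
    (hp : IsHole G p) (hu : u ∈ p.support) (hv : v ∈ p.support) (huv : u ≠ v)
    (huv' : ¬ G.Adj u v) (hwu : u ≠ w) (hwv : v ≠ w) (hwv' : ¬ G.Adj v w) :
    ∃ L R, Split G p.support p.edges u v L R ∧ w ∉ L ∧ ∀ z ∈ L, ¬ G.Adj z w := by
  obtain ⟨L, R, hsp⟩ := exists_split hp hu hv huv huv'
  by_cases hA : ∃ t ∈ ({w} : Set V), ∃ z ∈ L, t = z ∨ G.Adj z t
  · by_cases hB : ∃ t ∈ ({w} : Set V), ∃ z ∈ R, t = z ∨ G.Adj z t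
    · exact (star hNC hp hsp huv (ConnSet.singleton G w) hwu hwv
        (by rintro z rfl; exact hwv') hA hB).elim
    · exact ⟨R, L, hsp.swap, fun h => hB ⟨w, rfl, w, h, Or.inl rfl⟩,
        fun z hz h => hB ⟨w, rfl, z, hz, Or.inr h⟩⟩
  · exact ⟨L, R, hsp, fun h => hA ⟨w, rfl, w, h, Or.inl rfl⟩,
        fun z hz h => hA ⟨w, rfl, z, hz, Or.inr h⟩⟩

end NCaux

/-- in `Ĝ(C)`, if `u, w ∈ C` are adjacent in `G`, then a newly added
edge at `u` and a newly added edge at `w` are never adjacent (no common endpoint `v`). -/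
theorem stmt6 {V : Type*} [Fintype V] [DecidableEq V] (G : SimpleGraph V) (C : Set V)
    (hcov : IsHoleCover G C) (hNC : SetNC G C)
    (l : List V) (hl : l.Nodup) (hlC : {v | v ∈ l} = C)
    (u w : V) (hu : u ∈ C) (hw : w ∈ C) (huw : G.Adj u w) :
    ¬ ∃ v : V, ((chordalizeList G l).Adj u v ∧ ¬ G.Adj u v) ∧
        ((chordalizeList G l).Adj w v ∧ ¬ G.Adj w v) := by
  rintro ⟨v, ⟨huv, huv'⟩, ⟨hwv, hwv'⟩⟩
  have hNCl : ∀ z ∈ l, VertexNC G z := fun z hz => hNC.1 z (by rw [← hlC]; exact hz)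
  obtain ⟨c₁, p₁, hp₁, hup₁, hvp₁⟩ := (NCaux.new_edge l G hNCl u v huv).resolve_left huv'
  obtain ⟨c₂, p₂, hp₂, hwp₂, hvp₂⟩ := (NCaux.new_edge l G hNCl w v hwv).resolve_left hwv'
  obtain ⟨L₁, R₁, hs₁, hwL, hwL'⟩ := NCaux.exists_free_arm (w := w) (hNC.1 u hu) hp₁ hup₁ hvp₁
    huv.ne huv' huw.ne hwv.ne' (fun h => hwv' h.symm)
  obtain ⟨L₂, R₂, hs₂, huL, huL'⟩ := NCaux.exists_free_arm (w := u) (hNC.1 w hw) hp₂ hwp₂ hvp₂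
    hwv.ne hwv' huw.ne' huv.ne' (fun h => huv' h.symm)
  obtain ⟨a, haL, hua, hau⟩ := hs₁.uaL
  obtain ⟨a', haL', hva', -, -⟩ := hs₁.xaL
  obtain ⟨b, hbL, hwb, -⟩ := hs₂.uaL
  obtain ⟨b', hbL', hvb', -, -⟩ := hs₂.xaL
  have hc := (((hs₁.connL.union (NCaux.ConnSet.singleton G v) haL' rfl hva'.symm).union
    hs₂.connL (Or.inr rfl) hbL' hvb').union (NCaux.ConnSet.singleton G w) (Or.inr hbL) rfl hwb.symm)
    a (Or.inl (Or.inl (Or.inl haL))) w (Or.inr rfl)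
  obtain ⟨m, p, hm, hp, hps, -, -⟩ := NCaux.exists_hole (x := u) (by
      rintro (((h | h) | h) | h)
      · exact hs₁.uL h
      · exact huv.ne h
      · exact huL h
      · exact huw.ne h) hua huw (fun h => hwL (h ▸ haL)) (hwL' a haL) (by
      rintro z (((h | h) | h) | h) huz
      · exact Or.inl (hau z h huz)
      · rw [Set.mem_singleton_iff] at h
        exact absurd (h ▸ huz) huv'
      · exact absurd huz.symm (huL' z h)
      · exact Or.inr h) hc
  exact huw.ne (hNC.2 u p hp u hu w hw ((hps u).2 (Or.inl rfl))
    ((hps w).2 (Or.inr m.end_mem_support)))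
end
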